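/- Let n ≥ 2, let k be an integer with 1 ≤ k ≤ n, let β > 1/k and α ≤ 1 − kβ, and let f : S^n → (0,∞) be smooth. Let u be a solution of the normalised anisotropic flow on S^n × [0,T). Then η(t) is non-increasing in t, and there exist constants 0 < c ≤ C, depending only on f, α, β and u(·,0), such that c ≤ η(t) ≤ C for all t ∈ [0,T). -/

import Mathlib

open MeasureTheory Filter
open scoped RealInnerProductSpace Topology

noncomputable section

/-- Euclidean ambient space `ℝ^{n+1}`. -/
abbrev Eu (n : ℕ) : Type := EuclideanSpace ℝ (Fin (n + 1))

/-- The unit sphere `S^n ⊆ ℝ^{n+1}`. -/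
def sph (n : ℕ) : Set (Eu n) := Metric.sphere (0 : Eu n) 1

/-- The 1-homogeneous extension `U(y) = |y|·u(y/|y|)` of a function on the sphere. -/
def homExt {n : ℕ} (u : Eu n → ℝ) (y : Eu n) : ℝ := ‖y‖ * u (‖y‖⁻¹ • y)

/-- The (Euclidean) Hessian of the 1-homogeneous extension, as an operator. -/
def hessOp {n : ℕ} (u : Eu n → ℝ) (x : Eu n) : Eu n →L[ℝ] Eu n :=
  fderiv ℝ (gradient (homExt u)) x

/-- The `k`-th elementary symmetric function of the eigenvalues of an endomorphism of
`ℝ^{n+1}`, read off from the coefficients of the characteristic polynomial. -/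
def esymmOp (n k : ℕ) (T : Eu n →ₗ[ℝ] Eu n) : ℝ :=
  (-1 : ℝ) ^ k * (LinearMap.charpoly T).coeff (n + 1 - k)

/-- `σ_k`, the `k`-th elementary symmetric function of the principal curvature radii,
i.e. of the eigenvalues of `W_u(x)`; since the Hessian of the 1-homogeneous extension
kills the radial direction, this agrees with the `k`-th elementary symmetric function of
all its eigenvalues. -/
def sigmaK (n k : ℕ) (u : Eu n → ℝ) (x : Eu n) : ℝ :=
  esymmOp n k (hessOp u x).toLinearMap

/-- Smoothness on the sphere, expressed via the 1-homogeneous extension. -/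
def SmoothOnSphere {n : ℕ} (u : Eu n → ℝ) : Prop :=
  ContDiffOn ℝ (⊤ : ℕ∞) (homExt u) {(0 : Eu n)}ᶜ

def PosOnSphere {n : ℕ} (u : Eu n → ℝ) : Prop := ∀ x ∈ sph n, 0 < u x

/-- Uniform convexity: `W_u(x)` is positive definite on the tangent hyperplane `x^⊥`. -/
def UnifConvex {n : ℕ} (u : Eu n → ℝ) : Prop :=
  ∀ x ∈ sph n, ∀ v : Eu n, ⟪x, v⟫ = 0 → v ≠ 0 → 0 < ⟪v, hessOp u x v⟫

/-- `u` is the support function of a smooth, closed, uniformly convex hypersurface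
enclosing the origin. -/
def GoodSph {n : ℕ} (u : Eu n → ℝ) : Prop :=
  SmoothOnSphere u ∧ PosOnSphere u ∧ UnifConvex u

/-- Integration over the sphere with respect to the surface (n-dimensional Hausdorff)
measure. -/
def sphInt (n : ℕ) (g : Eu n → ℝ) : ℝ :=
  ∫ x in sph n, g x ∂(Measure.hausdorffMeasure (n : ℝ))

/-- `|S^n|`. -/
def sphVol (n : ℕ) : ℝ := (Measure.hausdorffMeasure (n : ℝ) (sph n)).toReal

/-- The spherical gradient `∇u(x) = DU(x) − u(x)·x`. -/
def sphGrad {n : ℕ} (u : Eu n → ℝ) (x : Eu n) : Eu n :=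
  gradient (homExt u) x - u x • x

/-- The (unnormalised) anisotropic expanding flow `∂_t u = f u^α σ_k^β` on the time set `s`. -/
def ExpFlow (n k : ℕ) (α β : ℝ) (f : Eu n → ℝ) (s : Set ℝ) (u : ℝ → Eu n → ℝ) : Prop :=
  (∀ t ∈ s, GoodSph (u t)) ∧
  ∀ x ∈ sph n, ∀ t ∈ s,
    HasDerivWithinAt (fun r => u r x)
      (f x * u t x ^ α * sigmaK n k (u t) x ^ β) s t

/-- The global term `η(t) = |S^n|⁻¹ ∫ f u^α σ_k^{1+β}` of the normalised anisotropic flow. -/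
def eta (n k : ℕ) (α β : ℝ) (f v : Eu n → ℝ) : ℝ :=
  (sphVol n)⁻¹ * sphInt n (fun x => f x * v x ^ α * sigmaK n k v x ^ (1 + β))

/-- The normalised anisotropic flow `∂_t u = f u^α σ_k^β − η(t) u` on the time set `s`,
with the initial normalisation `∫ u σ_k = |S^n|`. -/
def NormFlow (n k : ℕ) (α β : ℝ) (f : Eu n → ℝ) (s : Set ℝ) (u : ℝ → Eu n → ℝ) : Prop :=
  (∀ t ∈ s, GoodSph (u t)) ∧
  sphInt n (fun x => u 0 x * sigmaK n k (u 0) x) = sphVol n ∧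
  ∀ x ∈ sph n, ∀ t ∈ s,
    HasDerivWithinAt (fun r => u r x)
      (f x * u t x ^ α * sigmaK n k (u t) x ^ β - eta n k α β f (u t) * u t x) s t

/-- The normalised isotropic (`f ≡ 1`) flow `∂_t u = u^α σ_k^β − γ u`, where
`γ = C(n,k)^β`. -/
def IsoNormFlow (n k : ℕ) (α β : ℝ) (s : Set ℝ) (u : ℝ → Eu n → ℝ) : Prop :=
  (∀ t ∈ s, GoodSph (u t)) ∧
  ∀ x ∈ sph n, ∀ t ∈ s,
    HasDerivWithinAt (fun r => u r x)
      (u t x ^ α * sigmaK n k (u t) x ^ β - (n.choose k : ℝ) ^ β * u t x) s t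

variable {n m : ℕ}
def mu (n : ℕ) : Measure (Eu n) := (Measure.hausdorffMeasure (n : ℝ)).restrict (sph n)
theorem sph_compact (n : ℕ) : IsCompact (sph n) := isCompact_sphere _ _
theorem sph_meas (n : ℕ) : MeasurableSet (sph n) := (sph_compact n).measurableSet
theorem mem_sph {x : Eu n} : x ∈ sph n ↔ ‖x‖ = 1 := by simp [sph]
theorem sph_ne {x : Eu n} (h : x ∈ sph n) : x ≠ 0 := by
  rintro rfl; simp [mem_sph] at h
theorem sph_finite (n : ℕ) : Measure.hausdorffMeasure (n : ℝ) (sph n) < ⊤ := by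
  let ψ : Fin (n+1) → ℝ → (Fin n → ℝ) → Eu n := fun i s z =>
    WithLp.toLp 2 (Fin.insertNth (α := fun _ => ℝ) i s z)
  let φ : Fin (n+1) → ℝ → (Fin n → ℝ) → Eu n := fun i s z => ‖ψ i s z‖⁻¹ • ψ i s z
  let Q : Set (Fin n → ℝ) := Metric.closedBall 0 1
  have hsub : sph n ⊆ ⋃ i : Fin (n+1), (φ i 1 '' Q ∪ φ i (-1) '' Q) := by
    intro x hx
    obtain ⟨i, -, hi⟩ := Finset.exists_max_image (Finset.univ : Finset (Fin (n+1)))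
      (fun j => |x j|) ⟨0, Finset.mem_univ _⟩
    have hi0 : x i ≠ 0 := by
      intro h
      apply sph_ne hx
      ext j
      have := hi j (Finset.mem_univ _)
      rw [h, abs_zero] at this
      simpa using abs_nonpos_iff.mp this
    have hpos : 0 < |x i| := abs_pos.mpr hi0
    have key : ∀ s : ℝ, s * |x i| = x i → φ i s (fun j => x (i.succAbove j) / |x i|) = x := by
      intro s hs
      have h1 : ψ i s (fun j => x (i.succAbove j) / |x i|) = |x i|⁻¹ • x := by
        ext j
        rcases Fin.eq_self_or_eq_succAbove i j with h | ⟨m, h⟩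
        · subst h
          simp only [ψ, Fin.insertNth_apply_same, PiLp.smul_apply, smul_eq_mul]
          rw [inv_mul_eq_div, eq_div_iff hpos.ne']; exact hs
        · subst h
          simp only [ψ, Fin.insertNth_apply_succAbove, PiLp.smul_apply, smul_eq_mul]
          rw [inv_mul_eq_div]
      simp only [φ, h1, norm_smul, mem_sph.mp hx, norm_inv, norm_abs_eq_norm, Real.norm_eq_abs,
        mul_one, inv_inv, smul_smul]
      rw [mul_inv_cancel₀ hpos.ne', one_smul]
    have hQ : (fun j => x (i.succAbove j) / |x i|) ∈ Q := by
      simp only [Q, mem_closedBall_zero_iff, pi_norm_le_iff_of_nonneg zero_le_one]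
      intro j
      rw [Real.norm_eq_abs, abs_div, abs_abs]
      exact div_le_one_of_le₀ (hi _ (Finset.mem_univ _)) hpos.le
    rw [Set.mem_iUnion]
    refine ⟨i, ?_⟩
    rcases abs_choice (x i) with h | h
    · exact Or.inl ⟨_, hQ, key 1 (by rw [one_mul, h])⟩
    · exact Or.inr ⟨_, hQ, key (-1) (by linarith)⟩
  have hfin : ∀ i s, s ≠ 0 → Measure.hausdorffMeasure (n : ℝ) (φ i s '' Q) < ⊤ := by
    intro i s hs
    have hc : ContDiff ℝ 1 (ψ i s) := by
      have : ContDiff ℝ 1 (fun z : Fin n → ℝ => (Fin.insertNth (α := fun _ => ℝ) i s z)) := by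
        rw [contDiff_pi]
        intro j
        rcases Fin.eq_self_or_eq_succAbove i j with h | ⟨m, h⟩
        · subst h; simp only [Fin.insertNth_apply_same]; exact contDiff_const
        · subst h; simp only [Fin.insertNth_apply_succAbove]; exact contDiff_apply _ _ m
      exact (PiLp.continuousLinearEquiv 2 ℝ (fun _ : Fin (n+1) => ℝ)).symm.contDiff.comp this
    have hne : ∀ z, ψ i s z ≠ 0 := by
      intro z h
      apply hs
      have := congrArg (fun y : Eu n => y i) h
      simpa [ψ] using this
    have hc2 : ContDiff ℝ 1 (φ i s) :=
      ((hc.norm ℝ hne).inv (fun z => norm_ne_zero_iff.mpr (hne z))).smul hc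
    obtain ⟨K, hK⟩ := hc2.contDiffOn.exists_lipschitzOnWith one_ne_zero
      (convex_closedBall (0 : Fin n → ℝ) 1) (isCompact_closedBall (0 : Fin n → ℝ) 1)
    refine (hK.hausdorffMeasure_image_le (Nat.cast_nonneg n)).trans_lt ?_
    have := hausdorffMeasure_pi_real (ι := Fin n)
    rw [Fintype.card_fin] at this
    rw [this]
    exact ENNReal.mul_lt_top (by simp) (isCompact_closedBall _ _).measure_lt_top
  refine (measure_mono hsub).trans_lt ((measure_iUnion_le _).trans_lt ?_)
  rw [tsum_fintype]
  refine ENNReal.sum_lt_top.mpr fun i _ => (measure_union_le _ _).trans_lt ?_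
  exact ENNReal.add_lt_top.mpr ⟨hfin i 1 one_ne_zero, hfin i (-1) (by norm_num)⟩
instance (n : ℕ) : IsFiniteMeasure (mu n) := ⟨by
  rw [mu, Measure.restrict_apply_univ]; exact sph_finite n⟩
theorem sph_pos (n : ℕ) : 0 < Measure.hausdorffMeasure (n : ℝ) (sph n) := by
  let π : Eu n → (Fin n → ℝ) := fun x j => x j.succ
  have hL : LipschitzWith 1 π := by
    refine LipschitzWith.of_dist_le_mul fun x y => ?_
    rw [NNReal.coe_one, one_mul, dist_pi_le_iff dist_nonneg]
    intro j
    rw [dist_eq_norm, dist_eq_norm]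
    exact PiLp.norm_apply_le (x - y) j.succ
  have h1 := hL.hausdorffMeasure_image_le (Nat.cast_nonneg n : (0:ℝ) ≤ n) (sph n)
  have h2 : Metric.ball (0 : Fin n → ℝ) (1/(n+1)) ⊆ π '' sph n := by
    intro z hz
    rw [mem_ball_zero_iff] at hz
    have hs : ∑ j, z j ^ 2 ≤ 1 := by
      have : ∀ j ∈ Finset.univ, z j ^ 2 ≤ 1/((n:ℝ)+1) := by
        intro j _
        have h3 : |z j| < 1/((n:ℝ)+1) := (norm_le_pi_norm z j).trans_lt hz
        have h4 : 1/((n:ℝ)+1) ≤ 1 := by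
          rw [div_le_one (by positivity)]; linarith [(Nat.cast_nonneg n : (0:ℝ) ≤ n)]
        rw [← sq_abs]
        nlinarith [abs_nonneg (z j)]
      refine (Finset.sum_le_sum this).trans ?_
      rw [Finset.sum_const, Finset.card_univ, Fintype.card_fin, nsmul_eq_mul, mul_one_div,
        div_le_one (by positivity)]
      linarith
    refine ⟨WithLp.toLp 2 (Fin.cons (Real.sqrt (1 - ∑ j, z j ^ 2)) z), ?_, ?_⟩
    · rw [mem_sph, EuclideanSpace.norm_eq, Fin.sum_univ_succ]
      simp only [Fin.cons_zero, Fin.cons_succ, Real.norm_eq_abs, sq_abs]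
      rw [Real.sq_sqrt (by linarith)]
      simp
    · ext j; simp [π]
  have h3 := hausdorffMeasure_pi_real (ι := Fin n)
  rw [Fintype.card_fin] at h3
  rw [h3] at h1
  have h4 : 0 < volume (Metric.ball (0 : Fin n → ℝ) (1/(n+1))) :=
    Metric.measure_ball_pos _ _ (by positivity)
  have h5 := h4.trans_le ((measure_mono h2).trans h1)
  simpa using h5
theorem sphVol_pos (n : ℕ) : 0 < sphVol n :=
  ENNReal.toReal_pos (sph_pos n).ne' (sph_finite n).ne
theorem sphInt_eq (n : ℕ) (g : Eu n → ℝ) : sphInt n g = ∫ x, g x ∂(mu n) := rfl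
theorem sphVol_eq (n : ℕ) : sphVol n = ∫ _x, (1:ℝ) ∂(mu n) := by
  rw [integral_const, smul_eq_mul, mul_one, mu, Measure.real, Measure.restrict_apply_univ]; rfl
theorem ae_sph (n : ℕ) : ∀ᵐ x ∂(mu n), x ∈ sph n := ae_restrict_mem (sph_meas n)
theorem int_congr {g h : Eu n → ℝ} (H : ∀ x ∈ sph n, g x = h x) :
    ∫ x, g x ∂(mu n) = ∫ x, h x ∂(mu n) :=
  integral_congr_ae (by filter_upwards [ae_sph n] with x hx using H x hx)
theorem intg {g : Eu n → ℝ} (H : ContinuousOn g (sph n)) : Integrable g (mu n) := by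
  obtain ⟨C, hC⟩ := (sph_compact n).exists_bound_of_continuousOn H
  refine Integrable.mono' (integrable_const C) (H.aestronglyMeasurable (sph_meas n)) ?_
  filter_upwards [ae_sph n] with x hx using hC x hx
theorem int_mono {g h : Eu n → ℝ} (hg : ContinuousOn g (sph n)) (hh : ContinuousOn h (sph n))
    (H : ∀ x ∈ sph n, g x ≤ h x) : ∫ x, g x ∂(mu n) ≤ ∫ x, h x ∂(mu n) :=
  integral_mono_ae (intg hg) (intg hh) (by filter_upwards [ae_sph n] with x hx using H x hx)
theorem int_nonneg {g : Eu n → ℝ} (H : ∀ x ∈ sph n, 0 ≤ g x) :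
    0 ≤ ∫ x, g x ∂(mu n) :=
  integral_nonneg_of_ae (by filter_upwards [ae_sph n] with x hx using H x hx)
theorem mu_iso (e : Eu n ≃ₗᵢ[ℝ] Eu n) : MeasurePreserving e (mu n) (mu n) := by
  have h := (e.toIsometryEquiv.measurePreserving_hausdorffMeasure (n:ℝ)).restrict_preimage
    (sph_meas n)
  have h2 : e.toIsometryEquiv ⁻¹' (sph n) = sph n := by
    ext x; simp [mem_sph]
  rw [h2] at h
  exact h
theorem int_iso (e : Eu n ≃ₗᵢ[ℝ] Eu n) (g : Eu n → ℝ) :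
    ∫ x, g (e x) ∂(mu n) = ∫ x, g x ∂(mu n) :=
  (mu_iso e).integral_comp e.toHomeomorph.measurableEmbedding g
theorem mu_support {g : Eu n → ℝ} (hg : ContinuousOn g (sph n)) (h0 : ∀ x ∈ sph n, 0 ≤ g x)
    (hi : ∫ x, g x ∂(mu n) = 0) : ∀ x ∈ sph n, g x = 0 := by
  intro x hx
  by_contra hne
  have hpos : 0 < g x := lt_of_le_of_ne (h0 x hx) (Ne.symm hne)
  have hae : ∀ᵐ y ∂(mu n), g y = 0 := by
    have := (integral_eq_zero_iff_of_nonneg_ae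
      (by filter_upwards [ae_sph n] with y hy using h0 y hy) (intg hg)).mp hi
    filter_upwards [this] with y hy using hy
  have h1 := hg x hx
  rw [Metric.continuousWithinAt_iff] at h1
  obtain ⟨δ, hδ, h2⟩ := h1 (g x) hpos
  have hb : (mu n) (Metric.ball x δ) = 0 := by
    refine measure_mono_null (t := {y | ¬ (y ∈ sph n ∧ g y = 0)}) ?_ ?_
    · rintro y hy ⟨hys, hy0⟩
      have := h2 hys hy
      rw [hy0, dist_zero_left, Real.norm_eq_abs, abs_of_pos hpos] at this
      exact lt_irrefl _ this
    · have : ∀ᵐ y ∂(mu n), y ∈ sph n ∧ g y = 0 := (ae_sph n).and hae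
      exact this
  have hball : ∀ y ∈ sph n, (mu n) (Metric.ball y δ) = 0 := by
    intro y hy
    let e := (ℝ ∙ (x - y))ᗮ.reflection
    have he : e x = y := Submodule.reflection_sub (by rw [mem_sph.mp hx, mem_sph.mp hy])
    have := (mu_iso e).measure_preimage (Metric.isOpen_ball (x := y) (ε := δ)).measurableSet.nullMeasurableSet
    rw [← this, ← he, LinearIsometryEquiv.preimage_ball]
    simpa using hb
  obtain ⟨t, ht1, ht2⟩ := (sph_compact n).elim_nhds_subcover (fun y => Metric.ball y δ)
    (fun y _ => Metric.ball_mem_nhds y hδ)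
  have h3 : (mu n) (sph n) = 0 :=
    measure_mono_null ht2 ((measure_biUnion_null_iff t.countable_toSet).mpr
      fun y hy => hball y (ht1 y hy))
  have h4 := sph_pos n
  rw [mu, Measure.restrict_apply_self] at h3
  exact h4.ne' h3
theorem int_rot (J : Eu n →L[ℝ] Eu n) (hJ : ∀ x, ⟪x, J x⟫ = 0) (F : Eu n → ℝ)
    (hF : ContDiffOn ℝ 1 F {0}ᶜ) : ∫ x, fderiv ℝ F x (J x) ∂(mu n) = 0 := by
  let R : ℝ → Eu n →L[ℝ] Eu n := fun t => NormedSpace.exp (t • J)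
  have hR : ∀ t x, HasDerivAt (fun t => R t x) (J (R t x)) t := by
    intro t x
    have h := hasDerivAt_exp_smul_const' J t
    have := h.clm_apply (hasDerivAt_const t x)
    simpa using this
  have hR0 : ∀ x, R 0 x = x := by
    intro x
    have h : (0:ℝ) • J = 0 := by ext v; simp
    show (NormedSpace.exp ((0:ℝ) • J)) x = x
    rw [h, NormedSpace.exp_zero]; rfl
  have hnorm : ∀ t x, ‖R t x‖ = ‖x‖ := by
    intro t x
    have hd : ∀ t, HasDerivAt (fun t => ⟪R t x, R t x⟫) 0 t := by
      intro t
      have := (hR t x).inner ℝ (hR t x)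
      rw [real_inner_comm (R t x), hJ, add_zero] at this
      exact this
    have hc := is_const_of_deriv_eq_zero (fun t => (hd t).differentiableAt)
      (fun t => (hd t).deriv) t 0
    simp only [hR0, real_inner_self_eq_norm_sq] at hc
    exact (sq_eq_sq₀ (norm_nonneg _) (norm_nonneg _)).mp hc
  have hinv : ∀ t, ∫ x, F (R t x) ∂(mu n) = ∫ x, F x ∂(mu n) := by
    intro t
    let l : Eu n →ₗᵢ[ℝ] Eu n := ⟨(R t).toLinearMap, hnorm t⟩
    exact int_iso (l.toLinearIsometryEquiv rfl) F
  have hop : IsOpen ({0}ᶜ : Set (Eu n)) := isOpen_compl_singleton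
  have hdiff : ∀ y : Eu n, y ≠ 0 → HasFDerivAt F (fderiv ℝ F y) y := fun y hy =>
    ((hF.differentiableOn one_ne_zero).differentiableAt (hop.mem_nhds hy)).hasFDerivAt
  have hcont : ContinuousOn (fun y => fderiv ℝ F y (J y)) (sph n) :=
    (((hF.continuousOn_fderiv_of_isOpen hop le_rfl).mono (fun y hy => sph_ne hy))).clm_apply
      J.continuous.continuousOn
  obtain ⟨C, hC⟩ := (sph_compact n).exists_bound_of_continuousOn hcont
  have hmem : ∀ t, ∀ x ∈ sph n, R t x ∈ sph n := fun t x hx => by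
    rw [mem_sph] at *; rw [hnorm, hx]
  have hFc : ContinuousOn F (sph n) := hF.continuousOn.mono (fun y hy => sph_ne hy)
  have key := hasDerivAt_integral_of_dominated_loc_of_deriv_le (μ := mu n) (x₀ := (0:ℝ))
    (F := fun t x => F (R t x)) (F' := fun t x => fderiv ℝ F (R t x) (J (R t x)))
    (bound := fun _ => C) (Filter.univ_mem (f := 𝓝 (0:ℝ)))
    (Eventually.of_forall fun t =>
      (intg (hFc.comp (R t).continuous.continuousOn (hmem t))).aestronglyMeasurable)
    (intg (hFc.comp (R 0).continuous.continuousOn (hmem 0)))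
    (intg (hcont.comp (R 0).continuous.continuousOn (hmem 0))).aestronglyMeasurable
    (by filter_upwards [ae_sph n] with x hx t _ using hC _ (hmem t x hx))
    (integrable_const C)
    (by filter_upwards [ae_sph n] with x hx t _ using
          (hdiff _ (sph_ne (hmem t x hx))).comp_hasDerivAt t (hR t x))
  have h2 := key.2
  simp only [hinv, hR0] at h2
  exact h2.unique (hasDerivAt_const _ _)
def bv {n : ℕ} (i : Fin (n+1)) : Eu n := EuclideanSpace.single i 1
def pd {n : ℕ} (i : Fin (n+1)) (F : Eu n → ℝ) (y : Eu n) : ℝ := fderiv ℝ F y (bv i)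
theorem pd_mul (i : Fin (n+1)) {F G : Eu n → ℝ} {y : Eu n} (hF : DifferentiableAt ℝ F y)
    (hG : DifferentiableAt ℝ G y) : pd i (fun y => F y * G y) y = F y * pd i G y + pd i F y * G y := by
  simp only [pd]; rw [fderiv_fun_mul hF hG]; simp [mul_comm]
theorem pd_coord (i j : Fin (n+1)) (y : Eu n) :
    pd i (fun y : Eu n => y j) y = if i = j then 1 else 0 := by
  have : (fun y : Eu n => y j) = (EuclideanSpace.proj j : Eu n →L[ℝ] ℝ) := rfl
  rw [pd, this, ContinuousLinearMap.fderiv]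
  simp [bv, eq_comm]
theorem diff_coord (j : Fin (n+1)) (y : Eu n) : DifferentiableAt ℝ (fun y : Eu n => y j) y :=
  (EuclideanSpace.proj j : Eu n →L[ℝ] ℝ).differentiableAt
theorem pd_sum {ι : Type*} (s : Finset ι) (i : Fin (n+1)) {F : ι → Eu n → ℝ} {y : Eu n}
    (hF : ∀ j ∈ s, DifferentiableAt ℝ (F j) y) :
    pd i (fun y => ∑ j ∈ s, F j y) y = ∑ j ∈ s, pd i (F j) y := by
  simp only [pd]; rw [fderiv_fun_sum hF]; simp
theorem sum_sq_sph {x : Eu n} (hx : x ∈ sph n) : ∑ i, x i * x i = 1 := by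
  have := EuclideanSpace.real_norm_sq_eq x
  rw [mem_sph.mp hx] at this
  simp only [← sq]; linarith
theorem div_thm (Z : Fin (n+1) → Eu n → ℝ) (hZ : ∀ j, ContDiffOn ℝ 1 (Z j) {0}ᶜ)
    (ht : ∀ y : Eu n, y ≠ 0 → ∑ j, y j * Z j y = 0) :
    ∫ x, ∑ j, pd j (Z j) x ∂(mu n) = 0 := by
  have hop : IsOpen ({0}ᶜ : Set (Eu n)) := isOpen_compl_singleton
  have hcd : ∀ i j, ContDiffOn ℝ 1 (fun y : Eu n => y i * Z j y) {0}ᶜ := fun i j =>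
    ((EuclideanSpace.proj i : Eu n →L[ℝ] ℝ).contDiff.contDiffOn).mul (hZ j)
  have hdf : ∀ j (y : Eu n), y ≠ 0 → DifferentiableAt ℝ (Z j) y := fun j y hy =>
    ((hZ j).differentiableOn one_ne_zero).differentiableAt (hop.mem_nhds hy)
  let J : Fin (n+1) → Fin (n+1) → Eu n →L[ℝ] Eu n := fun i j =>
    (EuclideanSpace.proj i : Eu n →L[ℝ] ℝ).smulRight (bv j) -
    (EuclideanSpace.proj j : Eu n →L[ℝ] ℝ).smulRight (bv i)
  have hJ : ∀ i j x, ⟪x, J i j x⟫ = 0 := by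
    intro i j x
    simp [J, inner_sub_right, inner_smul_right, bv, EuclideanSpace.inner_single_right, mul_comm]
  have h0 : ∀ i j, ∫ x, fderiv ℝ (fun y : Eu n => y i * Z j y) x (J i j x) ∂(mu n) = 0 :=
    fun i j => int_rot (J i j) (hJ i j) _ (hcd i j)
  have hint : ∀ i j, Integrable (fun x => fderiv ℝ (fun y : Eu n => y i * Z j y) x (J i j x)) (mu n) :=
    fun i j => intg ((((hcd i j).continuousOn_fderiv_of_isOpen hop le_rfl).mono
      (fun y hy => sph_ne hy)).clm_apply (J i j).continuous.continuousOn)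
  have hs : ∫ x, ∑ i, ∑ j, fderiv ℝ (fun y : Eu n => y i * Z j y) x (J i j x) ∂(mu n) = 0 := by
    rw [integral_finsetSum _ (fun i _ => integrable_finsetSum _ (fun j _ => hint i j))]
    refine Finset.sum_eq_zero fun i _ => ?_
    rw [integral_finsetSum _ (fun j _ => hint i j)]
    exact Finset.sum_eq_zero fun j _ => h0 i j
  rw [← hs]
  refine int_congr fun x hx => ?_
  have hx0 := sph_ne hx
  have e1 : ∀ i j, fderiv ℝ (fun y : Eu n => y i * Z j y) x (J i j x)
      = x i * ((if j = i then 1 else 0) * Z j x) + x i * x i * pd j (Z j) x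
        - x j * Z j x - x i * (x j * pd i (Z j) x) := by
    intro i j
    have a1 := pd_mul j (diff_coord i x) (hdf j x hx0)
    have a2 := pd_mul i (diff_coord i x) (hdf j x hx0)
    rw [pd_coord] at a1 a2
    simp only [pd] at a1 a2 ⊢
    simp only [J, sub_apply, ContinuousLinearMap.smulRight_apply, map_sub,
      map_smul, smul_eq_mul, a1, a2, if_true]
    simp only [EuclideanSpace.proj, PiLp.proj_apply]; ring
  have e2 : ∀ i, ∑ j, x j * pd i (Z j) x = - Z i x := by
    intro i
    have h1 : pd i (fun y => ∑ j, y j * Z j y) x = 0 := by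
      have : (fun y : Eu n => ∑ j, y j * Z j y) =ᶠ[𝓝 x] fun _ => 0 := by
        filter_upwards [hop.mem_nhds hx0] with y hy using ht y hy
      rw [pd, this.fderiv_eq]; simp
    rw [pd_sum _ _ (fun j _ => (diff_coord j x).fun_mul (hdf j x hx0))] at h1
    have h2 : ∀ j, pd i (fun y : Eu n => y j * Z j y) x
        = x j * pd i (Z j) x + (if i = j then Z j x else 0) := by
      intro j; rw [pd_mul i (diff_coord j x) (hdf j x hx0), pd_coord]; split_ifs <;> simp
    simp only [h2, Finset.sum_add_distrib, Finset.sum_ite_eq, Finset.mem_univ, if_true] at h1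
    linarith
  simp only [e1, Finset.sum_sub_distrib, Finset.sum_add_distrib, ← Finset.mul_sum, e2, ht x hx0]
  simp only [ite_mul, one_mul, zero_mul, Finset.sum_ite_eq', Finset.mem_univ, if_true, mul_neg,
    Finset.sum_neg_distrib, ht x hx0]
  simp only [mul_assoc]
  simp [← mul_assoc, ← Finset.sum_mul, sum_sq_sph hx]
abbrev Mt (m : ℕ) := Fin m → Fin m → ℝ
abbrev Mat (m : ℕ) := Matrix (Fin m) (Fin m) ℝ
open Polynomial in
def es {m : ℕ} (k : ℕ) (A : Mt m) : ℝ :=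
  (Matrix.det ((X : ℝ[X]) • (Matrix.of A).map C + (1 : Matrix (Fin m) (Fin m) ℝ).map C)).coeff k
open Polynomial in
theorem esPoly_eval (A : Mat m) (s : ℝ) :
    (Matrix.det ((X : ℝ[X]) • A.map C + (1 : Mat m).map C)).eval s = (1 + s • A).det := by
  rw [← coe_evalRingHom, RingHom.map_det]
  congr 1
  ext i j
  simp [Matrix.one_apply]
  split_ifs <;> simp <;> ring
open Polynomial in
theorem es_interp (k : ℕ) {δ : ℝ} (hδ : δ ≠ 0) :
    ∃ c : Fin (m+1) → ℝ, ∀ A : Mt m,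
      es k A = ∑ l, c l * (1 + (δ * (l : ℝ)) • Matrix.of A).det := by
  classical
  let v : Fin (m+1) → ℝ := fun l => δ * (l : ℝ)
  have hv : Set.InjOn v (Finset.univ : Finset (Fin (m+1))) := by
    intro a _ b _ h
    simpa [v, hδ, Fin.ext_iff] using h
  refine ⟨fun l => (Lagrange.basis Finset.univ v l).coeff k, fun A => ?_⟩
  have hd : (Matrix.det ((X : ℝ[X]) • (Matrix.of A).map C + (1 : Mat m).map C)).degree
      < (Finset.univ : Finset (Fin (m+1))).card := by
    refine (degree_le_natDegree).trans_lt ?_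
    have := Polynomial.natDegree_det_X_add_C_le (Matrix.of A) (1 : Mat m)
    rw [Fintype.card_fin] at this
    rw [Finset.card_univ, Fintype.card_fin]
    exact_mod_cast Nat.lt_succ_of_le this
  have := Lagrange.eq_interpolate hv hd
  rw [es, this, Lagrange.interpolate_apply, finsetSum_coeff]
  refine Finset.sum_congr rfl fun l _ => ?_
  rw [coeff_C_mul, esPoly_eval, mul_comm]
def detCM (m : ℕ) : ContinuousMultilinearMap ℝ (fun _ : Fin m => Fin m → ℝ) ℝ :=
  { toMultilinearMap := (Matrix.detRowAlternating (R := ℝ) (n := Fin m)).toMultilinearMap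
    cont := by
      show Continuous fun A : Mt m => (Matrix.of A).det
      exact continuous_id.matrix_det }
theorem det_contDiff (m : ℕ) : ContDiff ℝ (⊤ : ℕ∞) (fun A : Mt m => (Matrix.of A).det) :=
  (detCM m).contDiff
theorem det_hasFDerivAt (B : Mt m) :
    ∃ L : Mt m →L[ℝ] ℝ, HasFDerivAt (fun A : Mt m => (Matrix.of A).det) L B ∧
      ∀ M, L M = ((Matrix.of B).adjugate * Matrix.of M).trace := by
  refine ⟨(detCM m).linearDeriv B, (detCM m).hasFDerivAt B, fun M => ?_⟩
  have h1 : (detCM m).linearDeriv B M = ∑ i, ((Matrix.of B).updateRow i (M i)).det := by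
    exact ContinuousMultilinearMap.linearDeriv_apply (detCM m) B M
  rw [h1, Matrix.trace_mul_comm, Matrix.trace]
  refine Finset.sum_congr rfl fun i _ => ?_
  have h2 := congrFun (Matrix.cramer_eq_adjugate_mulVec (Matrix.of B).transpose (M i)) i
  rw [Matrix.cramer_apply, Matrix.updateCol_transpose, Matrix.det_transpose] at h2
  rw [h2, Matrix.diag_apply, Matrix.mul_apply, ← Matrix.adjugate_transpose, Matrix.mulVec_transpose]
  rfl
theorem es_contDiff (k : ℕ) : ContDiff ℝ (⊤ : ℕ∞) (es k : Mt m → ℝ) := by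
  obtain ⟨c, hc⟩ := es_interp (m := m) k one_ne_zero
  rw [show (es k : Mt m → ℝ) = _ from funext hc]
  refine ContDiff.sum fun l _ => contDiff_const.mul ((det_contDiff m).comp ?_)
  exact contDiff_const.add (contDiff_id.const_smul _)
def eD {m : ℕ} (k : ℕ) (A M : Mt m) : ℝ := fderiv ℝ (es k) A M
def eDD {m : ℕ} (k : ℕ) (A M N : Mt m) : ℝ := fderiv ℝ (fderiv ℝ (es k)) A N M
theorem es_hasFDerivAt (k : ℕ) (A : Mt m) : HasFDerivAt (es k) (fderiv ℝ (es k) A) A :=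
  ((es_contDiff k).differentiable (by simp)).differentiableAt.hasFDerivAt
theorem esD_contDiff (k : ℕ) : ContDiff ℝ (⊤ : ℕ∞) (fderiv ℝ (es k : Mt m → ℝ)) :=
  (es_contDiff k).fderiv_right (by norm_cast)
theorem esD_hasFDerivAt (k : ℕ) (A : Mt m) :
    HasFDerivAt (fderiv ℝ (es k)) (fderiv ℝ (fderiv ℝ (es k)) A) A :=
  ((esD_contDiff k).differentiable (by simp)).differentiableAt.hasFDerivAt
theorem eDD_comm (k : ℕ) (A M N : Mt m) : eDD k A M N = eDD k A N M := by
  have := (es_contDiff (m := m) k).contDiffAt (x := A)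
  have h := this.isSymmSndFDerivAt (by rw [minSmoothness_of_isRCLikeNormedField]; exact WithTop.coe_le_coe.2 (le_top : (2:ℕ∞) ≤ ⊤))
  exact h N M
theorem eD_add (k : ℕ) (A M N : Mt m) : eD k A (M + N) = eD k A M + eD k A N := map_add _ _ _
theorem eD_smul (k : ℕ) (A M : Mt m) (r : ℝ) : eD k A (r • M) = r * eD k A M := map_smul _ _ _
theorem eD_sum {ι : Type*} (s : Finset ι) (k : ℕ) (A : Mt m) (M : ι → Mt m) :
    eD k A (∑ i ∈ s, M i) = ∑ i ∈ s, eD k A (M i) := map_sum _ _ _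
def op {m : ℕ} (v w : Fin m → ℝ) : Mt m := fun a b => v a * w b
def mm {m : ℕ} (A B : Mt m) : Mt m := fun i j => ∑ l, A i l * B l j
def tr {m : ℕ} (A : Mt m) : ℝ := ∑ i, A i i
open Polynomial in
theorem det_sum (A : Mt m) (s : ℝ) :
    (1 + s • Matrix.of A).det = ∑ k ∈ Finset.range (m+1), s ^ k * es k A := by
  rw [← esPoly_eval, eval_eq_sum_range' (n := m+1)]
  · exact Finset.sum_congr rfl fun k _ => mul_comm _ _
  · have := Polynomial.natDegree_det_X_add_C_le (Matrix.of A) (1 : Mat m)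
    rw [Fintype.card_fin] at this
    exact Nat.lt_succ_of_le this
open Polynomial in
theorem es_zero_of_lt {k : ℕ} (h : m < k) (A : Mt m) : es k A = 0 := by
  have := Polynomial.natDegree_det_X_add_C_le (Matrix.of A) (1 : Mat m)
  rw [Fintype.card_fin] at this
  exact coeff_eq_zero_of_natDegree_lt (this.trans_lt h)
theorem detD_sum (A M : Mt m) (s : ℝ) :
    s * ((1 + s • Matrix.of A).adjugate * Matrix.of M).trace = ∑ k ∈ Finset.range (m+1), s ^ k * eD k A M := by
  obtain ⟨L, h1, h2⟩ := det_hasFDerivAt (m := m) (fun i j => (1 + s • Matrix.of A) i j)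
  have h3 : HasFDerivAt (fun A : Mt m => ((fun i j => (1 : Mat m) i j) : Mt m) + s • A)
      (s • ContinuousLinearMap.id ℝ (Mt m)) A :=
    ((hasFDerivAt_id A).const_smul s).const_add _
  have h4 := h1.comp A h3
  have h5 : HasFDerivAt (fun A : Mt m => ∑ k ∈ Finset.range (m+1), s ^ k * es k A)
      (∑ k ∈ Finset.range (m+1), s ^ k • fderiv ℝ (es k) A) A :=
    HasFDerivAt.fun_sum fun k _ => (es_hasFDerivAt k A).const_mul (s^k)
  have h6 : (fun A : Mt m => ∑ k ∈ Finset.range (m+1), s ^ k * es k A) =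
    (fun A : Mt m => (Matrix.of A).det) ∘ (fun A : Mt m => ((fun i j => (1 : Mat m) i j) : Mt m) + s • A) :=
    funext fun A => (det_sum A s).symm
  rw [h6] at h5
  have h7 := congrArg (fun L : Mt m →L[ℝ] ℝ => L M) (h4.unique h5)
  have h8 := h2 (s • M)
  simp only [sum_apply, smul_apply, smul_eq_mul] at h7
  rw [show (∑ k ∈ Finset.range (m+1), s ^ k * eD k A M) = _ from h7.symm]
  refine Eq.trans ?_ h8.symm
  rw [show Matrix.of (s • M) = s • Matrix.of M from rfl, Matrix.mul_smul, Matrix.trace_smul, smul_eq_mul]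
  rfl
open Polynomial in
theorem pcmp {a b : ℕ → ℝ} (h : ∀ s : ℝ, ∑ k ∈ Finset.range m, s ^ k * a k = ∑ k ∈ Finset.range m, s ^ k * b k) :
    ∀ k < m, a k = b k := by
  have : (∑ k ∈ Finset.range m, C (a k) * X ^ k) = ∑ k ∈ Finset.range m, C (b k) * (X : ℝ[X]) ^ k := by
    apply Polynomial.funext
    intro s
    simp only [eval_finsetSum, eval_mul, eval_C, eval_pow, eval_X]
    simpa only [mul_comm] using h s
  intro k hk
  have := congrArg (fun p => p.coeff k) this
  simpa [finsetSum_coeff, coeff_X_pow, hk] using this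
theorem eD_zero_of_lt {k : ℕ} (h : m < k) (A M : Mt m) : eD k A M = 0 := by
  rw [eD, show (es k : Mt m → ℝ) = fun _ => 0 from funext (es_zero_of_lt h)]; simp
theorem recG (A M N : Mt m)
    (H : ∀ s : ℝ, ((1 + s • Matrix.of A).adjugate * (Matrix.of M + s • Matrix.of N)).trace = (1 + s • Matrix.of A).det * tr M) (k : ℕ) :
    eD (k+1) A M + eD k A N = es k A * tr M := by
  have e : ∀ s : ℝ, ∑ j ∈ Finset.range (m+2), s ^ j * (eD j A M + (if j = 0 then 0 else eD (j-1) A N)) =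
      ∑ j ∈ Finset.range (m+2), s ^ j * (if j = 0 then 0 else es (j-1) A * tr M) := by
    intro s
    have h1 := detD_sum A M s
    have h2 := detD_sum A N s
    have h3 := det_sum A s
    have h4 := H s
    rw [Matrix.mul_add, Matrix.trace_add, Matrix.mul_smul, Matrix.trace_smul, smul_eq_mul, h3] at h4
    simp only [mul_add, Finset.sum_add_distrib]
    rw [Finset.sum_range_succ (fun j => s^j * eD j A M), eD_zero_of_lt (Nat.lt_succ_self m), ← h1,
      Finset.sum_range_succ' _ (m+1), Finset.sum_range_succ' _ (m+1)]
    simp only [Nat.succ_ne_zero, if_false, Nat.add_sub_cancel, if_true, pow_succ']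
    have h5 : ∑ j ∈ Finset.range (m+1), s * s ^ j * eD j A N = s * (s * ((1 + s • Matrix.of A).adjugate * Matrix.of N).trace) := by
      rw [h2, Finset.mul_sum]; exact Finset.sum_congr rfl fun j _ => by ring
    have h6 : ∑ j ∈ Finset.range (m+1), s * s ^ j * (es j A * tr M) = s * ((∑ k ∈ Finset.range (m+1), s ^ k * es k A) * tr M) := by
      rw [Finset.sum_mul, Finset.mul_sum]; exact Finset.sum_congr rfl fun j _ => by ring
    rw [h5, h6, ← h4]; ring
  rcases lt_or_ge m k with hk | hk
  · rw [eD_zero_of_lt (by omega), eD_zero_of_lt hk, es_zero_of_lt hk]; ring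
  · simpa using pcmp e (k+1) (by omega)
theorem recL (k : ℕ) (A M : Mt m) : eD (k+1) A M + eD k A (mm A M) = es k A * tr M := by
  refine recG A M _ (fun s => ?_) k
  rw [show Matrix.of M + s • Matrix.of (mm A M) = (1 + s • Matrix.of A) * Matrix.of M by
    rw [Matrix.add_mul, Matrix.one_mul, Matrix.smul_mul]; rfl, ← Matrix.mul_assoc, Matrix.adjugate_mul,
    Matrix.smul_mul, Matrix.one_mul, Matrix.trace_smul]; rfl
theorem recR (k : ℕ) (A M : Mt m) : eD (k+1) A M + eD k A (mm M A) = es k A * tr M := by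
  refine recG A M _ (fun s => ?_) k
  rw [show Matrix.of M + s • Matrix.of (mm M A) = Matrix.of M * (1 + s • Matrix.of A) by
    rw [Matrix.mul_add, Matrix.mul_one, Matrix.mul_smul]; rfl, ← Matrix.mul_assoc, Matrix.trace_mul_comm,
    ← Matrix.mul_assoc, Matrix.mul_adjugate,
    Matrix.smul_mul, Matrix.one_mul, Matrix.trace_smul]; rfl
theorem es_smul (k : ℕ) (A : Mt m) (r : ℝ) : es k (r • A) = r ^ k * es k A := by
  rcases lt_or_ge m k with hk | hk
  · simp [es_zero_of_lt hk]
  refine pcmp (m := m+1) (a := fun k => es k (r • A)) (b := fun k => r ^ k * es k A) (fun s => ?_) k (by omega)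
  rw [← det_sum, show s • Matrix.of (r • A) = (s*r) • Matrix.of A by rw [mul_smul]; rfl, det_sum]
  exact Finset.sum_congr rfl fun j _ => by ring
theorem es_zero (A : Mt m) : es 0 A = 1 := by
  have := det_sum A 0
  rw [zero_smul, add_zero, Matrix.det_one, Finset.sum_range_succ'] at this
  simpa using this.symm
theorem eD_zero (A M : Mt m) : eD 0 A M = 0 := by
  rw [eD, show (es 0 : Mt m → ℝ) = fun _ => 1 from funext es_zero]; simp
def tp {m : ℕ} (A : Mt m) : Mt m := fun i j => A j i
theorem eD_tp (k : ℕ) {A : Mt m} (hA : ∀ i j, A i j = A j i) (M : Mt m) : eD k A (tp M) = eD k A M := by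
  induction k generalizing M with
  | zero => simp [eD_zero]
  | succ k ih =>
    have h1 := recL k A (tp M)
    have h2 := recR k A M
    have h3 : mm A (tp M) = tp (mm M A) := by
      ext i j; simp only [mm, tp]; exact Finset.sum_congr rfl fun l _ => by rw [hA, mul_comm]
    have h4 : tr (tp M) = tr M := rfl
    rw [h3, ih, h4] at h1
    linarith
theorem es_line (k : ℕ) (A M : Mt m) (s : ℝ) : HasDerivAt (fun s : ℝ => es k (A + s • M)) (eD k (A + s • M) M) s := by
  have h : HasDerivAt (fun s : ℝ => A + s • M) M s := by
    simpa using ((hasDerivAt_id s).smul_const M).const_add A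
  exact (es_hasFDerivAt k _).comp_hasDerivAt s h
theorem eD_line (k : ℕ) (A M N : Mt m) (s : ℝ) : HasDerivAt (fun s : ℝ => eD k (A + s • M) N) (eDD k (A + s • M) N M) s := by
  have h : HasDerivAt (fun s : ℝ => A + s • M) M s := by
    simpa using ((hasDerivAt_id s).smul_const M).const_add A
  have := (esD_hasFDerivAt k _).comp_hasDerivAt s h
  exact (((ContinuousLinearMap.apply ℝ ℝ N).hasFDerivAt).comp_hasDerivAt s this)
theorem eD_self (k : ℕ) (A : Mt m) : eD k A A = k * es k A := by
  have h := es_line k A A 0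
  have h2 : HasDerivAt (fun s : ℝ => (1+s) ^ k * es k A) (((k:ℝ) * (1 + 0) ^ (k-1) * 1) * es k A) 0 :=
    (((hasDerivAt_id (0:ℝ)).const_add 1).pow k).mul_const _
  have h3 : (fun s : ℝ => es k (A + s • A)) = fun s : ℝ => (1+s) ^ k * es k A := by
    ext s; rw [← es_smul, add_smul, one_smul]
  rw [h3] at h
  simpa using h.unique h2
theorem eDD_self (k : ℕ) (A M : Mt m) : eDD k A A M = (k - 1) * eD k A M := by
  have h1 : HasDerivAt (fun s : ℝ => eD k (A + s • M) (A + s • M)) (eDD k A A M + eD k A M) 0 := by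
    have := ((eD_line k A M A 0).add ((hasDerivAt_id (0:ℝ)).mul (eD_line k A M M 0)))
    simp only [zero_smul, add_zero] at this
    refine (this.congr_deriv (by simp)).congr_of_eventuallyEq (Eventually.of_forall fun s => ?_)
    simp [eD_add, eD_smul]
  have h2 : HasDerivAt (fun s : ℝ => eD k (A + s • M) (A + s • M)) (k * eD k A M) 0 := by
    simp only [eD_self]
    simpa using (es_line k A M 0).const_mul (k:ℝ)
  have := h1.unique h2
  linarith
theorem eD_one (A M : Mt m) : eD 1 A M = tr M := by
  have := recL 0 A M
  rw [eD_zero, es_zero] at this; simpa using this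
def Sm {n : ℕ} (F : Eu n → ℝ) : Prop := ContDiffOn ℝ (⊤ : ℕ∞) F {0}ᶜ
theorem hop (n : ℕ) : IsOpen ({0}ᶜ : Set (Eu n)) := isOpen_compl_singleton
theorem Sm.diff {F : Eu n → ℝ} (h : Sm F) {y : Eu n} (hy : y ≠ 0) : DifferentiableAt ℝ F y :=
  (h.differentiableOn (by simp)).differentiableAt ((hop n).mem_nhds hy)
theorem Sm.cont {F : Eu n → ℝ} (h : Sm F) : ContinuousOn F (sph n) :=
  h.continuousOn.mono fun _ hy => sph_ne hy
theorem Sm.add {F G : Eu n → ℝ} (h : Sm F) (h' : Sm G) : Sm (fun y => F y + G y) := ContDiffOn.add h h'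
theorem Sm.mul {F G : Eu n → ℝ} (h : Sm F) (h' : Sm G) : Sm (fun y => F y * G y) := ContDiffOn.mul h h'
theorem Sm.sub {F G : Eu n → ℝ} (h : Sm F) (h' : Sm G) : Sm (fun y => F y - G y) := ContDiffOn.sub h h'
theorem Sm.const (c : ℝ) : Sm (fun _ : Eu n => c) := contDiffOn_const
theorem Sm.cmul {F : Eu n → ℝ} (c : ℝ) (h : Sm F) : Sm (fun y => c * F y) := (Sm.const c).mul h
theorem Sm.coord (i : Fin (n+1)) : Sm (fun y : Eu n => y i) :=
  (EuclideanSpace.proj i : Eu n →L[ℝ] ℝ).contDiff.contDiffOn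
theorem Sm.sum {ι : Type*} {s : Finset ι} {F : ι → Eu n → ℝ} (h : ∀ i ∈ s, Sm (F i)) :
    Sm (fun y => ∑ i ∈ s, F i y) := ContDiffOn.sum h
theorem Sm.nrm (n : ℕ) : Sm (fun y : Eu n => ‖y‖) := fun y hy => (contDiffAt_norm ℝ hy).contDiffWithinAt
theorem Sm.pd {F : Eu n → ℝ} (h : Sm F) (i : Fin (n+1)) : Sm (pd i F) :=
  (h.fderiv_of_isOpen (hop n) (m := (⊤ : ℕ∞)) (by norm_cast)).clm_apply contDiffOn_const
theorem Sm.inv {F : Eu n → ℝ} (h : Sm F) (h' : ∀ y ≠ 0, F y ≠ 0) : Sm (fun y => (F y)⁻¹) := ContDiffOn.inv h h'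
theorem Sm.c1 {F : Eu n → ℝ} (h : Sm F) : ContDiffOn ℝ 1 F {0}ᶜ := ContDiffOn.of_le h (by norm_cast)
theorem pd_congr {F G : Eu n → ℝ} (h : ∀ y ≠ 0, F y = G y) (i : Fin (n+1)) {y : Eu n} (hy : y ≠ 0) :
    pd i F y = pd i G y := by
  have : F =ᶠ[𝓝 y] G := by filter_upwards [(hop n).mem_nhds hy] with z hz using h z hz
  rw [pd, pd, this.fderiv_eq]
theorem pd_add (i : Fin (n+1)) {F G : Eu n → ℝ} (hF : Sm F) (hG : Sm G) {y : Eu n} (hy : y ≠ 0) :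
    pd i (fun y => F y + G y) y = pd i F y + pd i G y := by
  rw [pd, fderiv_fun_add (hF.diff hy) (hG.diff hy)]; rfl
theorem pd_cmul (i : Fin (n+1)) {F : Eu n → ℝ} (c : ℝ) (hF : Sm F) {y : Eu n} (hy : y ≠ 0) :
    pd i (fun y => c * F y) y = c * pd i F y := by
  rw [pd, fderiv_const_mul (hF.diff hy)]; rfl
theorem fderiv_pd (F : Eu n → ℝ) (y v : Eu n) : fderiv ℝ F y v = ∑ i, v i * pd i F y := by
  have h : v = ∑ i, v i • bv i := by
    ext j; simp [bv, Pi.single_apply]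
  conv_lhs => rw [h]
  rw [map_sum]; exact Finset.sum_congr rfl fun i _ => map_smul _ _ _
theorem pd_comm {F : Eu n → ℝ} (h : Sm F) (i j : Fin (n+1)) {y : Eu n} (hy : y ≠ 0) :
    pd i (pd j F) y = pd j (pd i F) y := by
  have h1 : ContDiffAt ℝ (⊤ : ℕ∞) F y := h.contDiffAt ((hop n).mem_nhds hy)
  have h2 := h1.isSymmSndFDerivAt (by rw [minSmoothness_of_isRCLikeNormedField]; exact WithTop.coe_le_coe.2 (le_top : (2:ℕ∞) ≤ ⊤))
  have h3 : DifferentiableAt ℝ (fderiv ℝ F) y :=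
    ((h.fderiv_of_isOpen (hop n) (m := (⊤ : ℕ∞)) (by norm_cast)).differentiableOn (by simp)).differentiableAt ((hop n).mem_nhds hy)
  have h4 : ∀ a b : Fin (n+1), pd a (pd b F) y = fderiv ℝ (fderiv ℝ F) y (bv a) (bv b) := by
    intro a b
    have := (h3.hasFDerivAt.clm_apply (hasFDerivAt_const (bv b) y)).fderiv
    rw [pd, show pd b F = fun y => fderiv ℝ F y (bv b) from rfl, this]
    simp
  rw [h4, h4]; exact h2 _ _
def Hm {n : ℕ} (F : Eu n → ℝ) (y : Eu n) : Mt (n+1) := fun i j => pd i (pd j F) y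
theorem Hm_smooth {F : Eu n → ℝ} (h : Sm F) : ContDiffOn ℝ (⊤ : ℕ∞) (Hm F) {0}ᶜ :=
  contDiffOn_pi.mpr fun i => contDiffOn_pi.mpr fun j => (h.pd j).pd i
theorem Hm_cont {F : Eu n → ℝ} (h : Sm F) : ContinuousOn (Hm F) (sph n) :=
  (Hm_smooth h).continuousOn.mono fun _ hy => sph_ne hy
theorem Hm_add {F G : Eu n → ℝ} (h : Sm F) (h' : Sm G) {y : Eu n} (hy : y ≠ 0) :
    Hm (fun y => F y + G y) y = Hm F y + Hm G y := by
  ext i j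
  simp only [Hm, Pi.add_apply]
  rw [pd_congr (fun z hz => pd_add j h h' hz) i hy, pd_add i (h.pd j) (h'.pd j) hy]
theorem Hm_cmul {F : Eu n → ℝ} (c : ℝ) (h : Sm F) {y : Eu n} (hy : y ≠ 0) :
    Hm (fun y => c * F y) y = c • Hm F y := by
  ext i j
  simp only [Hm, Pi.smul_apply, smul_eq_mul]
  rw [pd_congr (fun z hz => pd_cmul j c h hz) i hy, pd_cmul i c (h.pd j) hy]
theorem Hm_symm {F : Eu n → ℝ} (h : Sm F) {y : Eu n} (hy : y ≠ 0) (i j : Fin (n+1)) : Hm F y i j = Hm F y j i :=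
  pd_comm h i j hy
structure Hg {n : ℕ} (F : Eu n → ℝ) : Prop where
  sm : Sm F
  hom : ∀ r : ℝ, 0 < r → ∀ y ≠ 0, F (r • y) = r * F y
theorem Hg.add {F G : Eu n → ℝ} (h : Hg F) (h' : Hg G) : Hg (fun y => F y + G y) :=
  ⟨h.sm.add h'.sm, fun r hr y hy => by simp only [h.hom r hr y hy, h'.hom r hr y hy]; ring⟩
theorem Hg.cmul {F : Eu n → ℝ} (c : ℝ) (h : Hg F) : Hg (fun y => c * F y) :=
  ⟨h.sm.cmul c, fun r hr y hy => by simp only [h.hom r hr y hy]; ring⟩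
theorem Hg.nrm (n : ℕ) : Hg (fun y : Eu n => ‖y‖) :=
  ⟨Sm.nrm n, fun r hr y _ => by rw [norm_smul, Real.norm_of_nonneg hr.le]⟩
theorem Hg.euler {F : Eu n → ℝ} (h : Hg F) {y : Eu n} (hy : y ≠ 0) : ∑ i, y i * pd i F y = F y := by
  rw [← fderiv_pd]
  have h1 : HasDerivAt (fun r : ℝ => r • y) y 1 := by simpa using (hasDerivAt_id (1:ℝ)).smul_const y
  have h0 : HasFDerivAt F (fderiv ℝ F y) ((1:ℝ) • y) := by rw [one_smul]; exact (h.sm.diff hy).hasFDerivAt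
  have h2 : HasDerivAt (fun r : ℝ => F (r • y)) (fderiv ℝ F y y) 1 := h0.comp_hasDerivAt 1 h1
  have h3 : HasDerivAt (fun r : ℝ => r * F y) (1 * F y) 1 := (hasDerivAt_id (1:ℝ)).mul_const _
  have h4 : (fun r : ℝ => F (r • y)) =ᶠ[𝓝 1] fun r : ℝ => r * F y := by
    filter_upwards [lt_mem_nhds (show (0:ℝ) < 1 by norm_num)] with r hr using h.hom r hr y hy
  simpa using h2.unique (h3.congr_of_eventuallyEq h4)
theorem Hg.ker {F : Eu n → ℝ} (h : Hg F) {y : Eu n} (hy : y ≠ 0) (j : Fin (n+1)) :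
    ∑ i, Hm F y j i * y i = 0 := by
  have h1 := pd_congr (fun z hz => h.euler hz) j hy
  rw [pd_sum _ _ (fun i _ => (diff_coord i y).fun_mul ((h.sm.pd i).diff hy))] at h1
  have h2 : ∀ i, pd j (fun y : Eu n => y i * pd i F y) y
      = Hm F y j i * y i + (if j = i then pd i F y else 0) := by
    intro i; rw [pd_mul j (diff_coord i y) ((h.sm.pd i).diff hy), pd_coord, Hm]; split_ifs <;> ring
  simp only [h2, Finset.sum_add_distrib, Finset.sum_ite_eq, Finset.mem_univ, if_true] at h1
  linarith
theorem pd_comp {V : Type*} [NormedAddCommGroup V] [NormedSpace ℝ V] (g : V → ℝ) (A : Eu n → V) (y : Eu n) (i : Fin (n+1))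
    (hg : DifferentiableAt ℝ g (A y)) (hA : DifferentiableAt ℝ A y) :
    pd i (fun y => g (A y)) y = fderiv ℝ g (A y) (fderiv ℝ A y (bv i)) := by
  rw [pd, show (fun y => g (A y)) = g ∘ A from rfl, fderiv_comp _ hg hA]; rfl
theorem es_sm (k : ℕ) {F : Eu n → ℝ} (h : Sm F) : Sm (fun y => es k (Hm F y)) :=
  (es_contDiff k).comp_contDiffOn (Hm_smooth h)
theorem eD_sm (k : ℕ) {F : Eu n → ℝ} (h : Sm F) {M : Eu n → Mt (n+1)} (hM : ContDiffOn ℝ (⊤ : ℕ∞) M {0}ᶜ) :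
    Sm (fun y => eD k (Hm F y) (M y)) :=
  ((esD_contDiff k).comp_contDiffOn (Hm_smooth h)).clm_apply hM
def En {m : ℕ} (i j : Fin m) : Mt m := op (Pi.single i 1) (Pi.single j 1)
theorem En_apply (i j a b : Fin m) : En i j a b = (if a = i then 1 else 0) * (if b = j then 1 else 0) := by
  simp [En, op, Pi.single_apply]
theorem Mt_sum (M : Mt m) : M = ∑ i, ∑ j, M i j • En i j := by
  ext a b
  simp only [Finset.sum_apply, Pi.smul_apply, smul_eq_mul, En_apply]
  simp
theorem eD_En (k : ℕ) (A M : Mt m) : eD k A M = ∑ i, ∑ j, M i j * eD k A (En i j) := by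
  conv_lhs => rw [Mt_sum M]
  simp only [eD_sum, eD_smul]
theorem fderiv_Hm {F : Eu n → ℝ} (h : Sm F) {y : Eu n} (hy : y ≠ 0) (a i j : Fin (n+1)) :
    fderiv ℝ (Hm F) y (bv a) i j = pd a (pd i (pd j F)) y := by
  have hd : DifferentiableAt ℝ (Hm F) y := ((Hm_smooth h).differentiableOn (by simp)).differentiableAt ((hop n).mem_nhds hy)
  have h1 : HasFDerivAt (fun y => Hm F y i j) (((ContinuousLinearMap.proj j).comp (ContinuousLinearMap.proj i)).comp (fderiv ℝ (Hm F) y)) y :=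
    ((ContinuousLinearMap.proj (R := ℝ) (φ := fun _ : Fin (n+1) => ℝ) j).comp (ContinuousLinearMap.proj (R := ℝ) (φ := fun _ : Fin (n+1) => Fin (n+1) → ℝ) i)).hasFDerivAt.comp y hd.hasFDerivAt
  have h2 := h1.fderiv
  rw [pd, show pd i (pd j F) = fun y => Hm F y i j from rfl, h2]; rfl
theorem Tsucc (k : ℕ) {F : Eu n → ℝ} (h : Sm F) {y : Eu n} (hy : y ≠ 0) (i j : Fin (n+1)) :
    eD (k+1) (Hm F y) (En i j) = es k (Hm F y) * (if i = j then 1 else 0) - ∑ l, Hm F y i l * eD k (Hm F y) (En l j) := by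
  have := recL k (Hm F y) (En i j)
  have h1 : mm (Hm F y) (En i j) = ∑ l, Hm F y i l • En l j := by
    ext a b
    simp only [mm, Finset.sum_apply, Pi.smul_apply, smul_eq_mul, En_apply]
    simp [Hm_symm h hy a i]
  have h2 : tr (En i j) = if i = j then 1 else 0 := by
    simp only [tr, En_apply]; simp [eq_comm]
  rw [h1, eD_sum, h2] at this
  simp only [eD_smul] at this
  linarith
theorem piola (k : ℕ) {F : Eu n → ℝ} (h : Sm F) (i : Fin (n+1)) {y : Eu n} (hy : y ≠ 0) :
    ∑ j, pd j (fun y => eD k (Hm F y) (En i j)) y = 0 := by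
  induction k generalizing i with
  | zero => simp [eD_zero, pd]
  | succ k ih =>
    have hT : ∀ l j, Sm (fun y => eD k (Hm F y) (En l j)) := fun l j => eD_sm k h contDiffOn_const
    have hH : ∀ i l, Sm (fun y => Hm F y i l) := fun i l => (h.pd l).pd i
    have e1 : ∀ j, pd j (fun y => eD (k+1) (Hm F y) (En i j)) y =
        (if i = j then pd j (fun y => es k (Hm F y)) y else 0) -
        ∑ l, (Hm F y i l * pd j (fun y => eD k (Hm F y) (En l j)) y + eD k (Hm F y) (En l j) * pd j (fun y => Hm F y i l) y) := by
      intro j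
      rw [pd_congr (fun z hz => Tsucc k h hz i j) j hy]
      have a1 : Sm (fun y => es k (Hm F y) * (if i = j then (1:ℝ) else 0)) := (es_sm k h).mul (Sm.const _)
      have a2 : Sm (fun y => ∑ l, Hm F y i l * eD k (Hm F y) (En l j)) := Sm.sum fun l _ => (hH i l).mul (hT l j)
      rw [pd, fderiv_fun_sub (a1.diff hy) (a2.diff hy), sub_apply]
      congr 1
      · by_cases hij : i = j
        · simp [hij, pd]
        · simp [hij]
      · refine (pd_sum _ j (fun l _ => (((hH i l).mul (hT l j)).diff hy))).trans ?_
        exact Finset.sum_congr rfl fun l _ => by rw [pd_mul j ((hH i l).diff hy) ((hT l j).diff hy)]; ring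
    simp only [e1, Finset.sum_sub_distrib, Finset.sum_ite_eq, Finset.mem_univ, if_true, Finset.sum_add_distrib]
    have e2 : pd i (fun y => es k (Hm F y)) y = ∑ l, ∑ j, pd i (fun y => Hm F y l j) y * eD k (Hm F y) (En l j) := by
      rw [pd_comp (es k) (Hm F) y i (es_hasFDerivAt k _).differentiableAt
        (((Hm_smooth h).differentiableOn (by simp)).differentiableAt ((hop n).mem_nhds hy))]
      refine (eD_En k _ _).trans ?_
      exact Finset.sum_congr rfl fun l _ => Finset.sum_congr rfl fun j _ => by rw [fderiv_Hm h hy]; rfl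
    have e3 : ∑ j, ∑ l, Hm F y i l * pd j (fun y => eD k (Hm F y) (En l j)) y = 0 := by
      rw [Finset.sum_comm]
      exact Finset.sum_eq_zero fun l _ => by rw [← Finset.mul_sum, ih l, mul_zero]
    rw [e2, e3, Finset.sum_comm, zero_add, sub_eq_zero]
    refine Finset.sum_congr rfl fun j _ => Finset.sum_congr rfl fun l _ => ?_
    rw [mul_comm]; congr 1
    show pd i (pd l (pd j F)) y = pd j (pd i (pd l F)) y
    rw [pd_congr (fun z hz => pd_comm h l j hz) i hy, pd_comm (h.pd l) i j hy]
theorem T_tan (k : ℕ) {F : Eu n → ℝ} (h : Hg F) {y : Eu n} (hy : y ≠ 0) (v : Fin (n+1) → ℝ) :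
    eD (k+1) (Hm F y) (op v y) = es k (Hm F y) * ∑ i, v i * y i := by
  have := recR k (Hm F y) (op v y)
  have h1 : mm (op v y) (Hm F y) = 0 := by
    ext a b
    simp only [mm, op, mul_assoc, ← Finset.mul_sum]
    have := h.ker hy b
    simp only [Hm_symm h.sm hy b] at this
    simp only [mul_comm (y _)]
    rw [this]; simp
  rw [h1] at this
  have h0 : eD k (Hm F y) 0 = 0 := map_zero _
  rw [h0] at this
  simpa [tr, op] using this
def LL {n : ℕ} (k : ℕ) (U F : Eu n → ℝ) (y : Eu n) : ℝ := eD k (Hm U y) (Hm F y)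
theorem LL_sm (k : ℕ) {U F : Eu n → ℝ} (hU : Sm U) (hF : Sm F) : Sm (LL k U F) := eD_sm k hU (Hm_smooth hF)
theorem op_sum (i : Fin (n+1)) (w : Fin (n+1) → ℝ) : ∑ j, w j • En i j = op (Pi.single i 1) w := by
  ext a b
  simp only [Finset.sum_apply, Pi.smul_apply, smul_eq_mul, En_apply, op, Pi.single_apply]
  simp
theorem F1 (k : ℕ) {U F G : Eu n → ℝ} (hU : Hg U) (hF : Hg F) (hG : Hg G) :
    ∫ x, G x * LL k U F x ∂(mu n) = ∫ x, F x * LL k U G x ∂(mu n) := by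
  rcases k with _ | k
  · simp [LL, eD_zero]
  let T : Fin (n+1) → Fin (n+1) → Eu n → ℝ := fun i j y => eD (k+1) (Hm U y) (En i j)
  have hT : ∀ i j, Sm (T i j) := fun i j => eD_sm (k+1) hU.sm contDiffOn_const
  let W : Fin (n+1) → Eu n → ℝ := fun i y => G y * pd i F y - F y * pd i G y
  have hW : ∀ i, Sm (W i) := fun i => (hG.sm.mul (hF.sm.pd i)).sub (hF.sm.mul (hG.sm.pd i))
  let Z : Fin (n+1) → Eu n → ℝ := fun j y => ∑ i, T i j y * W i y
  have hZ : ∀ j, Sm (Z j) := fun j => Sm.sum fun i _ => (hT i j).mul (hW i)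
  have key := div_thm Z (fun j => (hZ j).c1) (fun y hy => by
    have h1 : ∀ i, ∑ j, y j * T i j y = es k (Hm U y) * y i := by
      intro i
      have := T_tan k hU hy (Pi.single i 1)
      rw [← op_sum, eD_sum] at this
      simp only [eD_smul] at this
      rw [this]; simp [Pi.single_apply]
    simp only [Z, Finset.mul_sum]
    rw [Finset.sum_comm]
    simp only [← mul_assoc, ← Finset.sum_mul, h1]
    have e1 := hF.euler hy
    have e2 := hG.euler hy
    have : ∑ i, es k (Hm U y) * y i * W i y = es k (Hm U y) * (G y * ∑ i, y i * pd i F y - F y * ∑ i, y i * pd i G y) := by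
      simp only [Finset.mul_sum, ← Finset.sum_sub_distrib, W]
      exact Finset.sum_congr rfl fun i _ => by ring
    rw [this, e1, e2]; ring)
  have h2 : ∀ x ∈ sph n, ∑ j, pd j (Z j) x = G x * LL (k+1) U F x - F x * LL (k+1) U G x := by
    intro x hx
    have hy := sph_ne hx
    have a1 : ∀ j, pd j (Z j) x = ∑ i, (W i x * pd j (T i j) x + T i j x * (G x * Hm F x j i - F x * Hm G x j i)
        + T i j x * (pd j G x * pd i F x - pd j F x * pd i G x)) := by
      intro j
      refine (pd_sum _ j (fun i _ => ((hT i j).mul (hW i)).diff hy)).trans (Finset.sum_congr rfl fun i _ => ?_)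
      rw [pd_mul j ((hT i j).diff hy) ((hW i).diff hy)]
      have : pd j (W i) x = (G x * Hm F x j i + pd i F x * pd j G x) - (F x * Hm G x j i + pd i G x * pd j F x) := by
        have b1 := pd_mul j (hG.sm.diff hy) ((hF.sm.pd i).diff hy)
        have b2 := pd_mul j (hF.sm.diff hy) ((hG.sm.pd i).diff hy)
        simp only [pd] at b1 b2 ⊢
        have b3 := fderiv_fun_sub ((hG.sm.mul (hF.sm.pd i)).diff hy) ((hF.sm.mul (hG.sm.pd i)).diff hy)
        rw [show W i = fun y => G y * pd i F y - F y * pd i G y from rfl, b3, sub_apply]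
        simp only [pd]
        rw [b1, b2]
        simp only [Hm, pd]; ring
      rw [this]; ring
    simp only [a1, Finset.sum_add_distrib]
    have a2 : ∑ j, ∑ i, W i x * pd j (T i j) x = 0 := by
      rw [Finset.sum_comm]
      exact Finset.sum_eq_zero fun i _ => by rw [← Finset.mul_sum, piola (k+1) hU.sm i hy, mul_zero]
    have hs : ∀ i j, T i j x = T j i x := by
      intro i j
      have := eD_tp (k+1) (Hm_symm hU.sm hy) (En i j)
      have h3 : tp (En i j) = En j i := by ext a b; simp only [tp, En_apply]; ring
      rw [h3] at this; exact this.symm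
    have a3 : ∑ j, ∑ i, T i j x * (pd j G x * pd i F x - pd j F x * pd i G x) = 0 := by
      have : ∑ j, ∑ i, T i j x * (pd j G x * pd i F x - pd j F x * pd i G x) = - ∑ j, ∑ i, T i j x * (pd j G x * pd i F x - pd j F x * pd i G x) := by
        conv_lhs => rw [Finset.sum_comm]
        simp only [← Finset.sum_neg_distrib]
        exact Finset.sum_congr rfl fun i _ => Finset.sum_congr rfl fun j _ => by rw [hs]; ring
      linarith
    rw [a2, a3, LL, LL, eD_En, eD_En _ _ (Hm G x), Finset.mul_sum, Finset.mul_sum, zero_add, add_zero, ← Finset.sum_sub_distrib]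
    refine Finset.sum_congr rfl fun j _ => ?_
    rw [Finset.mul_sum, Finset.mul_sum, ← Finset.sum_sub_distrib]
    refine Finset.sum_congr rfl fun i _ => ?_
    rw [hs i j]; simp only [T]; ring
  rw [int_congr h2, integral_sub (intg (hG.sm.mul (LL_sm _ hU.sm hF.sm)).cont) (intg (hF.sm.mul (LL_sm _ hU.sm hG.sm)).cont)] at key
  linarith
theorem int_derivB {G G' : ℝ → Eu n → ℝ} {s0 ε C : ℝ} (hε : 0 < ε)
    (hG : ∀ s ∈ Metric.ball s0 ε, ContinuousOn (G s) (sph n)) (hG' : ContinuousOn (G' s0) (sph n))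
    (hb : ∀ s ∈ Metric.ball s0 ε, ∀ x ∈ sph n, |G' s x| ≤ C)
    (hd : ∀ s ∈ Metric.ball s0 ε, ∀ x ∈ sph n, HasDerivAt (fun s => G s x) (G' s x) s) :
    HasDerivAt (fun s => ∫ x, G s x ∂(mu n)) (∫ x, G' s0 x ∂(mu n)) s0 := by
  have hm : s0 ∈ Metric.ball s0 ε := Metric.mem_ball_self hε
  refine (hasDerivAt_integral_of_dominated_loc_of_deriv_le (F' := G') (bound := fun _ => C) (Metric.ball_mem_nhds s0 hε) ?_
    (intg (hG s0 hm)) (intg hG').aestronglyMeasurable ?_ (integrable_const C) ?_).2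
  · filter_upwards [Metric.ball_mem_nhds s0 hε] with s hs using (intg (hG s hs)).aestronglyMeasurable
  · filter_upwards [ae_sph n] with x hx s hs using hb s hs x hx
  · filter_upwards [ae_sph n] with x hx s hs using hd s hs x hx
theorem int_deriv {G G' : ℝ → Eu n → ℝ} (s0 : ℝ) (hG : ∀ s, ContinuousOn (G s) (sph n))
    (hG' : ContinuousOn (fun p : ℝ × Eu n => G' p.1 p.2) (Set.univ ×ˢ sph n))
    (hd : ∀ s, ∀ x ∈ sph n, HasDerivAt (fun s => G s x) (G' s x) s) :
    HasDerivAt (fun s => ∫ x, G s x ∂(mu n)) (∫ x, G' s0 x ∂(mu n)) s0 := by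
  have hc : IsCompact (Metric.closedBall s0 1 ×ˢ sph n) := (isCompact_closedBall s0 1).prod (sph_compact n)
  obtain ⟨C, hC⟩ := hc.exists_bound_of_continuousOn (hG'.mono (Set.prod_mono (Set.subset_univ _) subset_rfl))
  refine int_derivB (C := C) one_pos (fun s _ => hG s) ?_ (fun s hs x hx => ?_) (fun s _ x hx => hd s x hx)
  · exact hG'.comp (f := fun x : Eu n => (s0, x)) (by fun_prop) (fun x hx => ⟨trivial, hx⟩)
  · exact hC (s, x) ⟨Metric.ball_subset_closedBall hs, hx⟩
theorem eD_cont (k : ℕ) : Continuous (fun p : Mt m × Mt m => eD k p.1 p.2) :=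
  ((esD_contDiff k).continuous.comp continuous_fst).clm_apply continuous_snd
theorem esDD_contDiff (k : ℕ) : ContDiff ℝ (⊤ : ℕ∞) (fderiv ℝ (fderiv ℝ (es k : Mt m → ℝ))) :=
  (esD_contDiff k).fderiv_right (by norm_cast)
theorem eDD_cont (k : ℕ) : Continuous (fun p : Mt m × Mt m × Mt m => eDD k p.1 p.2.1 p.2.2) :=
  (((esDD_contDiff k).continuous.comp continuous_fst).clm_apply (continuous_snd.comp continuous_snd)).clm_apply
    (continuous_fst.comp continuous_snd)
def SS {n : ℕ} (k : ℕ) (U F G : Eu n → ℝ) (y : Eu n) : ℝ := eDD k (Hm U y) (Hm F y) (Hm G y)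
theorem SS_cont (k : ℕ) {U F G : Eu n → ℝ} (hU : Sm U) (hF : Sm F) (hG : Sm G) : ContinuousOn (SS k U F G) (sph n) :=
  (eDD_cont k).comp_continuousOn ((Hm_cont hU).prodMk ((Hm_cont hF).prodMk (Hm_cont hG)))
theorem Hm_line {F G : Eu n → ℝ} (h : Sm F) (h' : Sm G) {y : Eu n} (hy : y ≠ 0) (s : ℝ) :
    Hm (fun y => F y + s * G y) y = Hm F y + s • Hm G y := by
  rw [Hm_add h (h'.cmul s) hy, Hm_cmul s h' hy]
theorem Hm_cont2 {F G : Eu n → ℝ} (h : Sm F) (h' : Sm G) :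
    ContinuousOn (fun p : ℝ × Eu n => Hm F p.2 + p.1 • Hm G p.2) (Set.univ ×ˢ sph n) := by
  have a : ContinuousOn (fun p : ℝ × Eu n => Hm F p.2) (Set.univ ×ˢ sph n) :=
    (Hm_cont h).comp continuousOn_snd (fun p hp => hp.2)
  have b : ContinuousOn (fun p : ℝ × Eu n => Hm G p.2) (Set.univ ×ˢ sph n) :=
    (Hm_cont h').comp continuousOn_snd (fun p hp => hp.2)
  exact a.add (continuousOn_fst.smul b)
theorem cont_snd {V : Type*} [TopologicalSpace V] {F : Eu n → V} (h : ContinuousOn F (sph n)) :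
    ContinuousOn (fun p : ℝ × Eu n => F p.2) (Set.univ ×ˢ sph n) :=
  h.comp continuousOn_snd (fun p hp => hp.2)
theorem LL_deriv (k : ℕ) {U F G H : Eu n → ℝ} (hU : Hg U) (hF : Hg F) (hG : Hg G) (hH : Hg H) (s : ℝ) :
    HasDerivAt (fun s : ℝ => ∫ x, H x * LL k (fun y => U y + s * G y) F x ∂(mu n))
      (∫ x, H x * SS k (fun y => U y + s * G y) F G x ∂(mu n)) s := by
  refine int_deriv (G := fun s x => H x * LL k (fun y => U y + s * G y) F x)
    (G' := fun s x => H x * SS k (fun y => U y + s * G y) F G x) s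
    (fun s => (hH.sm.mul (LL_sm k (hU.sm.add (hG.sm.cmul s)) hF.sm)).cont) ?_ (fun s x hx => ?_)
  · have h1 : ContinuousOn (fun p : ℝ × Eu n => H p.2 * eDD k (Hm U p.2 + p.1 • Hm G p.2) (Hm F p.2) (Hm G p.2)) (Set.univ ×ˢ sph n) :=
      (cont_snd hH.sm.cont).mul ((eDD_cont k).comp_continuousOn ((Hm_cont2 hU.sm hG.sm).prodMk
        ((cont_snd (Hm_cont hF.sm)).prodMk (cont_snd (Hm_cont hG.sm)))))
    refine h1.congr fun p hp => ?_
    simp only [SS, Hm_line hU.sm hG.sm (sph_ne hp.2)]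
  · simp only [SS, LL, Hm_line hU.sm hG.sm (sph_ne hx)]
    exact (eD_line k _ _ _ s).const_mul _
theorem F2 (k : ℕ) {U F G H : Eu n → ℝ} (hU : Hg U) (hF : Hg F) (hG : Hg G) (hH : Hg H) :
    ∫ x, H x * SS k U F G x ∂(mu n) = ∫ x, F x * SS k U H G x ∂(mu n) := by
  have h1 := LL_deriv k hU hF hG hH 0
  have h2 := LL_deriv k hU hH hG hF 0
  have h3 : ∀ s : ℝ, Hg (fun y => U y + s * G y) := fun s => hU.add (hG.cmul s)
  have h4 := funext fun s => F1 k (h3 s) hF hH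
  rw [h4] at h1
  simpa using h1.unique h2
def sg {n : ℕ} (k : ℕ) (U : Eu n → ℝ) (y : Eu n) : ℝ := es k (Hm U y)
def VV {n : ℕ} (k : ℕ) (U : Eu n → ℝ) : ℝ := ∫ x, U x * sg k U x ∂(mu n)
theorem sg_sm (k : ℕ) {U : Eu n → ℝ} (hU : Sm U) : Sm (sg k U) := es_sm k hU
theorem LL_self (k : ℕ) (U : Eu n → ℝ) (y : Eu n) : LL k U U y = k * sg k U y := eD_self k _
theorem sg_line (k : ℕ) {U F : Eu n → ℝ} (hU : Sm U) (hF : Sm F) {y : Eu n} (hy : y ≠ 0) (s : ℝ) :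
    HasDerivAt (fun s : ℝ => sg k (fun y => U y + s * F y) y) (LL k (fun y => U y + s * F y) F y) s := by
  simp only [sg, LL, Hm_line hU hF hy]
  exact es_line k _ _ s
theorem LL_cont2 (k : ℕ) {U F : Eu n → ℝ} (hU : Sm U) (hF : Sm F) :
    ContinuousOn (fun p : ℝ × Eu n => LL k (fun y => U y + p.1 * F y) F p.2) (Set.univ ×ˢ sph n) := by
  have h1 : ContinuousOn (fun p : ℝ × Eu n => eD k (Hm U p.2 + p.1 • Hm F p.2) (Hm F p.2)) (Set.univ ×ˢ sph n) :=
    (eD_cont k).comp_continuousOn ((Hm_cont2 hU hF).prodMk (cont_snd (Hm_cont hF)))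
  refine h1.congr fun p hp => ?_
  simp only [LL, Hm_line hU hF (sph_ne hp.2)]
theorem V_deriv2 (k : ℕ) {U F H : Eu n → ℝ} (hU : Hg U) (hF : Hg F) (hH : ContinuousOn H (sph n)) (s : ℝ) :
    HasDerivAt (fun s : ℝ => ∫ x, H x * sg k (fun y => U y + s * F y) x ∂(mu n))
      (∫ x, H x * LL k (fun y => U y + s * F y) F x ∂(mu n)) s := by
  refine int_deriv (G := fun s x => H x * sg k (fun y => U y + s * F y) x)
    (G' := fun s x => H x * LL k (fun y => U y + s * F y) F x) s
    (fun s => hH.mul (sg_sm k (hU.sm.add (hF.sm.cmul s))).cont) ((cont_snd hH).mul (LL_cont2 k hU.sm hF.sm)) (fun s x hx => ?_)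
  exact (sg_line k hU.sm hF.sm (sph_ne hx) s).const_mul _
theorem V_deriv (k : ℕ) {U F : Eu n → ℝ} (hU : Hg U) (hF : Hg F) (s : ℝ) :
    HasDerivAt (fun s : ℝ => VV k (fun y => U y + s * F y))
      ((k + 1) * ∫ x, F x * sg k (fun y => U y + s * F y) x ∂(mu n)) s := by
  have h3 : ∀ s : ℝ, Hg (fun y => U y + s * F y) := fun s => hU.add (hF.cmul s)
  have h1 := V_deriv2 k hU hF hU.sm.cont s
  have h2 := (hasDerivAt_id s).mul (V_deriv2 k hU hF hF.sm.cont s)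
  have e : (fun s : ℝ => VV k (fun y => U y + s * F y)) = fun s : ℝ => (∫ x, U x * sg k (fun y => U y + s * F y) x ∂(mu n))
      + id s * ∫ x, F x * sg k (fun y => U y + s * F y) x ∂(mu n) := by
    ext s
    rw [VV, id, ← integral_const_mul, ← integral_add (intg (hU.sm.mul (sg_sm k (h3 s).sm)).cont)
      (intg ((hF.sm.mul (sg_sm k (h3 s).sm)).cmul s).cont)]
    exact int_congr fun x _ => by ring
  rw [e]
  refine (h1.add h2).congr_deriv ?_
  have h4 := F1 k (h3 s) hF (h3 s)
  have h5 : ∫ x, (U x + s * F x) * LL k (fun y => U y + s * F y) F x ∂(mu n) = (∫ x, U x * LL k (fun y => U y + s * F y) F x ∂(mu n))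
     + s * ∫ x, F x * LL k (fun y => U y + s * F y) F x ∂(mu n) := by
    rw [← integral_const_mul, ← integral_add (intg (hU.sm.mul (LL_sm k (h3 s).sm hF.sm)).cont)
      (intg ((hF.sm.mul (LL_sm k (h3 s).sm hF.sm)).cmul s).cont)]
    exact int_congr fun x _ => by ring
  have h6 : ∫ x, F x * LL k (fun y => U y + s * F y) (fun y => U y + s * F y) x ∂(mu n) = k * ∫ x, F x * sg k (fun y => U y + s * F y) x ∂(mu n) := by
    rw [← integral_const_mul]
    exact int_congr fun x _ => by rw [LL_self]; ring
  simp only [id]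
  linarith
theorem homExt_sph (u : Eu n → ℝ) {x : Eu n} (hx : x ∈ sph n) : homExt u x = u x := by
  simp [homExt, mem_sph.mp hx]
theorem homExt_hg {u : Eu n → ℝ} (h : SmoothOnSphere u) : Hg (homExt u) := by
  refine ⟨h, fun r hr y hy => ?_⟩
  have : (‖r • y‖)⁻¹ • (r • y) = ‖y‖⁻¹ • y := by
    rw [norm_smul, Real.norm_of_nonneg hr.le, smul_smul]; congr 1
    field_simp
  rw [homExt, this, norm_smul, Real.norm_of_nonneg hr.le, homExt]; ring
theorem hess_coord {u : Eu n → ℝ} (h : SmoothOnSphere u) {x : Eu n} (hx : x ≠ 0) (i j : Fin (n+1)) :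
    (hessOp u x (bv j)) i = Hm (homExt u) x j i := by
  have hs : Sm (homExt u) := h
  have hg : ∀ y i, (gradient (homExt u) y) i = pd i (homExt u) y := by
    intro y i
    have : ⟪gradient (homExt u) y, bv i⟫ = fderiv ℝ (homExt u) y (bv i) := by
      rw [gradient, InnerProductSpace.toDual_symm_apply]
    rw [pd, ← this, bv, EuclideanSpace.inner_single_right]; simp
  have hd : DifferentiableAt ℝ (gradient (homExt u)) x := by
    rw [differentiableAt_euclidean]
    intro i
    simp only [hg]
    exact (hs.pd i).diff hx
  have h2 : HasFDerivAt (fun y => (gradient (homExt u) y) i) ((EuclideanSpace.proj i : Eu n →L[ℝ] ℝ).comp (fderiv ℝ (gradient (homExt u)) x)) x :=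
    (EuclideanSpace.proj i : Eu n →L[ℝ] ℝ).hasFDerivAt.comp x hd.hasFDerivAt
  simp only [hg] at h2
  rw [Hm, pd, show pd i (homExt u) = fun y => pd i (homExt u) y from rfl, h2.fderiv]
  rfl
open Polynomial in
theorem sigmaK_eq {k : ℕ} (hk : k ≤ n) {u : Eu n → ℝ} (h : SmoothOnSphere u) {x : Eu n} (hx : x ∈ sph n) :
    sigmaK n k u x = sg k (homExt u) x := by
  have hx0 := sph_ne hx
  let b := (EuclideanSpace.basisFun (Fin (n+1)) ℝ).toBasis
  have hM : LinearMap.toMatrix b b (hessOp u x).toLinearMap = Matrix.of (Hm (homExt u) x) := by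
    ext i j
    rw [LinearMap.toMatrix_apply]
    have := hess_coord h hx0 i j
    rw [Matrix.of_apply, Hm_symm (homExt_hg h).sm hx0, ← this]
    simp [b, bv]
  rw [sigmaK, esymmOp, ← LinearMap.charpoly_toMatrix _ b, hM]
  set A := Hm (homExt u) x
  have h1 := Matrix.reverse_charpoly (Matrix.of A)
  have h2 : (Matrix.of A).charpolyRev.coeff k = es k (-A) := by
    rw [Matrix.charpolyRev, es]
    congr 2
    ext i j; simp [Matrix.one_apply]; ring_nf
  have h3 : es k (-A) = (-1)^k * es k A := by
    rw [← es_smul]; simp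
  rw [← h1, coeff_reverse, Matrix.charpoly_natDegree_eq_dim, Fintype.card_fin, revAt_le (by omega), h3] at h2
  rw [h2, sg, ← mul_assoc, ← mul_pow]; simp [A]
open Polynomial in
def esR {R : Type} [CommRing R] {m : ℕ} (k : ℕ) (B : Matrix (Fin m) (Fin m) R) : R :=
  (Matrix.det ((X : R[X]) • B.map C + (1 : Matrix (Fin m) (Fin m) R).map C)).coeff k
open Polynomial in
theorem esR_map {R S : Type} [CommRing R] [CommRing S] (φ : R →+* S) {m : ℕ} (k : ℕ) (B : Matrix (Fin m) (Fin m) R) :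
    φ (esR k B) = esR k (B.map φ) := by
  rw [esR, ← coeff_map, ← coe_mapRingHom, RingHom.map_det, esR]
  congr 2
  ext i j
  by_cases h : i = j <;> simp [Matrix.one_apply, h]
open Polynomial in
theorem esR_charpoly {R : Type} [CommRing R] [Nontrivial R] {m : ℕ} {k : ℕ} (hk : k ≤ m) (B : Matrix (Fin m) (Fin m) R) :
    esR k B = (-B).charpoly.coeff (m - k) := by
  have h1 := Matrix.reverse_charpoly (-B)
  have h2 : (-B).charpolyRev.coeff k = esR k B := by
    rw [Matrix.charpolyRev, esR]
    congr 2
    ext i j; by_cases h : i = j <;> simp [Matrix.one_apply, h, add_comm]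
  rw [← h2, ← h1, coeff_reverse, Matrix.charpoly_natDegree_eq_dim, Fintype.card_fin, revAt_le hk]
def qf {m : ℕ} (A : Mt m) (v : Fin m → ℝ) : ℝ := ∑ i, ∑ j, v i * A i j * v j
structure PD {m : ℕ} (A : Mt m) : Prop where
  symm : ∀ i j, A i j = A j i
  pos : ∀ v : Fin m → ℝ, v ≠ 0 → 0 < qf A v
theorem herm {A : Mt m} (hA : ∀ i j, A i j = A j i) (v : Fin m → ℂ) :
    ∑ i, ∑ j, (starRingEnd ℂ) (v i) * (A i j : ℂ) * v j = ((qf A (fun i => (v i).re) + qf A (fun i => (v i).im) : ℝ) : ℂ) := by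
  apply Complex.ext
  · simp only [Complex.re_sum, Complex.ofReal_re, qf, ← Finset.sum_add_distrib]
    refine Finset.sum_congr rfl fun i _ => Finset.sum_congr rfl fun j _ => ?_
    simp [← sub_eq_add_neg]; try ring
  · simp only [Complex.im_sum, Complex.ofReal_im]
    have : ∑ i, ∑ j, ((starRingEnd ℂ) (v i) * (A i j : ℂ) * v j).im = - ∑ i, ∑ j, ((starRingEnd ℂ) (v i) * (A i j : ℂ) * v j).im := by
      conv_lhs => rw [Finset.sum_comm]
      simp only [← Finset.sum_neg_distrib]
      refine Finset.sum_congr rfl fun i _ => Finset.sum_congr rfl fun j _ => ?_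
      rw [hA j i]; simp; ring
    linarith
open Polynomial in
theorem halfplane {z : ℂ} (j : ℕ) (P : ℂ[X]) (hj : j < P.natDegree)
    (h : ∀ w, P.eval w = 0 → 0 < (w * (starRingEnd ℂ) z).im * z.im) :
    ∀ w, (derivative^[j] P).eval w = 0 → 0 < (w * (starRingEnd ℂ) z).im * z.im := by
  induction j generalizing P with
  | zero => exact h
  | succ j ih =>
    rw [Function.iterate_succ_apply]
    have hd : 0 < P.degree := natDegree_pos_iff_degree_pos.mp (by omega)
    have hnd : (derivative P).natDegree = P.natDegree - 1 := natDegree_eq_of_degree_eq_some (degree_derivative (by omega))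
    refine ih _ (by omega) fun w hw => ?_
    have hne : derivative P ≠ 0 := by
      intro h0; rw [h0] at hnd; simp at hnd; omega
    have h1 := rootSet_derivative_subset_convexHull_rootSet hd
    have h2 : w ∈ convexHull ℝ (P.rootSet ℂ) := h1 (by rw [mem_rootSet]; exact ⟨hne, by simpa using hw⟩)
    have hcv : Convex ℝ {w : ℂ | 0 < (w * (starRingEnd ℂ) z).im * z.im} := by
      intro a ha b hb s t hs ht hst
      simp only [Set.mem_ofPred_eq] at ha hb ⊢
      have e : ((s • a + t • b) * (starRingEnd ℂ) z).im * z.im = s * ((a * (starRingEnd ℂ) z).im * z.im) + t * ((b * (starRingEnd ℂ) z).im * z.im) := by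
        simp; ring
      rw [e]
      rcases hs.eq_or_lt with h | h
      · have : t = 1 := by linarith
        simp [← h, this]; simpa using hb
      · have := mul_pos h ha
        have := mul_nonneg ht hb.le
        linarith
    refine convexHull_min (fun r hr => ?_) hcv h2
    rw [mem_rootSet] at hr
    exact h r (by simpa using hr.2)
open Polynomial in
theorem esC_ne {k : ℕ} (hk : k ≤ m) {A M : Mt m} (hA : PD A) (hM : ∀ i j, M i j = M j i) {z : ℂ} (hz : z.im ≠ 0) :
    esR k (Matrix.of fun i j => (A i j : ℂ) + z * (M i j : ℂ)) ≠ 0 := by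
  set B : Matrix (Fin m) (Fin m) ℂ := Matrix.of fun i j => (A i j : ℂ) + z * (M i j : ℂ) with hB
  rw [esR_charpoly hk]
  have hdeg : (-B).charpoly.natDegree = m := by rw [Matrix.charpoly_natDegree_eq_dim, Fintype.card_fin]
  rcases Nat.eq_zero_or_pos k with rfl | hk0
  · have := (Matrix.charpoly_monic (-B)).coeff_natDegree
    rw [hdeg] at this; rw [Nat.sub_zero, this]; exact one_ne_zero
  have hr : ∀ w, (-B).charpoly.eval w = 0 → 0 < (w * (starRingEnd ℂ) z).im * z.im := by
    intro w hw
    rw [Matrix.eval_charpoly] at hw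
    obtain ⟨v, hv, hv2⟩ := Matrix.exists_mulVec_eq_zero_iff.mpr hw
    have h1 : ∀ i, w * v i + ∑ j, ((A i j : ℂ) + z * (M i j : ℂ)) * v j = 0 := by
      intro i
      have := congrFun hv2 i
      rw [sub_neg_eq_add, Matrix.add_mulVec] at this
      simpa [Matrix.mulVec, dotProduct, Matrix.scalar_apply, Matrix.diagonal_apply, hB] using this
    have h2 : w * ∑ i, (starRingEnd ℂ) (v i) * v i + (∑ i, ∑ j, (starRingEnd ℂ) (v i) * (A i j : ℂ) * v j)
        + z * ∑ i, ∑ j, (starRingEnd ℂ) (v i) * (M i j : ℂ) * v j = 0 := by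
      have : ∑ i, (starRingEnd ℂ) (v i) * (w * v i + ∑ j, ((A i j : ℂ) + z * (M i j : ℂ)) * v j) = 0 :=
        Finset.sum_eq_zero fun i _ => by rw [h1 i, mul_zero]
      rw [← this]
      simp only [Finset.mul_sum, ← Finset.sum_add_distrib, mul_add]
      refine Finset.sum_congr rfl fun i _ => ?_
      rw [add_assoc, ← Finset.sum_add_distrib]
      congr 1
      · ring
      · exact Finset.sum_congr rfl fun j _ => by ring
    rw [herm hA.symm, herm hM] at h2
    have h3 : ∑ i, (starRingEnd ℂ) (v i) * v i = ((∑ i, Complex.normSq (v i) : ℝ) : ℂ) := by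
      push_cast
      exact Finset.sum_congr rfl fun i _ => by rw [Complex.normSq_eq_conj_mul_self]
    have hpos : 0 < ∑ i, Complex.normSq (v i) := by
      obtain ⟨i, hi⟩ := Function.ne_iff.mp hv
      exact Finset.sum_pos' (fun i _ => Complex.normSq_nonneg _) ⟨i, Finset.mem_univ i, Complex.normSq_pos.mpr hi⟩
    have ha : 0 < qf A (fun i => (v i).re) + qf A (fun i => (v i).im) := by
      have hn : ∀ p : Fin m → ℝ, 0 ≤ qf A p := by
        intro p
        by_cases hp : p = 0
        · simp [hp, qf]
        · exact (hA.pos p hp).le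
      by_cases hre : (fun i => (v i).re) = 0
      · have him : (fun i => (v i).im) ≠ 0 := by
          intro him
          exact hv (funext fun i => Complex.ext (congrFun hre i) (congrFun him i))
        have := hA.pos _ him
        have := hn (fun i => (v i).re); linarith
      · have := hA.pos _ hre
        have := hn (fun i => (v i).im); linarith
    rw [h3] at h2
    generalize qf A (fun i => (v i).re) + qf A (fun i => (v i).im) = a at ha h2
    generalize qf M (fun i => (v i).re) + qf M (fun i => (v i).im) = b at h2
    generalize ∑ i, Complex.normSq (v i) = q at hpos h2
    have i1 := congrArg Complex.re h2
    have i2 := congrArg Complex.im h2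
    simp at i1 i2
    simp
    have e1 : w.re = -(a + z.re * b)/q := by field_simp; linarith
    have e2 : w.im = -(z.im * b)/q := by field_simp; linarith
    have : (-(w.re * z.im) + w.im * z.re) * z.im = a * z.im^2 / q := by
      rw [e1, e2]; field_simp; ring
    rw [this]; positivity
  intro h0
  have := halfplane (m - k) (-B).charpoly (by omega) hr 0 (by
    rw [← coeff_zero_eq_eval_zero, coeff_iterate_derivative, zero_add, h0]; simp)
  simp at this
open Polynomial in
theorem es_poly {k : ℕ} (hk : k ≤ m) {A M : Mt m} (hA : PD A) (hM : ∀ i j, M i j = M j i) :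
    ∃ q : ℝ[X], (∀ s, q.eval s = es k (A + s • M)) ∧ (q ≠ 0 → q.Splits) := by
  let B : Matrix (Fin m) (Fin m) ℝ[X] := Matrix.of fun i j => C (A i j) + X * C (M i j)
  refine ⟨esR k B, fun s => ?_, fun h0 => ?_⟩
  · rw [← coe_evalRingHom, esR_map]
    show _ = esR k _
    congr 1
    ext i j; simp [B]; exact mul_comm _ _
  · refine Splits.of_splits_map (algebraMap ℝ ℂ) (IsAlgClosed.splits _) fun z hz => ?_
    by_contra hcon
    have him : z.im ≠ 0 := fun h => hcon ⟨z.re, by apply Complex.ext <;> simp [h]⟩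
    apply esC_ne hk hA hM him
    rw [mem_roots', IsRoot.def, eval_map_algebraMap] at hz
    have h2 := hz.2
    have h3 := esR_map (aeval z : ℝ[X] →ₐ[ℝ] ℂ).toRingHom k B
    rw [show (aeval z : ℝ[X] →ₐ[ℝ] ℂ).toRingHom (esR k B) = 0 from h2] at h3
    rw [h3]
    congr 1
    ext i j; simp [B]; exact mul_comm _ _
open Polynomial in
theorem laguerre (s : Multiset ℝ) (h0 : ∀ r ∈ s, r ≠ 0) (P : ℝ[X]) (hP : P = (s.map fun r => X - C r).prod) :
    P.eval 0 ≠ 0 ∧ 0 ≤ (P.derivative.eval 0)^2 - P.eval 0 * P.derivative.derivative.eval 0 ∧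
    (s ≠ 0 → 0 < (P.derivative.eval 0)^2 - P.eval 0 * P.derivative.derivative.eval 0) ∧
    ((∀ r ∈ s, r < 0) → 0 < P.eval 0 ∧ 0 ≤ P.derivative.eval 0) := by
  induction s using Multiset.induction_on generalizing P with
  | empty => subst hP; simp
  | cons r s ih =>
    obtain ⟨i1, i2, -, i4⟩ := ih (fun r hr => h0 r (Multiset.mem_cons_of_mem hr)) _ rfl
    set Q := (s.map fun r => X - C r).prod
    have hP' : P = (X - C r) * Q := by rw [hP, Multiset.map_cons, Multiset.prod_cons]
    have e0 : P.eval 0 = -r * Q.eval 0 := by rw [hP']; simp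
    have e1 : P.derivative.eval 0 = Q.eval 0 - r * Q.derivative.eval 0 := by rw [hP']; simp; ring
    have e2 : P.derivative.derivative.eval 0 = 2 * Q.derivative.eval 0 - r * Q.derivative.derivative.eval 0 := by
      rw [hP']; simp; ring
    have hr := h0 r (Multiset.mem_cons_self r s)
    have key : (P.derivative.eval 0)^2 - P.eval 0 * P.derivative.derivative.eval 0 = (Q.eval 0)^2 +
        r^2 * ((Q.derivative.eval 0)^2 - Q.eval 0 * Q.derivative.derivative.eval 0) := by rw [e0, e1, e2]; ring
    have hp : 0 < (P.derivative.eval 0)^2 - P.eval 0 * P.derivative.derivative.eval 0 := by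
      rw [key]; have := mul_nonneg (sq_nonneg r) i2; have := sq_pos_of_ne_zero i1; linarith
    refine ⟨by rw [e0]; exact mul_ne_zero (neg_ne_zero.mpr hr) i1, hp.le, fun _ => hp, fun hneg => ?_⟩
    obtain ⟨j1, j2⟩ := i4 fun r hr => hneg r (Multiset.mem_cons_of_mem hr)
    have hr' := hneg r (Multiset.mem_cons_self r s)
    exact ⟨by rw [e0]; nlinarith, by rw [e1]; nlinarith⟩
theorem PD_one (m : ℕ) : PD (fun i j : Fin m => if i = j then (1:ℝ) else 0) := by
  refine ⟨fun i j => by simp [eq_comm], fun v hv => ?_⟩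
  obtain ⟨i, hi⟩ := Function.ne_iff.mp hv
  have : qf (fun i j : Fin m => if i = j then (1:ℝ) else 0) v = ∑ i, v i * v i := by simp [qf]
  rw [this]
  exact Finset.sum_pos' (fun i _ => mul_self_nonneg _) ⟨i, Finset.mem_univ i, mul_self_pos.mpr hi⟩
theorem qf_add (A B : Mt m) (v : Fin m → ℝ) : qf (A + B) v = qf A v + qf B v := by
  simp only [qf, ← Finset.sum_add_distrib, Pi.add_apply]
  exact Finset.sum_congr rfl fun i _ => Finset.sum_congr rfl fun j _ => by ring
theorem qf_smul (A : Mt m) (v : Fin m → ℝ) (r : ℝ) : qf (r • A) v = r * qf A v := by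
  simp only [qf, Finset.mul_sum, Pi.smul_apply, smul_eq_mul]
  exact Finset.sum_congr rfl fun i _ => Finset.sum_congr rfl fun j _ => by ring
theorem PD.add_psd {A N : Mt m} (hA : PD A) (hs : ∀ i j, N i j = N j i) (hN : ∀ v, 0 ≤ qf N v) {t : ℝ} (ht : 0 ≤ t) :
    PD (A + t • N) := by
  refine ⟨fun i j => by simp [hA.symm i j, hs i j], fun v hv => ?_⟩
  rw [qf_add, qf_smul]
  have := hA.pos v hv
  have := mul_nonneg ht (hN v); linarith
theorem PD.nonneg {A : Mt m} (hA : PD A) (v : Fin m → ℝ) : 0 ≤ qf A v := by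
  by_cases h : v = 0
  · simp [h, qf]
  · exact (hA.pos v h).le
theorem es_ne {k : ℕ} (hk : k ≤ m) {A : Mt m} (hA : PD A) : es k A ≠ 0 := by
  intro h0
  have := esC_ne hk hA hA.symm (z := Complex.I) (by simp)
  apply this
  have h1 := esR_map (Polynomial.evalRingHom (Complex.I)) k
    (Matrix.of fun i j => (1 + Polynomial.X) * Polynomial.C (A i j : ℂ))
  have h2 : esR k (Matrix.of fun i j => (1 + Polynomial.X) * Polynomial.C (A i j : ℂ)) = 0 := by
    apply Polynomial.eq_zero_of_infinite_isRoot
    refine Set.Infinite.mono (s := Set.range fun r : ℝ => (r : ℂ)) ?_ (Set.infinite_range_of_injective Complex.ofReal_injective)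
    rintro _ ⟨r, rfl⟩
    show Polynomial.eval _ _ = 0
    rw [← Polynomial.coe_evalRingHom, esR_map]
    have h3 := esR_map Complex.ofRealHom k (Matrix.of ((1 + r) • A))
    rw [show esR k (Matrix.of ((1 + r) • A)) = es k ((1+r) • A) from rfl, es_smul, h0] at h3
    rw [mul_zero, map_zero] at h3
    rw [h3]; congr 1
    ext i j; simp
  rw [h2, map_zero] at h1
  rw [h1]; congr 1
  ext i j; simp; ring
theorem es_one_pos {k : ℕ} (hk : k ≤ m) : 0 < es k (fun i j : Fin m => if i = j then (1:ℝ) else 0) := by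
  induction k with
  | zero => rw [es_zero]; exact one_pos
  | succ k ih =>
    have := recL k (fun i j : Fin m => if i = j then (1:ℝ) else 0) (fun i j : Fin m => if i = j then (1:ℝ) else 0)
    rw [show mm (fun i j : Fin m => if i = j then (1:ℝ) else 0) (fun i j : Fin m => if i = j then (1:ℝ) else 0) = (fun i j : Fin m => if i = j then (1:ℝ) else 0) by
      ext i j; simp [mm], eD_self, eD_self] at this
    have h2 : tr (fun i j : Fin m => if i = j then (1:ℝ) else 0) = m := by simp [tr]
    rw [h2] at this
    have i := ih (by omega)
    have h3 : (0:ℝ) < m - k := by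
      have : (k:ℝ) + 1 ≤ m := by exact_mod_cast hk
      linarith
    have h4 := mul_pos i h3
    push_cast at this
    have h5 : ((k:ℝ)+1) * es (k+1) (fun i j : Fin m => if i = j then (1:ℝ) else 0) > 0 := by linarith
    exact pos_of_mul_pos_right h5 (by positivity)
theorem es_pos {k : ℕ} (hk : k ≤ m) {A : Mt m} (hA : PD A) : 0 < es k A := by
  by_contra hcon
  let I : Mt m := fun i j => if i = j then (1:ℝ) else 0
  have hc : Continuous fun s : ℝ => es k (s • A + I) := (es_contDiff k).continuous.comp (by fun_prop)
  have hpd2 : ∀ s : ℝ, 0 ≤ s → PD (s • A + I) := fun s hs => by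
    rw [add_comm]; exact (PD_one m).add_psd hA.symm hA.nonneg hs
  have h0 : 0 < es k ((0:ℝ) • A + I) := by rw [zero_smul, zero_add]; exact es_one_pos hk
  have hall : ∀ s : ℝ, 0 ≤ s → 0 < es k (s • A + I) := by
    intro s hs
    by_contra h
    obtain ⟨c, hc1, hc2⟩ := intermediate_value_Icc' hs hc.continuousOn (show (0:ℝ) ∈ Set.Icc _ _ from ⟨not_lt.mp h, h0.le⟩)
    exact es_ne hk (hpd2 c hc1.1) hc2
  have hlim : Tendsto (fun s : ℝ => es k (A + s • I)) (𝓝[>] 0) (𝓝 (es k A)) := by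
    have : Continuous fun s : ℝ => es k (A + s • I) := (es_contDiff k).continuous.comp (by fun_prop)
    have := this.tendsto 0
    simp only [zero_smul, add_zero] at this
    exact this.mono_left nhdsWithin_le_nhds
  have : 0 ≤ es k A := by
    refine ge_of_tendsto hlim ?_
    filter_upwards [self_mem_nhdsWithin] with s hs
    have hs' : (0:ℝ) < s := hs
    have h1 := hall s⁻¹ (inv_pos.mpr hs').le
    have h2 : A + s • I = s • (s⁻¹ • A + I) := by rw [smul_add, smul_smul, mul_inv_cancel₀ hs'.ne', one_smul]
    rw [h2, es_smul]; positivity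
  exact es_ne hk hA (le_antisymm (not_lt.mp hcon) this)
open Polynomial in
theorem poly_derivs {k : ℕ} {A M : Mt m} {q : ℝ[X]} (hq : ∀ s, q.eval s = es k (A + s • M)) :
    q.eval 0 = es k A ∧ q.derivative.eval 0 = eD k A M ∧ q.derivative.derivative.eval 0 = eDD k A M M ∧
    ∀ s, q.derivative.eval s = eD k (A + s • M) M := by
  have h1 : ∀ s, q.derivative.eval s = eD k (A + s • M) M := by
    intro s
    refine (q.hasDerivAt s).unique ?_
    rw [show (fun s => eval s q) = fun s => es k (A + s • M) from funext hq]
    exact es_line k A M s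
  refine ⟨by simpa using hq 0, by simpa using h1 0, ?_, h1⟩
  refine (q.derivative.hasDerivAt 0).unique ?_
  rw [show (fun s => eval s q.derivative) = fun s => eD k (A + s • M) M from funext h1]
  simpa using eD_line k A M M 0
open Polynomial in
theorem splits_lag {q : ℝ[X]} (hs : q.Splits) (h0 : q.eval 0 ≠ 0) :
    0 ≤ (q.derivative.eval 0)^2 - q.eval 0 * q.derivative.derivative.eval 0 ∧
    ((q.derivative.eval 0)^2 - q.eval 0 * q.derivative.derivative.eval 0 = 0 → q.derivative = 0) ∧
    (0 < q.eval 0 → (∀ s, 0 ≤ s → q.eval s ≠ 0) → 0 ≤ q.derivative.eval 0) := by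
  have hq0 : q ≠ 0 := fun h => h0 (by simp [h])
  have hr : ∀ r ∈ q.roots, r ≠ 0 := fun r hr h => h0 (by rw [h] at hr; exact (mem_roots'.mp hr).2)
  obtain ⟨l1, l2, l3, l4⟩ := laguerre q.roots hr _ rfl
  have hP := hs.eq_prod_roots
  set P := (q.roots.map fun r => X - C r).prod
  set a := q.leadingCoeff
  have ha : a ≠ 0 := leadingCoeff_ne_zero.mpr hq0
  have e0 : q.eval 0 = a * P.eval 0 := by conv_lhs => rw [hP]; simp
  have e1 : q.derivative.eval 0 = a * P.derivative.eval 0 := by conv_lhs => rw [hP]; simp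
  have e2 : q.derivative.derivative.eval 0 = a * P.derivative.derivative.eval 0 := by conv_lhs => rw [hP]; simp
  have key : (q.derivative.eval 0)^2 - q.eval 0 * q.derivative.derivative.eval 0 = a^2 * ((P.derivative.eval 0)^2 - P.eval 0 * P.derivative.derivative.eval 0) := by
    rw [e0, e1, e2]; ring
  refine ⟨by rw [key]; positivity, fun h => ?_, fun hp hn => ?_⟩
  · by_cases hz : q.roots = 0
    · rw [hP]; simp [P, hz]
    · have := l3 hz
      rw [key] at h
      have := mul_pos (pow_pos (abs_pos.mpr ha) 2) this
      rw [sq_abs] at this; linarith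
  · obtain ⟨m1, m2⟩ := l4 fun r hr => by
      by_contra hcon
      exact hn r (not_lt.mp hcon) (mem_roots'.mp hr).2
    rw [e0] at hp
    rw [e1]
    exact mul_nonneg (pos_of_mul_pos_left hp m1.le).le m2
theorem lag_weak {k : ℕ} (hk : k ≤ m) {A M : Mt m} (hA : PD A) (hM : ∀ i j, M i j = M j i) :
    0 ≤ (eD k A M)^2 - es k A * eDD k A M M ∧
    ((eD k A M)^2 - es k A * eDD k A M M = 0 → ∀ s : ℝ, eD k (A + s • M) M = 0) := by
  obtain ⟨q, h1, h2⟩ := es_poly hk hA hM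
  obtain ⟨d0, d1, d2, d3⟩ := poly_derivs h1
  have hn : q.eval 0 ≠ 0 := by rw [d0]; exact (es_pos hk hA).ne'
  obtain ⟨s1, s2, -⟩ := splits_lag (h2 fun h => hn (by simp [h])) hn
  rw [d0, d1, d2] at s1 s2
  refine ⟨s1, fun h s => ?_⟩
  rw [← d3, s2 h]; simp
theorem eD_psd {k : ℕ} (hk : k ≤ m) {A N : Mt m} (hA : PD A) (hs : ∀ i j, N i j = N j i) (hN : ∀ v, 0 ≤ qf N v) :
    0 ≤ eD k A N := by
  obtain ⟨q, h1, h2⟩ := es_poly hk hA hs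
  obtain ⟨d0, d1, d2, d3⟩ := poly_derivs h1
  have hp : 0 < q.eval 0 := by rw [d0]; exact es_pos hk hA
  obtain ⟨-, -, s3⟩ := splits_lag (h2 fun h => hp.ne' (by simp [h])) hp.ne'
  rw [← d1]
  refine s3 hp fun s hs0 => ?_
  rw [h1]; exact (es_pos hk (hA.add_psd hs hN hs0)).ne'
def I1 (m : ℕ) : Mt m := fun i j => if i = j then (1:ℝ) else 0
theorem qf_vsmul (A : Mt m) (v : Fin m → ℝ) (r : ℝ) : qf A (r • v) = r^2 * qf A v := by
  simp only [qf, Finset.mul_sum, Pi.smul_apply, smul_eq_mul]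
  exact Finset.sum_congr rfl fun i _ => Finset.sum_congr rfl fun j _ => by ring
theorem pd_open {A M : Mt m} (hA : PD A) (hM : ∀ i j, M i j = M j i) : ∀ᶠ e : ℝ in 𝓝 0, PD (A + e • M) := by
  have h1 : ∀ᶠ e : ℝ in 𝓝 0, ∀ v ∈ Metric.sphere (0 : Fin m → ℝ) 1, 0 < qf (A + e • M) v := by
    refine (isCompact_sphere _ _).eventually_forall_of_forall_eventually fun v hv => ?_
    have hc : Continuous fun p : (Fin m → ℝ) × ℝ => qf (A + p.2 • M) p.1 := by unfold qf; fun_prop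
    have hv0 : v ≠ 0 := by rintro rfl; simp at hv
    have : 0 < qf (A + ((v, (0:ℝ)) : (Fin m → ℝ) × ℝ).2 • M) v := by simpa using hA.pos v hv0
    have := (hc.tendsto (v, 0)).eventually_const_lt this
    exact (continuous_swap.tendsto ((0:ℝ), v)).eventually this
  filter_upwards [h1] with e he
  refine ⟨fun i j => by simp [hA.symm i j, hM i j], fun v hv => ?_⟩
  have hn := norm_pos_iff.mpr hv
  have := he (‖v‖⁻¹ • v) (by rw [mem_sphere_zero_iff_norm, norm_smul, norm_inv, norm_norm, inv_mul_cancel₀ hn.ne'])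
  rw [qf_vsmul] at this
  exact pos_of_mul_pos_right this (by positivity)
theorem eD_I (k : ℕ) (A : Mt m) : eD (k+1) A (I1 m) = (m - k) * es k A := by
  have := recL k A (I1 m)
  rw [show mm A (I1 m) = A by ext i j; simp [mm, I1], eD_self, show tr (I1 m) = m by simp [tr, I1]] at this
  linarith
theorem eDD_addl (k : ℕ) (A M M' N : Mt m) : eDD k A (M + M') N = eDD k A M N + eDD k A M' N := by simp [eDD]
theorem eDD_addr (k : ℕ) (A M N N' : Mt m) : eDD k A M (N + N') = eDD k A M N + eDD k A M N' := by simp [eDD]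
theorem eDD_smull (k : ℕ) (A M N : Mt m) (r : ℝ) : eDD k A (r • M) N = r * eDD k A M N := by simp [eDD]
theorem eDD_smulr (k : ℕ) (A M N : Mt m) (r : ℝ) : eDD k A M (r • N) = r * eDD k A M N := by simp [eDD]
theorem lin_zero {a c : ℝ} (h : ∀ t : ℝ, 0 ≤ t^2 * a + t * c) : c = 0 := by
  have h1 := h (c / (-(2 * (|a| + 1))))
  have h2 : (0:ℝ) < |a| + 1 := by positivity
  have h3 : (c / (-(2 * (|a| + 1))))^2 * a + c / (-(2 * (|a| + 1))) * c = -(c^2) * (2 * (|a| + 1) - a) / (4 * (|a|+1)^2) := by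
    field_simp; ring
  rw [h3] at h1
  by_contra hc
  have h4 : 0 < c^2 := by positivity
  have h5 : 0 < 2 * (|a| + 1) - a := by have := le_abs_self a; linarith [abs_nonneg a]
  have : -(c^2) * (2 * (|a| + 1) - a) / (4 * (|a|+1)^2) < 0 := by
    apply div_neg_of_neg_of_pos
    · have := mul_pos h4 h5; linarith
    · positivity
  linarith
theorem star_desc {k : ℕ} (hk : k + 1 ≤ m) {A M : Mt m} (hA : PD A) (hM : ∀ i j, M i j = M j i)
    (h : ∀ᶠ e : ℝ in 𝓝 0, eD (k+1) (A + e • M) M = 0) : ∀ᶠ e : ℝ in 𝓝 0, eD k (A + e • M) M = 0 := by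
  filter_upwards [pd_open hA hM, h.eventually_nhds] with e hP he
  set A' := A + e • M with hA'
  have h0 : ∀ᶠ s : ℝ in 𝓝 0, eD (k+1) (A' + s • M) M = 0 := by
    have : Tendsto (fun s : ℝ => e + s) (𝓝 0) (𝓝 e) := by
      have : Continuous fun s : ℝ => e + s := by fun_prop
      simpa using this.tendsto 0
    filter_upwards [this.eventually he] with s hs
    rw [hA', add_assoc, ← add_smul]; exact hs
  have z1 : eD (k+1) A' M = 0 := by simpa using h0.self_of_nhds
  have z2 : eDD (k+1) A' M M = 0 := by
    have a := eD_line (k+1) A' M M 0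
    rw [zero_smul, add_zero] at a
    refine a.unique ((hasDerivAt_const (0:ℝ) (0:ℝ)).congr_of_eventuallyEq h0)
  have z3 : eDD (k+1) A' M (I1 m) = 0 := by
    have hs : ∀ t : ℝ, ∀ i j, (M + t • I1 m) i j = (M + t • I1 m) j i := fun t i j => by simp [hM i j, I1, eq_comm]
    have a := fun t => (lag_weak hk hP (hs t)).1
    have hp := es_pos hk hP
    have : -(2 * es (k+1) A' * eDD (k+1) A' M (I1 m)) = 0 := by
      refine lin_zero (a := (eD (k+1) A' (I1 m))^2 - es (k+1) A' * eDD (k+1) A' (I1 m) (I1 m)) fun t => ?_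
      have := a t
      rw [eD_add, eD_smul, eDD_addl, eDD_addr, eDD_addr, eDD_smull, eDD_smull, eDD_smulr, eDD_smulr, z1, z2,
        eDD_comm (k+1) A' (I1 m) M] at this
      linarith
    have h2 : (2 * es (k+1) A') * eDD (k+1) A' M (I1 m) = 0 := by linarith
    exact (mul_eq_zero.mp h2).resolve_left (by positivity)
  have z4 : eDD (k+1) A' (I1 m) M = (m - k) * eD k A' M := by
    have a := eD_line (k+1) A' M (I1 m) 0
    simp only [eD_I, zero_smul, add_zero] at a
    refine a.unique ?_
    have := (es_line k A' M 0).const_mul ((m:ℝ) - k)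
    simpa using this
  rw [eDD_comm, z3] at z4
  have : (0:ℝ) < m - k := by
    have : (k:ℝ) + 1 ≤ m := by exact_mod_cast hk
    linarith
  exact (mul_eq_zero.mp z4.symm).resolve_left this.ne'
theorem starZ {k : ℕ} (hk2 : 2 ≤ k) (hk : k ≤ m) {A M : Mt m} (hA : PD A) (hM : ∀ i j, M i j = M j i)
    (h : ∀ᶠ e : ℝ in 𝓝 0, eD k (A + e • M) M = 0) : M = 0 := by
  induction k, hk2 using Nat.le_induction with
  | base =>
    have h1 := (star_desc hk hA hM h).self_of_nhds
    rw [eD_one] at h1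
    have h2 : ∀ᶠ e : ℝ in 𝓝 0, tr (mm A M) + e * tr (mm M M) = 0 := by
      filter_upwards [h] with e he
      have := recL 1 (A + e • M) M
      rw [he, eD_one, h1] at this
      have e2 : tr (mm (A + e • M) M) = tr (mm A M) + e * tr (mm M M) := by
        simp only [tr, mm, Finset.mul_sum, ← Finset.sum_add_distrib, Pi.add_apply, Pi.smul_apply, smul_eq_mul]
        exact Finset.sum_congr rfl fun i _ => Finset.sum_congr rfl fun j _ => by ring
      linarith
    have h3 : tr (mm M M) = 0 := by
      have d : HasDerivAt (fun e : ℝ => tr (mm A M) + e * tr (mm M M)) (tr (mm M M)) 0 := by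
        simpa using ((hasDerivAt_id (0:ℝ)).mul_const (tr (mm M M))).const_add (tr (mm A M))
      exact d.unique ((hasDerivAt_const (0:ℝ) (0:ℝ)).congr_of_eventuallyEq h2)
    have h4 : ∑ i, ∑ j, M i j * M i j = 0 := by
      rw [← h3]; simp only [tr, mm]
      exact Finset.sum_congr rfl fun i _ => Finset.sum_congr rfl fun j _ => by rw [hM i j]
    ext i j
    have h5 := (Finset.sum_eq_zero_iff_of_nonneg (fun i _ => Finset.sum_nonneg fun j _ => mul_self_nonneg (M i j))).mp h4 i (Finset.mem_univ i)
    have h6 := (Finset.sum_eq_zero_iff_of_nonneg (fun j _ => mul_self_nonneg (M i j))).mp h5 j (Finset.mem_univ j)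
    exact mul_self_eq_zero.mp h6
  | succ k hk2 ih => exact ih (by omega) (star_desc hk hA hM h)
theorem starN {k : ℕ} (hk2 : 2 ≤ k) (hk : k ≤ m) {A M : Mt m} (hA : PD A) (hM : ∀ i j, M i j = M j i)
    (h : eD k A M = 0) (h0 : M ≠ 0) : eDD k A M M < 0 := by
  obtain ⟨l1, l2⟩ := lag_weak hk hA hM
  have hp := es_pos hk hA
  rw [h] at l1 l2
  have h1 : eDD k A M M ≤ 0 := by
    by_contra hc
    have := mul_pos hp (not_le.mp hc); linarith
  refine lt_of_le_of_ne h1 fun h2 => h0 ?_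
  exact starZ hk2 hk hA hM (Eventually.of_forall (l2 (by rw [h2]; ring)))
structure Kx {n : ℕ} (x : Eu n) (A : Mt (n+1)) : Prop where
  symm : ∀ i j, A i j = A j i
  ker : ∀ i, ∑ j, A i j * x j = 0
structure PT {n : ℕ} (x : Eu n) (A : Mt (n+1)) : Prop extends Kx x A where
  pos : ∀ v : Fin (n+1) → ℝ, ∑ i, v i * x i = 0 → v ≠ 0 → 0 < qf A v
theorem Kx.add {x : Eu n} {A B : Mt (n+1)} (hA : Kx x A) (hB : Kx x B) : Kx x (A + B) :=
  ⟨fun i j => by simp [hA.symm i j, hB.symm i j], fun i => by simp [add_mul, Finset.sum_add_distrib, hA.ker, hB.ker]⟩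
theorem Kx.smul {x : Eu n} {A : Mt (n+1)} (hA : Kx x A) (r : ℝ) : Kx x (r • A) :=
  ⟨fun i j => by simp [hA.symm i j], fun i => by
    have := hA.ker i
    simp only [Pi.smul_apply, smul_eq_mul, mul_assoc, ← Finset.mul_sum, this, mul_zero]⟩
theorem exY {x : Eu n} (hx : x ∈ sph n) : ∃ Y : Matrix (Fin (n+1)) (Fin n) ℝ,
    Y.transpose * Y = 1 ∧ ∀ i j, (Y * Y.transpose) i j = (if i = j then 1 else 0) - x i * x j := by
  have ho : Orthonormal ℝ (Set.restrict ({0} : Set (Fin (n+1))) fun _ => x) := by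
    refine ⟨fun _ => mem_sph.mp hx, fun a b hab => ?_⟩
    exact absurd (Subsingleton.elim a b) hab
  obtain ⟨b, hb⟩ := ho.exists_orthonormalBasis_extension_of_card_eq (by simp)
  have hb0 : b 0 = x := hb 0 rfl
  refine ⟨Matrix.of fun i a => b a.succ i, ?_, fun i j => ?_⟩
  · ext a c
    have := orthonormal_iff_ite.mp b.orthonormal a.succ c.succ
    rw [PiLp.inner_apply] at this
    simp only [Fin.succ_inj] at this
    rw [Matrix.mul_apply, Matrix.one_apply, ← this]
    exact Finset.sum_congr rfl fun i _ => by simp [mul_comm]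
  · have := b.sum_inner_mul_inner (bv i) (bv j)
    rw [Fin.sum_univ_succ, hb0] at this
    simp only [bv, EuclideanSpace.inner_single_left, EuclideanSpace.inner_single_right] at this
    simp [Matrix.mul_apply, EuclideanSpace.single_apply, eq_comm] at this ⊢
    linarith
def cj {n : ℕ} (Y : Matrix (Fin (n+1)) (Fin n) ℝ) (A : Mt (n+1)) : Mt n := Y.transpose * Matrix.of A * Y
theorem cj_apply (Y : Matrix (Fin (n+1)) (Fin n) ℝ) (A : Mt (n+1)) (a b) :
    cj Y A a b = ∑ i, ∑ j, Y i a * A i j * Y j b := by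
  rw [cj, Matrix.mul_apply, Finset.sum_comm]
  simp [Matrix.mul_apply, Finset.sum_mul]
theorem cj_add (Y : Matrix (Fin (n+1)) (Fin n) ℝ) (A B : Mt (n+1)) : cj Y (A + B) = cj Y A + cj Y B := by
  show Y.transpose * (Matrix.of A + Matrix.of B) * Y = _
  rw [Matrix.mul_add, Matrix.add_mul]; rfl
theorem cj_smul (Y : Matrix (Fin (n+1)) (Fin n) ℝ) (A : Mt (n+1)) (r : ℝ) : cj Y (r • A) = r • cj Y A := by
  show Y.transpose * (r • Matrix.of A) * Y = r • (Y.transpose * Matrix.of A * Y)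
  rw [Matrix.mul_smul, Matrix.smul_mul]
theorem cj_symm (Y : Matrix (Fin (n+1)) (Fin n) ℝ) {A : Mt (n+1)} (h : ∀ i j, A i j = A j i) (a b) : cj Y A a b = cj Y A b a := by
  rw [cj_apply, cj_apply, Finset.sum_comm]
  exact Finset.sum_congr rfl fun i _ => Finset.sum_congr rfl fun j _ => by rw [h j i]; ring
theorem qf_cj (Y : Matrix (Fin (n+1)) (Fin n) ℝ) (A : Mt (n+1)) (v : Fin n → ℝ) : qf (cj Y A) v = qf A (Y.mulVec v) := by
  have h : ∀ {m : ℕ} (B : Mt m) (w : Fin m → ℝ), qf B w = w ⬝ᵥ (Matrix.of B).mulVec w := by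
    intro m B w
    simp only [qf, dotProduct, Matrix.mulVec, Finset.mul_sum, mul_assoc]; rfl
  rw [h, h, cj]
  show v ⬝ᵥ (Y.transpose * Matrix.of A * Y).mulVec v = _
  rw [← Matrix.mulVec_mulVec, ← Matrix.mulVec_mulVec, Matrix.mulVec_transpose, dotProduct_comm, ← Matrix.dotProduct_mulVec, dotProduct_comm]
theorem Kx.yy {x : Eu n} {A : Mt (n+1)} (hA : Kx x A) {Y : Matrix (Fin (n+1)) (Fin n) ℝ}
    (hY : ∀ i j, (Y * Y.transpose) i j = (if i = j then 1 else 0) - x i * x j) : Y * Y.transpose * Matrix.of A = Matrix.of A := by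
  ext i j
  rw [Matrix.mul_apply]
  simp only [hY, sub_mul, Finset.sum_sub_distrib, Matrix.of_apply]
  have : ∑ l, x i * x l * A l j = x i * ∑ l, A j l * x l := by
    rw [Finset.mul_sum]; exact Finset.sum_congr rfl fun l _ => by rw [hA.symm l j]; ring
  rw [this, hA.ker]; simp
open Polynomial in
theorem es_cj {x : Eu n} {A : Mt (n+1)} (hA : Kx x A) {Y : Matrix (Fin (n+1)) (Fin n) ℝ}
    (hY : ∀ i j, (Y * Y.transpose) i j = (if i = j then 1 else 0) - x i * x j) (k : ℕ) : es k A = es k (cj Y A) := by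
  rw [es, es]
  congr 1
  have h1 : ((X : ℝ[X]) • (Matrix.of A).map C + (1 : Matrix (Fin (n+1)) (Fin (n+1)) ℝ).map C) =
      1 + ((X : ℝ[X]) • Y.map C) * ((Y.transpose * Matrix.of A).map C) := by
    rw [Matrix.smul_mul, ← Matrix.map_mul, ← Matrix.mul_assoc, hA.yy hY, Matrix.map_one _ C_0 C_1]; exact add_comm _ _
  rw [h1, Matrix.det_one_add_mul_comm]
  congr 1
  rw [Matrix.mul_smul, ← Matrix.map_mul, Matrix.map_one _ C_0 C_1, add_comm]; rfl
theorem eD_cj {x : Eu n} {A M : Mt (n+1)} (hA : Kx x A) (hM : Kx x M) {Y : Matrix (Fin (n+1)) (Fin n) ℝ}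
    (hY : ∀ i j, (Y * Y.transpose) i j = (if i = j then 1 else 0) - x i * x j) (k : ℕ) : eD k A M = eD k (cj Y A) (cj Y M) := by
  have h1 := es_line k A M 0
  have h2 := es_line k (cj Y A) (cj Y M) 0
  simp only [← cj_smul, ← cj_add, ← es_cj (hA.add (hM.smul _)) hY] at h2
  have := h1.unique h2
  simpa using this
theorem eDD_cj {x : Eu n} {A M N : Mt (n+1)} (hA : Kx x A) (hM : Kx x M) (hN : Kx x N) {Y : Matrix (Fin (n+1)) (Fin n) ℝ}
    (hY : ∀ i j, (Y * Y.transpose) i j = (if i = j then 1 else 0) - x i * x j) (k : ℕ) : eDD k A N M = eDD k (cj Y A) (cj Y N) (cj Y M) := by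
  have h1 := eD_line k A M N 0
  have h2 := eD_line k (cj Y A) (cj Y M) (cj Y N) 0
  simp only [← cj_smul, ← cj_add, ← eD_cj (hA.add (hM.smul _)) hN hY] at h2
  have := h1.unique h2
  simpa using this
theorem PT.pd {x : Eu n} (hx : x ∈ sph n) {A : Mt (n+1)} (hA : PT x A) {Y : Matrix (Fin (n+1)) (Fin n) ℝ} (h1 : Y.transpose * Y = 1)
    (hY : ∀ i j, (Y * Y.transpose) i j = (if i = j then 1 else 0) - x i * x j) : PD (cj Y A) := by
  refine ⟨cj_symm Y hA.symm, fun v hv => ?_⟩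
  rw [qf_cj]
  have e1 : Y.transpose.mulVec (Y.mulVec v) = v := by rw [Matrix.mulVec_mulVec, h1, Matrix.one_mulVec]
  refine hA.pos _ ?_ fun h => hv ?_
  · have e2 : Y.mulVec v = (Y * Y.transpose).mulVec (Y.mulVec v) := by
      rw [← Matrix.mulVec_mulVec, e1]
    have hs : ∑ i, x i * x i = 1 := by
      have := sum_sq_sph hx; simpa [sq] using this
    have e3 : ∀ i, (Y.mulVec v) i = (Y.mulVec v) i - x i * ∑ j, (Y.mulVec v) j * x j := by
      intro i
      conv_lhs => rw [e2]
      rw [Matrix.mulVec, dotProduct]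
      simp only [hY, sub_mul, Finset.sum_sub_distrib, Finset.mul_sum]
      congr 1
      · simp
      · exact Finset.sum_congr rfl fun j _ => by ring
    set c := ∑ j, (Y.mulVec v) j * x j
    have h4 : ∀ i, x i * c = 0 := fun i => by have := e3 i; linarith
    calc c = (∑ i, x i * x i) * c := by rw [hs, one_mul]
      _ = 0 := by rw [Finset.sum_mul]; exact Finset.sum_eq_zero fun i _ => by rw [mul_assoc, h4, mul_zero]
  · rw [← e1, h]; simp
theorem E1 {k : ℕ} (hk : k ≤ n) {x : Eu n} (hx : x ∈ sph n) {A : Mt (n+1)} (hA : PT x A) : 0 < es k A := by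
  obtain ⟨Y, h1, hY⟩ := exY hx
  rw [es_cj hA.toKx hY]; exact es_pos hk (hA.pd hx h1 hY)
theorem E2 {k : ℕ} (hk : k ≤ n) {x : Eu n} (hx : x ∈ sph n) {A N : Mt (n+1)} (hA : PT x A) (hN : Kx x N) (h : ∀ v, 0 ≤ qf N v) : 0 ≤ eD k A N := by
  obtain ⟨Y, h1, hY⟩ := exY hx
  rw [eD_cj hA.toKx hN hY]; exact eD_psd hk (hA.pd hx h1 hY) (cj_symm Y hN.symm) fun v => by rw [qf_cj]; exact h _
theorem E3 {k : ℕ} (hk : k ≤ n) {x : Eu n} (hx : x ∈ sph n) {A M : Mt (n+1)} (hA : PT x A) (hM : Kx x M) :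
    es k A * eDD k A M M ≤ (eD k A M)^2 := by
  obtain ⟨Y, h1, hY⟩ := exY hx
  rw [eD_cj hA.toKx hM hY, eDD_cj hA.toKx hM hM hY, es_cj hA.toKx hY]
  have := (lag_weak hk (hA.pd hx h1 hY) (cj_symm Y hM.symm)).1
  linarith
theorem E4 {k : ℕ} (hk2 : 2 ≤ k) (hk : k ≤ n) {x : Eu n} (hx : x ∈ sph n) {A M : Mt (n+1)} (hA : PT x A) (hM : Kx x M)
    (h : eD k A M = 0) (h0 : M ≠ 0) : eDD k A M M < 0 := by
  obtain ⟨Y, h1, hY⟩ := exY hx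
  rw [eDD_cj hA.toKx hM hM hY]
  rw [eD_cj hA.toKx hM hY] at h
  refine starN hk2 hk (hA.pd hx h1 hY) (cj_symm Y hM.symm) h fun hz => h0 ?_
  have e1 : Matrix.of M = Y * Y.transpose * Matrix.of M * (Y * Y.transpose) := by
    rw [hM.yy hY]
    have ht : (Matrix.of M).transpose = Matrix.of M := by ext i j; exact hM.symm j i
    have := congrArg Matrix.transpose (hM.yy hY)
    rw [Matrix.transpose_mul, Matrix.transpose_mul, Matrix.transpose_transpose, ht] at this
    exact this.symm
  have e2 : Matrix.of M = Y * (Y.transpose * Matrix.of M * Y) * Y.transpose := by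
    conv_lhs => rw [e1]
    simp only [Matrix.mul_assoc]
  rw [show Y.transpose * Matrix.of M * Y = 0 from hz, Matrix.mul_zero, Matrix.zero_mul] at e2
  exact e2
theorem E5 {k : ℕ} (hk1 : 1 ≤ k) (hk : k ≤ n) {x : Eu n} (hx : x ∈ sph n) {A M : Mt (n+1)} (hA : PT x A) (hM : Kx x M) :
    k * es k A * eDD k A M M ≤ (k - 1) * (eD k A M)^2 := by
  have hp := E1 hk hx hA
  have hk0 : (0:ℝ) < k := by exact_mod_cast hk1
  set t := eD k A M / (k * es k A) with ht
  have h := E3 hk hx hA (hM.add (hA.toKx.smul (-t)))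
  rw [eD_add, eD_smul, eDD_addl, eDD_addr, eDD_addr, eDD_smull, eDD_smull, eDD_smulr, eDD_smulr, eDD_comm k A M A, eDD_self, eDD_self, eD_self] at h
  have e : eD k A M = t * (k * es k A) := by rw [ht]; field_simp
  have h2 : es k A * eDD k A M M ≤ (k-1) * k * (t * es k A)^2 := by
    rw [e] at h
    nlinarith
  rw [e]
  have := mul_le_mul_of_nonneg_left h2 hk0.le
  nlinarith
theorem line_d {F : Eu n → ℝ} (h : Sm F) (x v : Eu n) {s : ℝ} (hs : x + s • v ≠ 0) :
    HasDerivAt (fun s : ℝ => F (x + s • v)) (∑ i, v i * pd i F (x + s • v)) s := by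
  have h1 : HasDerivAt (fun s : ℝ => x + s • v) v s := by simpa using ((hasDerivAt_id s).smul_const v).const_add x
  have := (h.diff hs).hasFDerivAt.comp_hasDerivAt s h1
  rwa [fderiv_pd] at this
theorem line_d2 {F : Eu n → ℝ} (h : Sm F) (x v : Eu n) {s : ℝ} (hs : x + s • v ≠ 0) :
    HasDerivAt (fun s : ℝ => ∑ i, v i * pd i F (x + s • v)) (qf (Hm F (x + s • v)) v) s := by
  have := HasDerivAt.fun_sum (u := Finset.univ) fun i _ => (line_d (h.pd i) x v hs).const_mul (v i)
  have e : qf (Hm F (x + s • v)) v = ∑ i, v i * ∑ j, v j * pd j (pd i F) (x + s • v) := by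
    unfold qf
    rw [Finset.sum_comm]
    refine Finset.sum_congr rfl fun i _ => ?_
    rw [Finset.mul_sum]
    exact Finset.sum_congr rfl fun j _ => by rw [Hm]; ring
  rw [e]; exact this
theorem line_ev {x : Eu n} (hx : x ≠ 0) (v : Eu n) : ∀ᶠ s : ℝ in 𝓝 0, x + s • v ≠ 0 := by
  have hc : Continuous fun s : ℝ => x + s • v := by fun_prop
  exact (hc.tendsto 0).eventually_ne (by simpa using hx)
theorem Hg.touch {F : Eu n → ℝ} (h : Hg F) (h0 : ∀ y ∈ sph n, 0 ≤ F y) {x : Eu n} (hx : x ∈ sph n) (hz : F x = 0)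
    (w : Fin (n+1) → ℝ) : 0 ≤ qf (Hm F x) w := by
  let v : Eu n := WithLp.toLp 2 w
  show 0 ≤ qf (Hm F x) v
  have hx0 := sph_ne hx
  have hnn : ∀ y ≠ 0, 0 ≤ F y := by
    intro y hy
    have hp := norm_pos_iff.mpr hy
    have := h.hom ‖y‖ hp (‖y‖⁻¹ • y) (smul_ne_zero (inv_pos.mpr hp).ne' hy)
    rw [smul_smul, mul_inv_cancel₀ hp.ne', one_smul] at this
    rw [this]
    refine mul_nonneg hp.le (h0 _ ?_)
    rw [mem_sph, norm_smul, norm_inv, norm_norm, inv_mul_cancel₀ hp.ne']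
  have hev := line_ev hx0 v
  set g : ℝ → ℝ := fun s => F (x + s • v) with hg
  have hmin : IsLocalMin g 0 := by
    filter_upwards [hev] with s hs
    simp only [hg, zero_smul, add_zero, hz]; exact hnn _ hs
  have hd : deriv g =ᶠ[𝓝 0] fun s : ℝ => ∑ i, v i * pd i F (x + s • v) := by
    filter_upwards [hev] with s hs using (line_d h.sm x v hs).deriv
  have hdd : deriv (deriv g) 0 = qf (Hm F x) v := by
    rw [hd.deriv_eq, (line_d2 h.sm x v (by simpa using hx0)).deriv]; simp
  by_contra hcon
  have hlt := not_le.mp hcon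
  have hmax : IsLocalMin (fun s => - g s) 0 := by
    have hn : deriv (fun s => - g s) = fun s => - deriv g s := by ext s; simp
    refine isLocalMin_of_deriv_deriv_pos ?_ ?_ ?_
    · rw [hn]; simp only [deriv.fun_neg]; linarith
    · rw [hn]; simp [hmin.deriv_eq_zero]
    · exact (line_d h.sm x v (s := 0) (by simpa using hx0)).continuousAt.neg
  have hc : g =ᶠ[𝓝 0] fun _ => g 0 := by
    filter_upwards [hmin, hmax] with s h1 h2
    linarith
  have : deriv (deriv g) 0 = 0 := by
    have h1 : deriv g =ᶠ[𝓝 0] deriv fun _ : ℝ => g 0 := hc.deriv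
    rw [h1.deriv_eq]; simp
  linarith
theorem Hg.kx {F : Eu n → ℝ} (h : Hg F) {x : Eu n} (hx : x ∈ sph n) : Kx x (Hm F x) :=
  ⟨Hm_symm h.sm (sph_ne hx), h.ker (sph_ne hx)⟩
structure Gd {n : ℕ} (U : Eu n → ℝ) : Prop extends Hg U where
  pos : ∀ y ≠ 0, 0 < U y
  cvx : ∀ x ∈ sph n, PT x (Hm U x)
theorem pos_of_sph {F : Eu n → ℝ} (h : Hg F) (h0 : ∀ y ∈ sph n, 0 < F y) : ∀ y ≠ 0, 0 < F y := by
  intro y hy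
  have hp := norm_pos_iff.mpr hy
  have := h.hom ‖y‖ hp (‖y‖⁻¹ • y) (smul_ne_zero (inv_pos.mpr hp).ne' hy)
  rw [smul_smul, mul_inv_cancel₀ hp.ne', one_smul] at this
  rw [this]
  refine mul_pos hp (h0 _ ?_)
  rw [mem_sph, norm_smul, norm_inv, norm_norm, inv_mul_cancel₀ hp.ne']
theorem Gd.of_good {u : Eu n → ℝ} (h : GoodSph u) : Gd (homExt u) := by
  have hg := homExt_hg h.1
  refine ⟨hg, pos_of_sph hg fun y hy => by rw [homExt_sph u hy]; exact h.2.1 y hy, fun x hx => ⟨hg.kx hx, fun v hv hv0 => ?_⟩⟩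
  have := h.2.2 x hx (WithLp.toLp 2 v) (by rw [PiLp.inner_apply]; simpa using hv) (by simpa using hv0)
  have e : (WithLp.toLp 2 v : Eu n) = ∑ j, v j • bv j := by ext j; simp [bv, Pi.single_apply]
  convert this using 1
  rw [PiLp.inner_apply, qf]
  refine Finset.sum_congr rfl fun i _ => ?_
  have : (hessOp u x (WithLp.toLp 2 v)) i = ∑ j, v j * Hm (homExt u) x j i := by
    rw [e, map_sum]; simp [hess_coord h.1 (sph_ne hx)]
  rw [this]
  simp only [RCLike.inner_apply, conj_trivial, Finset.sum_mul]
  exact Finset.sum_congr rfl fun j _ => by rw [hg.kx hx |>.symm i j]; ring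
theorem pd_nrm (i : Fin (n+1)) {y : Eu n} (hy : y ≠ 0) : pd i (fun y : Eu n => ‖y‖) y = y i * ‖y‖⁻¹ := by
  have h1 := (Sm.nrm n).diff hy
  have h2 : pd i (fun y : Eu n => ‖y‖ * ‖y‖) y = 2 * y i := by
    rw [show (fun y : Eu n => ‖y‖ * ‖y‖) = fun y => ∑ j, y j * y j by
      ext y; have := EuclideanSpace.real_norm_sq_eq y; simpa [sq] using this]
    rw [pd_sum _ _ fun j _ => (diff_coord j y).fun_mul (diff_coord j y)]
    simp only [pd_mul i (diff_coord _ y) (diff_coord _ y), pd_coord]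
    simp [Finset.sum_add_distrib]; ring
  rw [pd_mul i h1 h1] at h2
  have : ‖y‖ ≠ 0 := norm_ne_zero_iff.mpr hy
  field_simp; linarith
theorem pd_inrm (i : Fin (n+1)) {y : Eu n} (hy : y ≠ 0) : pd i (fun y : Eu n => ‖y‖⁻¹) y = - y i * ‖y‖⁻¹^3 := by
  have h1 := (Sm.nrm n).diff hy
  have hn : ∀ y : Eu n, y ≠ 0 → ‖y‖ ≠ 0 := fun y hy => norm_ne_zero_iff.mpr hy
  have h2 := ((Sm.nrm n).inv hn).diff hy
  have h3 := pd_mul (i := i) h1 h2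
  rw [pd_congr (G := fun _ => (1:ℝ)) (fun z hz => mul_inv_cancel₀ (hn z hz)) i hy, pd_nrm i hy] at h3
  have h4 : pd i (fun _ : Eu n => (1:ℝ)) y = 0 := by simp [pd]
  rw [h4] at h3
  have := hn y hy
  have h5 : pd i (fun y : Eu n => ‖y‖⁻¹) y = -(y i * ‖y‖⁻¹ * ‖y‖⁻¹) * ‖y‖⁻¹ := by
    field_simp; field_simp at h3; linarith
  rw [h5]; ring
theorem Hm_nrm {x : Eu n} (hx : x ∈ sph n) (i j : Fin (n+1)) :
    Hm (fun y : Eu n => ‖y‖) x i j = (if i = j then 1 else 0) - x i * x j := by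
  have hx0 := sph_ne hx
  have hn : ∀ y : Eu n, y ≠ 0 → ‖y‖ ≠ 0 := fun y hy => norm_ne_zero_iff.mpr hy
  rw [Hm, pd_congr (fun z hz => pd_nrm j hz) i hx0, pd_mul i (diff_coord j x) (((Sm.nrm n).inv hn).diff hx0), pd_coord, pd_inrm i hx0, mem_sph.mp hx]
  simp; ring
theorem Gd.nrm (n : ℕ) : Gd (fun y : Eu n => ‖y‖) := by
  refine ⟨Hg.nrm n, fun y hy => norm_pos_iff.mpr hy, fun x hx => ⟨(Hg.nrm n).kx hx, fun v hv hv0 => ?_⟩⟩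
  have : qf (Hm (fun y : Eu n => ‖y‖) x) v = qf (I1 (n+1)) v - (∑ i, v i * x i)^2 := by
    simp only [qf, Hm_nrm hx, I1, mul_sub, sub_mul, Finset.sum_sub_distrib]
    congr 1
    rw [sq, Finset.sum_mul_sum]
    exact Finset.sum_congr rfl fun i _ => Finset.sum_congr rfl fun j _ => by ring
  rw [this, hv]
  have := (PD_one (n+1)).pos v hv0
  show 0 < qf (I1 (n+1)) v - _
  unfold I1; simpa using this
theorem Gd.comb {U V : Eu n → ℝ} (hU : Gd U) (hV : Gd V) {a b : ℝ} (ha : 0 ≤ a) (hb : 0 ≤ b) (hab : 0 < a + b) :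
    Gd (fun y => a * U y + b * V y) := by
  have key : ∀ p q : ℝ, 0 < p → 0 < q → 0 < a * p + b * q := by
    intro p q hp hq
    rcases ha.eq_or_lt with h | h
    · have : 0 < b := by linarith
      rw [← h]; have := mul_pos this hq; linarith
    · have := mul_pos h hp; have := mul_nonneg hb hq.le; linarith
  have hg := (hU.toHg.cmul a).add (hV.toHg.cmul b)
  refine ⟨hg, fun y hy => key _ _ (hU.pos y hy) (hV.pos y hy), fun x hx => ⟨hg.kx hx, fun v hv hv0 => ?_⟩⟩
  have hx0 := sph_ne hx
  rw [Hm_add (hU.sm.cmul a) (hV.sm.cmul b) hx0, Hm_cmul a hU.sm hx0, Hm_cmul b hV.sm hx0, qf_add, qf_smul, qf_smul]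
  exact key _ _ ((hU.cvx x hx).pos v hv hv0) ((hV.cvx x hx).pos v hv hv0)
theorem Gd.sgpos {k : ℕ} (hk : k ≤ n) {U : Eu n → ℝ} (hU : Gd U) {x : Eu n} (hx : x ∈ sph n) : 0 < sg k U x := E1 hk hx (hU.cvx x hx)
theorem discr {a b c : ℝ} (h : ∀ t : ℝ, 0 ≤ a + 2 * t * b + t^2 * c) : b^2 ≤ a * c := by
  have := discrim_le_zero (a := c) (b := 2 * b) (c := a) fun t => by have := h t; linarith
  rw [discrim] at this; linarith
theorem iadd {f g : Eu n → ℝ} (hf : ContinuousOn f (sph n)) (hg : ContinuousOn g (sph n)) :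
    ∫ x, (f x + g x) ∂(mu n) = ∫ x, f x ∂(mu n) + ∫ x, g x ∂(mu n) := integral_add (intg hf) (intg hg)
theorem isub {f g : Eu n → ℝ} (hf : ContinuousOn f (sph n)) (hg : ContinuousOn g (sph n)) :
    ∫ x, (f x - g x) ∂(mu n) = ∫ x, f x ∂(mu n) - ∫ x, g x ∂(mu n) := integral_sub (intg hf) (intg hg)
theorem cs {f g : Eu n → ℝ} (hf : ContinuousOn f (sph n)) (hg : ContinuousOn g (sph n)) :
    (∫ x, f x * g x ∂(mu n))^2 ≤ (∫ x, f x ^ 2 ∂(mu n)) * ∫ x, g x ^ 2 ∂(mu n) := by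
  refine discr fun t => ?_
  have : 0 ≤ ∫ x, (f x + t * g x)^2 ∂(mu n) := int_nonneg fun x _ => sq_nonneg _
  have e : ∫ x, (f x + t * g x)^2 ∂(mu n) = ∫ x, (f x ^ 2 + 2 * t * (f x * g x) + t^2 * g x ^ 2) ∂(mu n) :=
    int_congr fun x _ => by ring
  rw [e, iadd (by fun_prop) (by fun_prop), iadd (by fun_prop) (by fun_prop), integral_const_mul, integral_const_mul] at this
  exact this
def BB {n : ℕ} (k : ℕ) (U F : Eu n → ℝ) (y : Eu n) : ℝ := k * (sg k U y * (U y)⁻¹) * F y - LL k U F y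
theorem BB_sm (k : ℕ) {U F : Eu n → ℝ} (hU : Gd U) (hF : Sm F) : Sm (BB k U F) :=
  ((((sg_sm k hU.sm).mul (hU.sm.inv fun y hy => (hU.pos y hy).ne')).cmul k).mul hF).sub (LL_sm k hU.sm hF)
theorem LL_add (k : ℕ) {U F G : Eu n → ℝ} (hF : Sm F) (hG : Sm G) (t : ℝ) {y : Eu n} (hy : y ≠ 0) :
    LL k U (fun y => F y + t * G y) y = LL k U F y + t * LL k U G y := by
  rw [LL, Hm_line hF hG hy, eD_add, eD_smul]; rfl
theorem BB_add (k : ℕ) {U F G : Eu n → ℝ} (hF : Sm F) (hG : Sm G) (t : ℝ) {y : Eu n} (hy : y ≠ 0) :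
    BB k U (fun y => F y + t * G y) y = BB k U F y + t * BB k U G y := by
  rw [BB, LL_add k hF hG t hy, BB, BB]; ring
theorem BB_self (k : ℕ) {U : Eu n → ℝ} (hU : Gd U) {y : Eu n} (hy : y ≠ 0) : BB k U U y = 0 := by
  have := (hU.pos y hy).ne'
  rw [BB, LL_self]; field_simp; ring
theorem BB_symm (k : ℕ) {U F G : Eu n → ℝ} (hU : Gd U) (hF : Hg F) (hG : Hg G) :
    ∫ x, G x * BB k U F x ∂(mu n) = ∫ x, F x * BB k U G x ∂(mu n) := by
  have e : ∀ F G : Eu n → ℝ, Hg F → Hg G → ∫ x, G x * BB k U F x ∂(mu n) =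
      ∫ x, (k * (sg k U x * (U x)⁻¹)) * (F x * G x) ∂(mu n) - ∫ x, G x * LL k U F x ∂(mu n) := by
    intro F G hF hG
    have h1 := (((sg_sm k hU.sm).mul (hU.sm.inv fun y hy => (hU.pos y hy).ne')).cmul k).cont
    have h2 := (LL_sm k hU.sm hF.sm).cont
    have cF := hF.sm.cont
    have cG := hG.sm.cont
    rw [← isub (by fun_prop) (by fun_prop)]
    exact int_congr fun x _ => by rw [BB]; ring
  rw [e F G hF hG, e G F hG hF, F1 k hU.toHg hF hG]
  congr 1
  exact int_congr fun x _ => by ring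
theorem b_nonneg {k : ℕ} (hk : k ≤ n) {U F : Eu n → ℝ} (hU : Gd U) (hF : Hg F) : 0 ≤ ∫ x, F x * BB k U F x ∂(mu n) := by
  have hUi : Sm fun y => (U y)⁻¹ := hU.sm.inv fun y hy => (hU.pos y hy).ne'
  have hQ : Hg (fun y => F y * F y * (U y)⁻¹) := ⟨(hF.sm.mul hF.sm).mul hUi, fun r hr y hy => by
    have := (hU.pos y hy).ne'
    simp only [hF.hom r hr y hy, hU.hom r hr y hy]; field_simp⟩
  have h1 := F1 k hU.toHg hQ hU.toHg
  have hp : ∀ x ∈ sph n, 0 ≤ U x * LL k U (fun y => F y * F y * (U y)⁻¹) x - 2 * (F x * LL k U F x) + k * (sg k U x * (U x)⁻¹) * (F x * F x) := by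
    intro x hx
    have hx0 := sph_ne hx
    have hux := hU.pos x hx0
    set c := F x / U x with hc
    have hG : Hg (fun y => (F y * F y * (U y)⁻¹ + (-2 * c) * F y) + c^2 * U y) := (hQ.add (hF.cmul _)).add (hU.toHg.cmul _)
    have ht := hG.touch (fun y hy => by
      have hu := hU.pos y (sph_ne hy)
      have : (F y * F y * (U y)⁻¹ + (-2 * c) * F y) + c^2 * U y = (F y - c * U y)^2 * (U y)⁻¹ := by field_simp; ring
      rw [this]; positivity) hx (by rw [hc]; field_simp; ring)
    have := E2 hk hx (hU.cvx x hx) (hG.kx hx) ht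
    have e : eD k (Hm U x) (Hm (fun y => (F y * F y * (U y)⁻¹ + (-2 * c) * F y) + c^2 * U y) x) =
      LL k U (fun y => F y * F y * (U y)⁻¹) x + (-2 * c) * LL k U F x + c^2 * LL k U U x := by
      have := LL_add k (U := U) (hQ.sm.add (hF.sm.cmul (-2 * c))) hU.sm (c^2) hx0
      rw [LL] at this
      rw [this, LL_add k hQ.sm hF.sm _ hx0]
    rw [e, LL_self] at this
    have h2 := mul_nonneg hux.le this
    refine h2.trans_eq ?_
    rw [hc]; field_simp; ring
  have h2 := int_nonneg hp
  have c1 := (LL_sm k hU.sm hQ.sm).cont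
  have c2 := (LL_sm k hU.sm hF.sm).cont
  have c3 := (((sg_sm k hU.sm).mul hUi).cmul k).cont
  have cF := hF.sm.cont
  have cU := hU.sm.cont
  rw [iadd (by fun_prop) (by fun_prop), isub (by fun_prop) (by fun_prop), h1, integral_const_mul] at h2
  have e1 : ∫ x, F x * F x * (U x)⁻¹ * LL k U U x ∂(mu n) = ∫ x, k * (sg k U x * (U x)⁻¹) * (F x * F x) ∂(mu n) :=
    int_congr fun x _ => by rw [LL_self]; ring
  have e2 : ∫ x, F x * BB k U F x ∂(mu n) = ∫ x, k * (sg k U x * (U x)⁻¹) * (F x * F x) ∂(mu n) - ∫ x, F x * LL k U F x ∂(mu n) := by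
    rw [← isub (by fun_prop) (by fun_prop)]
    exact int_congr fun x _ => by rw [BB]; ring
  rw [e2]; rw [e1] at h2; linarith
theorem S_self {k : ℕ} {U F : Eu n → ℝ} (hU : Hg U) (hF : Hg F) :
    ∫ x, U x * SS k U F F x ∂(mu n) = (k - 1) * ∫ x, F x * LL k U F x ∂(mu n) := by
  rw [F2 k hU hF hF hU, ← integral_const_mul]
  exact int_congr fun x _ => by rw [SS, eDD_self, LL]; ring
theorem bochner {k : ℕ} (hk2 : 2 ≤ k) (hk : k ≤ n) {U F : Eu n → ℝ} (hU : Gd U) (hF : Hg F) :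
    k * ∫ x, F x * BB k U F x ∂(mu n) ≤ ∫ x, U x * (sg k U x)⁻¹ * (BB k U F x)^2 ∂(mu n) := by
  have cS := SS_cont k hU.sm hF.sm hF.sm
  have cB := (BB_sm k hU hF.sm).cont
  have cL := (LL_sm k hU.sm hF.sm).cont
  have cs := (sg_sm k hU.sm).cont
  have csi : ContinuousOn (fun x => (sg k U x)⁻¹) (sph n) := cs.inv₀ fun x hx => (hU.sgpos hk hx).ne'
  have cF := hF.sm.cont
  have cU := hU.sm.cont
  have hk1 : (0:ℝ) < k - 1 := by
    have : (2:ℝ) ≤ k := by exact_mod_cast hk2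
    linarith
  have h1 : ∫ x, k * (U x * SS k U F F x) ∂(mu n) ≤ ∫ x, (k - 1) * (U x * (sg k U x)⁻¹ * (BB k U F x)^2 - 2 * k * (F x * BB k U F x)
      + k * (F x * (BB k U F x + LL k U F x))) ∂(mu n) := by
    refine int_mono ((cU.mul cS).const_mul _) (((((cU.mul csi).mul (cB.pow 2)).sub ((cF.mul cB).const_mul _)).add ((cF.mul (cB.add cL)).const_mul _)).const_mul _) fun x hx => ?_
    have h := E5 (by omega) hk hx (hU.cvx x hx) (hF.kx hx)
    have hs := hU.sgpos hk hx
    have hu := hU.pos x (sph_ne hx)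
    change k * sg k U x * SS k U F F x ≤ (k - 1) * (LL k U F x)^2 at h
    have hb : LL k U F x = k * (sg k U x * (U x)⁻¹) * F x - BB k U F x := by rw [BB]; ring
    have h2 := mul_le_mul_of_nonneg_left h (show 0 ≤ U x * (sg k U x)⁻¹ by positivity)
    have e1 : U x * (sg k U x)⁻¹ * (k * sg k U x * SS k U F F x) = k * (U x * SS k U F F x) := by field_simp
    rw [e1] at h2
    refine h2.trans_eq ?_
    rw [hb]; field_simp; ring
  rw [integral_const_mul, S_self hU.toHg hF, integral_const_mul, iadd (by fun_prop) (by fun_prop),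
    isub (by fun_prop) (by fun_prop), integral_const_mul, integral_const_mul] at h1
  have e : ∫ x, F x * (BB k U F x + LL k U F x) ∂(mu n) = ∫ x, F x * BB k U F x ∂(mu n) + ∫ x, F x * LL k U F x ∂(mu n) := by
    rw [← iadd (by fun_prop) (by fun_prop)]; exact int_congr fun x _ => by ring
  rw [e] at h1
  have h2 : (k - 1) * (k * ∫ x, F x * LL k U F x ∂(mu n)) ≤ _ := le_trans (le_of_eq (by ring)) h1
  have h3 := le_of_mul_le_mul_left h2 hk1
  linarith
def AF {n : ℕ} (k : ℕ) (U : Eu n → ℝ) : Prop :=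
  ∀ F : Eu n → ℝ, Hg F → ∫ x, F x * sg k U x ∂(mu n) = 0 → ∫ x, F x * LL k U F x ∂(mu n) ≤ 0
def DD {n : ℕ} (k : ℕ) (U : Eu n → ℝ) : Prop :=
  ∀ z : Eu n → ℝ, ContinuousOn z (sph n) → ∫ x, U x * z x ∂(mu n) = 0 → ∀ ε > 0,
    ∃ F, Hg F ∧ ∫ x, (BB k U F x - z x)^2 ∂(mu n) < ε
theorem bd_sph {f : Eu n → ℝ} (hf : ContinuousOn f (sph n)) : ∃ C > 0, ∀ x ∈ sph n, |f x| ≤ C := by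
  obtain ⟨C, hC⟩ := (sph_compact n).exists_bound_of_continuousOn hf
  exact ⟨max C 1, by positivity, fun x hx => (hC x hx).trans (le_max_left _ _)⟩
theorem b_eq {k : ℕ} {U F : Eu n → ℝ} (hU : Gd U) (hF : Hg F) : ∫ x, F x * BB k U F x ∂(mu n) =
    k * ∫ x, (sg k U x * (U x)⁻¹) * F x ^ 2 ∂(mu n) - ∫ x, F x * LL k U F x ∂(mu n) := by
  have hUi : Sm fun y => (U y)⁻¹ := hU.sm.inv fun y hy => (hU.pos y hy).ne'
  have c2 := (LL_sm k hU.sm hF.sm).cont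
  have c3 := ((sg_sm k hU.sm).mul hUi).cont
  have cF := hF.sm.cont
  rw [← integral_const_mul, ← isub (by fun_prop) (by fun_prop)]
  exact int_congr fun x _ => by rw [BB]; ring
theorem bcs {k : ℕ} (hk : k ≤ n) {U F G : Eu n → ℝ} (hU : Gd U) (hF : Hg F) (hG : Hg G) :
    (∫ x, F x * BB k U G x ∂(mu n))^2 ≤ (∫ x, F x * BB k U F x ∂(mu n)) * ∫ x, G x * BB k U G x ∂(mu n) := by
  refine discr fun t => ?_
  have h := b_nonneg hk hU (hF.add (hG.cmul t))
  have cBF := (BB_sm k hU hF.sm).cont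
  have cBG := (BB_sm k hU hG.sm).cont
  have cF := hF.sm.cont
  have cG := hG.sm.cont
  have e : ∫ x, (F x + t * G x) * BB k U (fun y => F y + t * G y) x ∂(mu n) =
      ∫ x, (F x * BB k U F x + t * (F x * BB k U G x) + t * (G x * BB k U F x) + t^2 * (G x * BB k U G x)) ∂(mu n) :=
    int_congr fun x hx => by rw [BB_add k hF.sm hG.sm t (sph_ne hx)]; ring
  rw [e, iadd (by fun_prop) (by fun_prop), iadd (by fun_prop) (by fun_prop), iadd (by fun_prop) (by fun_prop),
    integral_const_mul, integral_const_mul, integral_const_mul, BB_symm k hU hF hG] at h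
  linarith
theorem DD.af {k : ℕ} (hk2 : 2 ≤ k) (hk : k ≤ n) {U : Eu n → ℝ} (hU : Gd U) (hD : DD k U) : AF k U := by
  intro F hF h0
  have hUi : Sm fun y => (U y)⁻¹ := hU.sm.inv fun y hy => (hU.pos y hy).ne'
  have cs0 := (sg_sm k hU.sm).cont
  have csi : ContinuousOn (fun x => (sg k U x)⁻¹) (sph n) := cs0.inv₀ fun x hx => (hU.sgpos hk hx).ne'
  have cui := hUi.cont
  have cF := hF.sm.cont
  have cU := hU.sm.cont
  have cw : ContinuousOn (fun x => sg k U x * (U x)⁻¹) (sph n) := by fun_prop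
  set m := ∫ x, (sg k U x * (U x)⁻¹) * F x ^ 2 ∂(mu n) with hm
  set b := ∫ x, F x * BB k U F x ∂(mu n) with hb
  have hbe := b_eq (k := k) hU hF
  have hm0 : 0 ≤ m := int_nonneg fun x hx => by
    have := hU.sgpos hk hx; have := hU.pos x (sph_ne hx); positivity
  have hz : ContinuousOn (fun x => sg k U x * (U x)⁻¹ * F x) (sph n) := by fun_prop
  have hz0 : ∫ x, U x * (sg k U x * (U x)⁻¹ * F x) ∂(mu n) = 0 := by
    rw [← h0]; refine int_congr fun x hx => ?_
    have := (hU.pos x (sph_ne hx)).ne'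
    field_simp
  choose ψ hψ hψe using fun j : ℕ => hD _ hz hz0 ((j:ℝ) + 1)⁻¹ (by positivity)
  set r : ℕ → Eu n → ℝ := fun j x => BB k U (ψ j) x - sg k U x * (U x)⁻¹ * F x with hr
  have crj : ∀ j, ContinuousOn (r j) (sph n) := fun j => by
    have := (BB_sm k hU (hψ j).sm).cont
    simp only [hr]; fun_prop
  set e1 : ℕ → ℝ := fun j => ∫ x, F x * r j x ∂(mu n) with he1
  set e2 : ℕ → ℝ := fun j => ∫ x, (U x * (sg k U x)⁻¹) * (r j x)^2 ∂(mu n) with he2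
  have t0 : Tendsto (fun j : ℕ => ((j:ℝ) + 1)⁻¹) atTop (𝓝 0) := by simpa using tendsto_one_div_add_atTop_nhds_zero_nat (𝕜 := ℝ)
  have te1 : Tendsto e1 atTop (𝓝 0) := by
    have hsq : Tendsto (fun j => (e1 j)^2) atTop (𝓝 0) := by
      refine squeeze_zero (fun j => sq_nonneg _) (fun j => ?_) (by simpa using t0.const_mul (∫ x, F x ^ 2 ∂(mu n)))
      refine (cs cF (crj j)).trans (mul_le_mul_of_nonneg_left (hψe j).le (int_nonneg fun x _ => sq_nonneg _))
    have := hsq.sqrt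
    simp only [Real.sqrt_sq_eq_abs, Real.sqrt_zero] at this
    exact (tendsto_zero_iff_abs_tendsto_zero _).2 this
  have te2 : Tendsto e2 atTop (𝓝 0) := by
    obtain ⟨C, hC, hCb⟩ := bd_sph (show ContinuousOn (fun x => U x * (sg k U x)⁻¹) (sph n) by fun_prop)
    refine squeeze_zero (fun j => int_nonneg fun x hx => ?_) (fun j => ?_) (by simpa using t0.const_mul C)
    · have := hU.sgpos hk hx; have := hU.pos x (sph_ne hx); positivity
    · have c := crj j
      calc e2 j ≤ ∫ x, C * (r j x)^2 ∂(mu n) := int_mono (by fun_prop) (by fun_prop) fun x hx =>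
            mul_le_mul_of_nonneg_right ((le_abs_self _).trans (hCb x hx)) (sq_nonneg _)
        _ ≤ _ := by rw [integral_const_mul]; exact mul_le_mul_of_nonneg_left (hψe j).le hC.le
  have key : ∀ j, k * (m + e1 j)^2 ≤ b * (m + 2 * e1 j + e2 j) := by
    intro j
    have c := crj j
    have hB : ∀ x, BB k U (ψ j) x = sg k U x * (U x)⁻¹ * F x + r j x := fun x => by simp only [hr]; ring
    have h1 := bcs hk hU hF (hψ j)
    have h2 := bochner hk2 hk hU (hψ j)
    have i1 : ∫ x, F x * BB k U (ψ j) x ∂(mu n) = m + e1 j := by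
      rw [hm, he1, ← iadd (by fun_prop) (by fun_prop)]
      exact int_congr fun x _ => by rw [hB]; ring
    have i2 : ∫ x, U x * (sg k U x)⁻¹ * (BB k U (ψ j) x)^2 ∂(mu n) = m + 2 * e1 j + e2 j := by
      rw [hm, he1, he2]; beta_reduce
      rw [← integral_const_mul, ← iadd (by fun_prop) (by fun_prop), ← iadd (by fun_prop) (by fun_prop)]
      refine int_congr fun x hx => ?_
      have := (hU.sgpos hk hx).ne'; have := (hU.pos x (sph_ne hx)).ne'
      rw [hB]; field_simp; ring
    rw [i1] at h1; rw [i2] at h2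
    have hb0 : 0 ≤ b := b_nonneg hk hU hF
    have hk0 : (0:ℝ) ≤ k := by positivity
    calc (k:ℝ) * (m + e1 j)^2 ≤ k * (b * _) := mul_le_mul_of_nonneg_left h1 hk0
      _ = b * (k * _) := by ring
      _ ≤ _ := mul_le_mul_of_nonneg_left h2 hb0
  have hlim : k * m^2 ≤ b * m := by
    have l1 : Tendsto (fun j => k * (m + e1 j)^2) atTop (𝓝 (k * (m + 0)^2)) := ((te1.const_add m).pow 2).const_mul _
    have l2 : Tendsto (fun j => b * (m + 2 * e1 j + e2 j)) atTop (𝓝 (b * (m + 2 * 0 + 0))) := (((te1.const_mul 2).const_add m).add te2).const_mul _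
    have := le_of_tendsto_of_tendsto' l1 l2 key
    simpa using this
  rcases hm0.eq_or_lt with h | h
  · have hF0 : ∀ x ∈ sph n, F x = 0 := by
      intro x hx
      have := mu_support (g := fun x => (sg k U x * (U x)⁻¹) * F x ^ 2) (by fun_prop) (fun x hx => by
        have := hU.sgpos hk hx; have := hU.pos x (sph_ne hx); positivity) h.symm x hx
      have h3 := (hU.sgpos hk hx).ne'; have h4 := (hU.pos x (sph_ne hx)).ne'
      simpa [h3, h4] using this
    have : ∫ x, F x * LL k U F x ∂(mu n) = ∫ x, (0:ℝ) ∂(mu n) := int_congr fun x hx => by rw [hF0 x hx, zero_mul]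
    rw [this]; simp
  · have : k * m ≤ b := le_of_mul_le_mul_right (by linarith [sq m]) h
    linarith
theorem eD_nrm {k : ℕ} (hk1 : 1 ≤ k) (hn : 1 ≤ n) : ∃ c : ℝ, ∀ x ∈ sph n, ∀ M, Kx x M →
    eD k (Hm (fun y : Eu n => ‖y‖) x) M = c * tr M := by
  have htr : ∀ x ∈ sph n, tr (Hm (fun y : Eu n => ‖y‖) x) = n := by
    intro x hx
    simp [tr, Hm_nrm hx, sum_sq_sph hx]
  have hmm : ∀ x ∈ sph n, ∀ M, Kx x M → mm (Hm (fun y : Eu n => ‖y‖) x) M = M := by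
    intro x hx M hM
    ext i j
    have h : ∑ l, x l * M l j = 0 := by
      rw [← hM.ker j]; exact Finset.sum_congr rfl fun l _ => by rw [hM.symm l j]; ring
    have : ∀ l, ((if i = l then (1:ℝ) else 0) - x i * x l) * M l j = (if i = l then M l j else 0) - x i * (x l * M l j) := by
      intro l; split_ifs <;> ring
    simp only [mm, Hm_nrm hx, this, Finset.sum_sub_distrib, ← Finset.mul_sum, h]
    simp
  induction k, hk1 using Nat.le_induction with
  | base => exact ⟨1, fun x hx M hM => by rw [eD_one, one_mul]⟩
  | succ k hk1 ih =>
    obtain ⟨c, hc⟩ := ih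
    refine ⟨c * n / k - c, fun x hx M hM => ?_⟩
    have h1 := recL k (Hm (fun y : Eu n => ‖y‖) x) M
    have h2 := hc x hx _ ((Hg.nrm n).kx hx)
    rw [eD_self, htr x hx] at h2
    rw [hmm x hx M hM, hc x hx M hM] at h1
    have hk0 : (k:ℝ) ≠ 0 := by positivity
    have h3 : es k (Hm (fun y : Eu n => ‖y‖) x) = c * n / k := by field_simp; linarith
    rw [h3] at h1; linarith
theorem BB_nrm {k : ℕ} (hk1 : 1 ≤ k) (hk : k ≤ n) : ∃ c : ℝ, 0 < c ∧ ∀ F, Hg F → ∀ x ∈ sph n,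
    BB k (fun y : Eu n => ‖y‖) F x = c * (n * F x - ∑ i, pd i (pd i F) x) := by
  obtain ⟨c, hc⟩ := eD_nrm (n := n) hk1 (hk1.trans hk)
  have hes : ∀ x ∈ sph n, (k:ℝ) * sg k (fun y : Eu n => ‖y‖) x = c * n := by
    intro x hx
    have h2 := hc x hx _ ((Hg.nrm n).kx hx)
    rw [eD_self] at h2
    rw [sg, h2]; congr 1; simp [tr, Hm_nrm hx, sum_sq_sph hx]
  have hk0 : (0:ℝ) < k := by exact_mod_cast hk1
  have hn0 : (0:ℝ) < n := by exact_mod_cast hk1.trans hk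
  refine ⟨c, ?_, fun F hF x hx => ?_⟩
  · have h0 : bv (0 : Fin (n+1)) ∈ sph n := by rw [mem_sph]; simp [bv]
    have h1 := hes _ h0
    have h2 := mul_pos hk0 ((Gd.nrm n).sgpos hk h0)
    rw [h1] at h2
    exact (pos_iff_pos_of_mul_pos h2).2 hn0
  · have h1 : LL k (fun y : Eu n => ‖y‖) F x = c * ∑ i, pd i (pd i F) x := hc x hx _ (hF.kx hx)
    rw [BB, h1, ← mul_assoc, hes x hx, mem_sph.mp hx]; ring
def Psi {n : ℕ} : List (Fin (n+1)) → Eu n → ℝ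
  | [], y => ‖y‖
  | i :: w, y => (y i * ‖y‖⁻¹) * Psi w y
theorem sm_inrm (n : ℕ) : Sm fun y : Eu n => ‖y‖⁻¹ := (Sm.nrm n).inv fun y hy => norm_ne_zero_iff.mpr hy
theorem sm_q (j : Fin (n+1)) : Sm fun y : Eu n => y j * ‖y‖⁻¹ := (Sm.coord j).mul (sm_inrm n)
theorem Psi_hg : ∀ w : List (Fin (n+1)), Hg (Psi w)
  | [] => Hg.nrm n
  | i :: w => ⟨(sm_q i).mul (Psi_hg w).sm, fun r hr y hy => by
      have hn : ‖y‖ ≠ 0 := norm_ne_zero_iff.mpr hy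
      rw [Psi, Psi, (Psi_hg w).hom r hr y hy, norm_smul, Real.norm_of_nonneg hr.le]
      simp; field_simp⟩
theorem pd_q (i j : Fin (n+1)) {y : Eu n} (hy : y ≠ 0) :
    pd i (fun y : Eu n => y j * ‖y‖⁻¹) y = (if i = j then 1 else 0) * ‖y‖⁻¹ + (-1) * (y j * (y i * (‖y‖⁻¹ * (‖y‖⁻¹ * ‖y‖⁻¹)))) := by
  rw [pd_mul i (diff_coord j y) ((sm_inrm n).diff hy), pd_coord, pd_inrm i hy]; ring
theorem pdd_q (i j : Fin (n+1)) {x : Eu n} (hx : x ∈ sph n) :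
    pd i (pd i (fun y : Eu n => y j * ‖y‖⁻¹)) x = - 2 * (if i = j then x j else 0) - x j + 3 * x j * (x i * x i) := by
  have hx0 := sph_ne hx
  have s := sm_inrm n
  rw [pd_congr (fun y hy => pd_q i j hy) i hx0, pd_add i (s.cmul _) (((Sm.coord j).mul ((Sm.coord i).mul (s.mul (s.mul s)))).cmul _) hx0,
    pd_cmul i _ s hx0, pd_cmul i _ ((Sm.coord j).mul ((Sm.coord i).mul (s.mul (s.mul s)))) hx0,
    pd_mul i (diff_coord j x) (((Sm.coord i).mul (s.mul (s.mul s))).diff hx0), pd_mul i (diff_coord i x) ((s.mul (s.mul s)).diff hx0),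
    pd_mul i (s.diff hx0) ((s.mul s).diff hx0), pd_mul i (s.diff hx0) (s.diff hx0), pd_inrm i hx0, pd_coord, pd_coord, mem_sph.mp hx]
  rcases eq_or_ne i j with h | h
  · subst h; simp; ring
  · simp [h]; ring
theorem pd_Psi (i j : Fin (n+1)) (w : List (Fin (n+1))) {x : Eu n} (hx : x ∈ sph n) :
    pd i (Psi (j :: w)) x = (if i = j then Psi w x else 0) - x i * x j * Psi w x + x j * pd i (Psi w) x := by
  have hx0 := sph_ne hx
  change pd i (fun y => (y j * ‖y‖⁻¹) * Psi w y) x = _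
  rw [pd_mul i ((sm_q j).diff hx0) ((Psi_hg w).sm.diff hx0), pd_q i j hx0, mem_sph.mp hx]
  split_ifs <;> simp <;> ring
theorem lap_Psi (j : Fin (n+1)) (w : List (Fin (n+1))) {x : Eu n} (hx : x ∈ sph n) :
    ∑ i, pd i (pd i (Psi (j :: w))) x = x j * ∑ i, pd i (pd i (Psi w)) x + 2 * pd j (Psi w) x - (n + 2) * (x j * Psi w x) := by
  have hx0 := sph_ne hx
  have hw := (Psi_hg w).sm
  have h1 : ∀ i, pd i (pd i (Psi (j :: w))) x = x j * pd i (pd i (Psi w)) x + 2 * (if i = j then pd i (Psi w) x else 0)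
      - 2 * x j * (x i * pd i (Psi w) x) + Psi w x * (- 2 * (if i = j then x j else 0) - x j + 3 * x j * (x i * x i)) := by
    intro i
    have e : ∀ y ≠ 0, pd i (Psi (j :: w)) y = (y j * ‖y‖⁻¹) * pd i (Psi w) y + pd i (fun y : Eu n => y j * ‖y‖⁻¹) y * Psi w y :=
      fun y hy => pd_mul i ((sm_q j).diff hy) (hw.diff hy)
    rw [pd_congr e i hx0, pd_add i ((sm_q j).mul (hw.pd i)) (((sm_q j).pd i).mul hw) hx0, pd_mul i ((sm_q j).diff hx0) ((hw.pd i).diff hx0),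
      pd_mul i (((sm_q j).pd i).diff hx0) (hw.diff hx0), pdd_q i j hx, pd_q i j hx0, mem_sph.mp hx]
    split_ifs <;> simp <;> ring
  simp only [h1, Finset.sum_add_distrib, Finset.sum_sub_distrib, ← Finset.mul_sum, sum_sq_sph hx, (Psi_hg w).euler hx0]
  simp
  ring
theorem mem_of_eq {a b : sph n → ℝ} {S : Submodule ℝ (sph n → ℝ)} (h : b ∈ S) (e : ∀ x, a x = b x) : a ∈ S := by
  rwa [funext e]
theorem Psi_n {x : Eu n} (hx : x ∈ sph n) : Psi [] x = 1 := mem_sph.mp hx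
theorem Psi_c {x : Eu n} (hx : x ∈ sph n) (j : Fin (n+1)) (w : List (Fin (n+1))) : Psi (j :: w) x = x j * Psi w x := by
  rw [Psi, mem_sph.mp hx]; simp
def Pw {n : ℕ} (w : List (Fin (n+1))) : sph n → ℝ := fun x => Psi w x.1
def PS (n d : ℕ) : Submodule ℝ (sph n → ℝ) := Submodule.span ℝ {g | ∃ w : List (Fin (n+1)), w.length < d ∧ g = Pw w}
theorem PS_mono {n d e : ℕ} (h : d ≤ e) : PS n d ≤ PS n e := Submodule.span_mono fun _ ⟨v, hv, hg⟩ => ⟨v, hv.trans_le h, hg⟩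
theorem PS_mem {n d : ℕ} (w : List (Fin (n+1))) (h : w.length < d) : Pw w ∈ PS n d := Submodule.subset_span ⟨w, h, rfl⟩
theorem PS_mul {n d : ℕ} (j : Fin (n+1)) {g : sph n → ℝ} (h : g ∈ PS n d) : (fun x : sph n => x.1 j * g x) ∈ PS n (d+1) := by
  have : PS n d ≤ (PS n (d+1)).comap (LinearMap.mulLeft ℝ (fun x : sph n => x.1 j)) := by
    refine Submodule.span_le.2 ?_
    rintro _ ⟨w, hw, rfl⟩
    have e : (LinearMap.mulLeft ℝ (fun x : sph n => x.1 j)) (Pw w) = Pw (j :: w) := by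
      ext x; simp [Pw, Psi, mem_sph.mp x.2]
    simp only [SetLike.mem_coe, Submodule.mem_comap, e]
    exact PS_mem _ (by simpa using hw)
  exact this h
theorem g_pd (i : Fin (n+1)) (w : List (Fin (n+1))) :
    (fun x : sph n => pd i (Psi w) x.1 - (1 - w.length) * (x.1 i * Psi w x.1)) ∈ PS n w.length := by
  induction w with
  | nil =>
    refine mem_of_eq (PS n 0).zero_mem fun x => ?_
    have : pd i (Psi []) x.1 = x.1 i * ‖x.1‖⁻¹ := pd_nrm i (sph_ne x.2)
    rw [this, Psi_n x.2, mem_sph.mp x.2]; simp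
  | cons j w ih =>
    have h1 := PS_mul j ih
    have h2 := (PS n (w.length + 1)).smul_mem (if i = j then (1:ℝ) else 0) (PS_mem w (Nat.lt_succ_self _))
    refine mem_of_eq ((PS n (w.length + 1)).add_mem h1 h2) fun x => ?_
    simp only [pd_Psi i j w x.2, Pi.add_apply, Pi.smul_apply, Pw, Psi_c x.2, smul_eq_mul, List.length_cons]
    push_cast
    split_ifs <;> simp <;> ring
theorem g_lap (w : List (Fin (n+1))) :
    (fun x : sph n => ∑ i, pd i (pd i (Psi w)) x.1 - (1 - w.length) * (n + w.length) * Psi w x.1) ∈ PS n w.length := by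
  induction w with
  | nil =>
    refine mem_of_eq (PS n 0).zero_mem fun x => ?_
    have : ∀ i, pd i (pd i (Psi [])) x.1 = _ := fun i => Hm_nrm x.2 i i
    simp only [this, Psi_n x.2]; simp [sum_sq_sph x.2]
  | cons j w ih =>
    have h1 := PS_mul j ih
    have h2 := (PS n (w.length + 1)).smul_mem 2 (PS_mono (Nat.le_succ _) (g_pd j w))
    refine mem_of_eq ((PS n (w.length + 1)).add_mem h1 h2) fun x => ?_
    simp only [lap_Psi j w x.2, Pi.add_apply, Pi.smul_apply, Psi_c x.2, smul_eq_mul, List.length_cons]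
    push_cast
    ring
theorem g_range {k : ℕ} (hk1 : 1 ≤ k) (hk : k ≤ n) (d : ℕ) : ∀ g ∈ PS n d, ∃ F, Hg F ∧ ∃ a : ℝ, ∀ x : sph n,
    g x = BB k (fun y : Eu n => ‖y‖) F x.1 + a := by
  have h0 : Hg (fun _ : Eu n => (0:ℝ)) := ⟨Sm.const 0, fun r _ y _ => by simp⟩
  have hcl : ∀ (c : ℝ) (F G : Eu n → ℝ), Hg F → Hg G → ∀ x : sph n, BB k (fun y : Eu n => ‖y‖) (fun y => F y + c * G y) x.1 =
     BB k (fun y : Eu n => ‖y‖) F x.1 + c * BB k (fun y : Eu n => ‖y‖) G x.1 := fun c F G hF hG x => BB_add k hF.sm hG.sm c (sph_ne x.2)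
  have hz : ∀ x : sph n, BB k (fun y : Eu n => ‖y‖) (fun _ => 0) x.1 = 0 := fun x => by
    have := hcl (-1) _ _ h0 h0 x; simp at this; exact this
  induction d with
  | zero =>
    intro g hg
    have : g = 0 := by simpa [PS] using hg
    subst this
    exact ⟨_, h0, 0, fun x => by rw [hz]; simp⟩
  | succ d ih =>
    intro g hg
    refine Submodule.span_induction ?_ ?_ ?_ ?_ hg
    · rintro _ ⟨w, hw, rfl⟩
      rcases Nat.lt_succ_iff_lt_or_eq.1 hw with h | h
      · exact ih _ (PS_mem w h)
      · rcases Nat.eq_zero_or_pos d with hd | hd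
        · have : w = [] := List.length_eq_zero_iff.1 (h.trans hd)
          subst this
          exact ⟨_, h0, 1, fun x => by rw [hz]; simp [Pw, Psi, mem_sph.mp x.2]⟩
        · obtain ⟨c, hc, hB⟩ := BB_nrm (n := n) hk1 hk
          obtain ⟨F, hF, a, hFa⟩ := ih _ (h ▸ g_lap w)
          have hn1 : (1:ℝ) ≤ n := by exact_mod_cast hk1.trans hk
          have hd1 : (1:ℝ) ≤ d := by exact_mod_cast hd
          set e : ℝ := d * (n + d - 1) with he
          have he0 : 0 < e := by have : 0 < (n:ℝ) + d - 1 := by linarith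
                                 positivity
          refine ⟨_, ((Psi_hg w).add (hF.cmul c)).cmul (c * e)⁻¹ |> h0.add, c * a / (c * e), fun x => ?_⟩
          rw [hcl _ _ _ h0 ((Psi_hg w).add (hF.cmul c)) x, hz, hcl _ _ _ (Psi_hg w) hF x, hB _ (Psi_hg w) _ x.2]
          have := hFa x
          have h3 : BB k (fun y : Eu n => ‖y‖) F x.1 = (∑ i, pd i (pd i (Psi w)) x.1 - (1 - d) * (n + d) * Psi w x.1) - a := by rw [this]; ring
          rw [h3, Pw]
          field_simp
          rw [he]; ring
    · exact ⟨_, h0, 0, fun x => by rw [hz]; simp⟩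
    · rintro g1 g2 _ _ ⟨F1, hF1, a1, h1⟩ ⟨F2, hF2, a2, h2⟩
      exact ⟨_, hF1.add (hF2.cmul 1), a1 + a2, fun x => by rw [hcl 1 _ _ hF1 hF2 x, Pi.add_apply, h1, h2]; ring⟩
    · rintro c g1 _ ⟨F1, hF1, a1, h1⟩
      exact ⟨_, h0.add (hF1.cmul c), c * a1, fun x => by rw [hcl c _ _ h0 hF1 x, hz, Pi.smul_apply, h1, smul_eq_mul]; ring⟩
theorem BB_int {k : ℕ} {U F : Eu n → ℝ} (hU : Gd U) (hF : Hg F) : ∫ x, U x * BB k U F x ∂(mu n) = 0 := by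
  rw [BB_symm k hU hF hU.toHg, int_congr (h := fun _ => (0:ℝ)) fun x hx => by rw [BB_self k hU (sph_ne hx), mul_zero]]; simp
theorem DD0 {k : ℕ} (hk1 : 1 ≤ k) (hk : k ≤ n) : DD k (fun y : Eu n => ‖y‖) := by
  intro z hz hz0 ε hε
  haveI : CompactSpace (sph n) := isCompact_iff_compactSpace.1 (sph_compact n)
  let X : Fin (n+1) → C(sph n, ℝ) := fun i => ⟨fun x => x.1 i, by fun_prop⟩
  let A : Subalgebra ℝ C(sph n, ℝ) := Algebra.adjoin ℝ (Set.range X)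
  have hA : A.SeparatesPoints := by
    intro x y hxy
    have : ∃ i, x.1 i ≠ y.1 i := by
      by_contra h; push Not at h
      exact hxy (Subtype.ext (by ext i; exact h i))
    obtain ⟨i, hi⟩ := this
    exact ⟨_, ⟨X i, Algebra.subset_adjoin ⟨i, rfl⟩, rfl⟩, hi⟩
  have hAP : ∀ g ∈ A, ∃ d, (g : sph n → ℝ) ∈ PS n d := by
    intro g hg
    have : g ∈ Subalgebra.toSubmodule A := hg
    rw [Algebra.adjoin_eq_span] at this
    refine Submodule.span_induction ?_ ?_ ?_ ?_ this
    · intro g hg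
      induction hg using Submonoid.closure_induction_left with
      | one => refine ⟨1, ?_⟩
               refine mem_of_eq (PS_mem (n := n) [] (by simp)) fun x => ?_
               simp [Pw, Psi, mem_sph.mp x.2]
      | mul_left x hx y hy ih =>
        obtain ⟨i, rfl⟩ := hx
        obtain ⟨d, hd⟩ := ih
        exact ⟨d+1, PS_mul i hd⟩
    · exact ⟨0, (PS n 0).zero_mem⟩
    · rintro g1 g2 _ _ ⟨d, hd⟩ ⟨e, he⟩
      exact ⟨max d e, (PS n _).add_mem (PS_mono (le_max_left _ _) hd) (PS_mono (le_max_right _ _) he)⟩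
    · rintro c g _ ⟨d, hd⟩
      exact ⟨d, (PS n _).smul_mem c hd⟩
  have hS := sphVol_pos n
  rw [sphVol_eq] at hS
  set S := ∫ _, (1:ℝ) ∂(mu n) with hSd
  set δ := Real.sqrt (ε / (8 * S)) with hδ
  have hδ0 : 0 < δ := Real.sqrt_pos.2 (by positivity)
  have hδ2 : δ ^ 2 = ε / (8 * S) := Real.sq_sqrt (by positivity)
  obtain ⟨g, hg⟩ := ContinuousMap.exists_mem_subalgebra_near_continuous_of_separatesPoints A hA (fun x : sph n => z x.1)
    (hz.comp_continuous continuous_subtype_val fun x => x.2) δ hδ0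
  obtain ⟨d, hd⟩ := hAP g.1 g.2
  obtain ⟨F, hF, a, hFa⟩ := g_range hk1 hk d _ hd
  have cB := (BB_sm k (Gd.nrm n) hF.sm).cont
  have hb : ∀ x ∈ sph n, |BB k (fun y : Eu n => ‖y‖) F x + a - z x| ≤ δ := fun x hx => by
    have h1 := hg ⟨x, hx⟩
    have h2 := hFa ⟨x, hx⟩
    rw [← h2]; exact h1.le
  have hi : ∫ x, (BB k (fun y : Eu n => ‖y‖) F x + a * 1 - z x) ∂(mu n) = a * S := by
    rw [isub (by fun_prop) hz, iadd (by fun_prop) (by fun_prop), integral_const_mul]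
    have h1 := BB_int (k := k) (Gd.nrm n) hF
    rw [int_congr (h := BB k (fun y : Eu n => ‖y‖) F) fun x hx => by rw [mem_sph.mp hx, one_mul]] at h1
    beta_reduce at hz0
    rw [int_congr (h := z) fun x hx => by rw [mem_sph.mp hx, one_mul]] at hz0
    rw [h1, hz0]; ring
  have hu : a * S ≤ δ * S := by
    rw [← hi, hSd, ← integral_const_mul]
    exact int_mono (by fun_prop) (by fun_prop) fun x hx => by have := (abs_le.1 (hb x hx)).2; linarith
  have hl : -δ * S ≤ a * S := by
    rw [← hi, hSd, ← integral_const_mul]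
    exact int_mono (by fun_prop) (by fun_prop) fun x hx => by have := (abs_le.1 (hb x hx)).1; linarith
  have hau := le_of_mul_le_mul_right hu hS
  have hal := le_of_mul_le_mul_right hl hS
  refine ⟨F, hF, ?_⟩
  calc ∫ x, (BB k (fun y : Eu n => ‖y‖) F x - z x)^2 ∂(mu n) ≤ ∫ x, (4 * δ^2) * 1 ∂(mu n) := by
        refine int_mono (by fun_prop) (by fun_prop) fun x hx => ?_
        have := abs_le.1 (hb x hx)
        nlinarith
    _ = ε / 2 := by rw [integral_const_mul, hδ2]; field_simp; ring
    _ < ε := by linarith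
theorem pos_min {X : Type*} [TopologicalSpace X] {Z : Set X} (hZ : IsCompact Z) {q : X → ℝ} (hq : ContinuousOn q Z)
    (h : ∀ z ∈ Z, 0 < q z) : ∃ c > 0, ∀ z ∈ Z, c ≤ q z := by
  rcases Z.eq_empty_or_nonempty with rfl | hne
  · exact ⟨1, one_pos, by simp⟩
  · obtain ⟨z0, hz0, hm⟩ := hZ.exists_isMinOn hne hq
    exact ⟨q z0, h z0 hz0, fun z hz => hm hz⟩
theorem pq {X : Type*} [TopologicalSpace X] [T2Space X] {Z : Set X} (hZ : IsCompact Z) {p q : X → ℝ} (hp : ContinuousOn p Z) (hq : ContinuousOn q Z)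
    (hp0 : ∀ z ∈ Z, 0 ≤ p z) (h : ∀ z ∈ Z, p z = 0 → 0 < q z) : ∃ C > 0, ∃ c > 0, ∀ z ∈ Z, c ≤ C * p z + q z := by
  have hN : IsCompact (Z ∩ q ⁻¹' Set.Iic 0) := hZ.of_isClosed_subset (hq.preimage_isClosed_of_isClosed hZ.isClosed isClosed_Iic) Set.inter_subset_left
  obtain ⟨p0, hp0', hp1⟩ := pos_min hN (hp.mono Set.inter_subset_left) fun z hz => lt_of_le_of_ne (hp0 z hz.1) fun e => by
    have := h z hz.1 e.symm; have h2 : q z ≤ 0 := hz.2; linarith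
  obtain ⟨Q, hQ⟩ := hZ.exists_bound_of_continuousOn hq
  have hc : ContinuousOn (fun z => ((|Q| + 1) / p0) * p z + q z) Z := by fun_prop
  obtain ⟨c, hc0, hc1⟩ := pos_min hZ hc fun z hz => by
    by_cases hq0 : q z ≤ 0
    · have h1 := hp1 z ⟨hz, hq0⟩
      have h2 : (|Q| + 1) / p0 * p0 ≤ (|Q| + 1) / p0 * p z := mul_le_mul_of_nonneg_left h1 (by positivity)
      rw [div_mul_cancel₀ _ hp0'.ne'] at h2
      have h3 := (abs_le.1 ((hQ z hz).trans (le_abs_self Q))).1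
      linarith
    · have := mul_nonneg (show 0 ≤ (|Q| + 1) / p0 by positivity) (hp0 z hz)
      push Not at hq0; linarith
  exact ⟨_, by positivity, c, hc0, hc1⟩
def Ut {n : ℕ} (U : Eu n → ℝ) (t : ℝ) : Eu n → ℝ := fun y => ‖y‖ + t * (U y + (-1) * ‖y‖)
theorem Ut_gd {U : Eu n → ℝ} (hU : Gd U) {t : ℝ} (ht : t ∈ Set.Icc (0:ℝ) 1) : Gd (Ut U t) := by
  have : Ut U t = fun y => (1 - t) * ‖y‖ + t * U y := by ext y; rw [Ut]; ring
  rw [this]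
  exact (Gd.nrm n).comb hU (by linarith [ht.2]) ht.1 (by linarith)
theorem hsub {U : Eu n → ℝ} (hU : Gd U) : Hg (fun y => U y + (-1) * ‖y‖) := hU.toHg.add ((Hg.nrm n).cmul (-1))
theorem Ut_cont {U : Eu n → ℝ} (hU : Gd U) : ContinuousOn (fun p : ℝ × Eu n => Ut U p.1 p.2) (Set.univ ×ˢ sph n) :=
  (cont_snd (Hg.nrm n).sm.cont).add (continuousOn_fst.mul (cont_snd (hsub hU).sm.cont))
theorem Ut_hm {U : Eu n → ℝ} (hU : Gd U) : ContinuousOn (fun p : ℝ × Eu n => Hm (Ut U p.1) p.2) (Set.univ ×ˢ sph n) := by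
  refine (Hm_cont2 (Hg.nrm n).sm (hsub hU).sm).congr fun p hp => ?_
  exact Hm_line (Hg.nrm n).sm (hsub hU).sm (sph_ne hp.2) p.1
theorem ell {k : ℕ} (hk2 : 2 ≤ k) (hk : k ≤ n) {U : Eu n → ℝ} (hU : Gd U) : ∃ C > 0, ∃ c > 0, ∀ t ∈ Set.Icc (0:ℝ) 1, ∀ x ∈ sph n,
    ∀ M, Kx x M → c * ‖M‖^2 ≤ C * (eD k (Hm (Ut U t) x) M)^2 - eDD k (Hm (Ut U t) x) M M := by
  let Z : Set ((ℝ × Eu n) × Mt (n+1)) := ((Set.Icc (0:ℝ) 1 ×ˢ sph n) ×ˢ Metric.sphere 0 1) ∩ {z | Kx z.1.2 z.2}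
  have hcl : IsClosed {z : (ℝ × Eu n) × Mt (n+1) | Kx z.1.2 z.2} := by
    have : {z : (ℝ × Eu n) × Mt (n+1) | Kx z.1.2 z.2} = {z | ∀ i j, z.2 i j = z.2 j i} ∩ {z | ∀ i, ∑ j, z.2 i j * z.1.2 j = 0} := by
      ext z; exact ⟨fun h => ⟨h.1, h.2⟩, fun h => ⟨h.1, h.2⟩⟩
    rw [this]
    refine IsClosed.inter ?_ ?_
    · simp only [Set.ofPred_forall]
      exact isClosed_iInter fun i => isClosed_iInter fun j => isClosed_eq (by fun_prop) (by fun_prop)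
    · simp only [Set.ofPred_forall]
      exact isClosed_iInter fun i => isClosed_eq (by fun_prop) (by fun_prop)
  have hZ : IsCompact Z := ((isCompact_Icc.prod (sph_compact n)).prod (isCompact_sphere _ _)).inter_right hcl
  have hA : ContinuousOn (fun z : (ℝ × Eu n) × Mt (n+1) => Hm (Ut U z.1.1) z.1.2) Z :=
    (Ut_hm hU).comp (f := fun z : (ℝ × Eu n) × Mt (n+1) => z.1) (by fun_prop) fun z hz => ⟨trivial, hz.1.1.2⟩
  have c1 : ContinuousOn (fun z : (ℝ × Eu n) × Mt (n+1) => (eD k (Hm (Ut U z.1.1) z.1.2) z.2)^2) Z :=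
    ((eD_cont k).comp_continuousOn (hA.prodMk (by fun_prop))).pow 2
  have c2 : ContinuousOn (fun z : (ℝ × Eu n) × Mt (n+1) => -eDD k (Hm (Ut U z.1.1) z.1.2) z.2 z.2) Z :=
    ((eDD_cont k).comp_continuousOn (hA.prodMk (continuousOn_snd.prodMk continuousOn_snd))).neg
  obtain ⟨C, hC, c, hc, h⟩ := pq hZ c1 c2 (fun z _ => sq_nonneg _) (fun z hz h => by
    have := E4 hk2 hk hz.1.1.2 ((Ut_gd hU hz.1.1.1).cvx _ hz.1.1.2) hz.2 (by simpa using h) (fun e => by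
      have := hz.1.2; rw [e] at this; simp at this)
    linarith)
  refine ⟨C, hC, c, hc, fun t ht x hx M hM => ?_⟩
  rcases eq_or_ne M 0 with rfl | hM0
  · have h1 : eD k (Hm (Ut U t) x) 0 = 0 := by simp [eD]
    have h2 : eDD k (Hm (Ut U t) x) 0 0 = 0 := by simp [eDD]
    rw [h1, h2]; simp
  · have hn : 0 < ‖M‖ := norm_pos_iff.2 hM0
    have := h ((t, x), ‖M‖⁻¹ • M) ⟨⟨⟨ht, hx⟩, by simp [norm_smul, hn.ne']⟩, hM.smul _⟩
    simp only [eD_smul, eDD_smull, eDD_smulr] at this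
    have h2 := mul_le_mul_of_nonneg_right this (sq_nonneg ‖M‖)
    refine h2.trans_eq ?_
    field_simp
    ring
theorem apriori {k : ℕ} (hk2 : 2 ≤ k) (hk : k ≤ n) {U : Eu n → ℝ} (hU : Gd U) (hAF : AF k U) {a b c C : ℝ} (ha : 0 < a) (hb : 0 < b) (hc : 0 < c) (hC : 0 < C)
    (h1 : ∀ x ∈ sph n, a ≤ U x ∧ U x ≤ b ∧ a ≤ sg k U x * (U x)⁻¹ ∧ sg k U x * (U x)⁻¹ ≤ b)
    (h2 : ∀ x ∈ sph n, ∀ M, Kx x M → c * ‖M‖^2 ≤ C * (eD k (Hm U x) M)^2 - eDD k (Hm U x) M M)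
    {F : Eu n → ℝ} (hF : Hg F) (h0 : ∫ x, F x * sg k U x ∂(mu n) = 0) :
    ∫ x, (F x ^ 2 + ‖Hm F x‖^2) ∂(mu n) ≤ (a⁻¹^2 + (c * a)⁻¹ * (C * b * (2 * k^2 * b^2 * a⁻¹^2 + 2) + k * a⁻¹)) * ∫ x, (BB k U F x)^2 ∂(mu n) := by
  have hk1 : (2:ℝ) ≤ k := by exact_mod_cast hk2
  have cB := (BB_sm k hU hF.sm).cont
  have cL := (LL_sm k hU.sm hF.sm).cont
  have cS := SS_cont k hU.sm hF.sm hF.sm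
  have cF := hF.sm.cont
  have cU := hU.sm.cont
  have cH := (Hm_cont hF.sm).norm
  have hUi : Sm fun y => (U y)⁻¹ := hU.sm.inv fun y hy => (hU.pos y hy).ne'
  have cw := ((sg_sm k hU.sm).mul hUi).cont
  set B := ∫ x, (BB k U F x)^2 ∂(mu n) with hB
  set P := ∫ x, F x ^ 2 ∂(mu n) with hP
  set m := ∫ x, (sg k U x * (U x)⁻¹) * F x ^ 2 ∂(mu n) with hm
  set I := ∫ x, F x * BB k U F x ∂(mu n) with hI
  have e1 := b_eq (k := k) hU hF
  have e2 := hAF F hF h0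
  have hm1 : a * P ≤ m := by
    rw [hP, ← integral_const_mul]
    exact int_mono (by fun_prop) (by fun_prop) fun x hx => mul_le_mul_of_nonneg_right (h1 x hx).2.2.1 (sq_nonneg _)
  have hP0 : 0 ≤ P := int_nonneg fun x _ => sq_nonneg _
  have hB0 : 0 ≤ B := int_nonneg fun x _ => sq_nonneg _
  have hm0 : 0 ≤ m := le_trans (by positivity) hm1
  have hmk : m ≤ k * m := by nlinarith
  have hI1 : I ≤ a / 2 * P + (2 * a)⁻¹ * B := by
    rw [hP, hB, ← integral_const_mul, ← integral_const_mul, ← iadd (by fun_prop) (by fun_prop)]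
    refine int_mono (by fun_prop) (by fun_prop) fun x hx => ?_
    have : 0 ≤ (2 * a)⁻¹ * (a * F x - BB k U F x)^2 := by positivity
    have e : (2 * a)⁻¹ * (a * F x - BB k U F x)^2 = a / 2 * F x ^ 2 + (2 * a)⁻¹ * (BB k U F x)^2 - F x * BB k U F x := by field_simp; ring
    linarith
  have hPB : P ≤ a⁻¹^2 * B := by
    have : a / 2 * P ≤ (2 * a)⁻¹ * B := by linarith
    have h3 := mul_le_mul_of_nonneg_left this (show 0 ≤ 2 * a⁻¹ by positivity)
    have e3 : 2 * a⁻¹ * (a / 2 * P) = P := by field_simp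
    have e4 : 2 * a⁻¹ * ((2 * a)⁻¹ * B) = a⁻¹^2 * B := by field_simp
    linarith
  have hIB : I ≤ a⁻¹ * B := by
    have h3 := mul_le_mul_of_nonneg_left hPB (show 0 ≤ a / 2 by positivity)
    have e3 : a / 2 * (a⁻¹^2 * B) + (2 * a)⁻¹ * B = a⁻¹ * B := by field_simp; ring
    linarith
  have hH : c * a * ∫ x, ‖Hm F x‖^2 ∂(mu n) ≤ C * b * ((2 * k^2 * b^2) * P + 2 * B) - ∫ x, U x * SS k U F F x ∂(mu n) := by
    rw [hP, hB, ← integral_const_mul, ← integral_const_mul, ← integral_const_mul, ← iadd (by fun_prop) (by fun_prop), ← integral_const_mul,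
      ← isub (by fun_prop) (by fun_prop)]
    refine int_mono (by fun_prop) (by fun_prop) fun x hx => ?_
    have hx1 := h2 x hx _ (hF.kx hx)
    change _ ≤ C * (LL k U F x)^2 - SS k U F F x at hx1
    obtain ⟨q1, q2, q3, q4⟩ := h1 x hx
    have hL : LL k U F x = k * (sg k U x * (U x)⁻¹) * F x - BB k U F x := by rw [BB]; ring
    have hw2 : (sg k U x * (U x)⁻¹)^2 ≤ b^2 := by gcongr; linarith
    have hL2 : (LL k U F x)^2 ≤ (2 * k^2 * b^2) * F x ^ 2 + 2 * (BB k U F x)^2 := by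
      rw [hL]
      have t1 : 0 ≤ (k * (sg k U x * (U x)⁻¹) * F x + BB k U F x)^2 := sq_nonneg _
      have t2 : (sg k U x * (U x)⁻¹)^2 * (2 * k^2 * F x ^ 2) ≤ b^2 * (2 * k^2 * F x ^ 2) := by gcongr
      linarith
    have hu0 : 0 ≤ U x := by linarith
    have s1 := mul_le_mul_of_nonneg_left hx1 hu0
    have s2 : c * a * ‖Hm F x‖^2 ≤ U x * (c * ‖Hm F x‖^2) := by
      have := mul_le_mul_of_nonneg_right q1 (show 0 ≤ c * ‖Hm F x‖^2 by positivity); linarith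
    have s3 : U x * (C * (LL k U F x)^2) ≤ C * b * ((2 * k^2 * b^2) * F x ^ 2 + 2 * (BB k U F x)^2) := by
      calc U x * (C * (LL k U F x)^2) ≤ b * (C * (LL k U F x)^2) := by gcongr
        _ ≤ b * (C * ((2 * k^2 * b^2) * F x ^ 2 + 2 * (BB k U F x)^2)) := by gcongr
        _ = _ := by ring
    linarith
  rw [S_self hU.toHg hF] at hH
  rw [iadd (by fun_prop) (by fun_prop)]
  have hS : -((k - 1) * ∫ x, F x * LL k U F x ∂(mu n)) ≤ k * a⁻¹ * B := by
    have q : -∫ x, F x * LL k U F x ∂(mu n) ≤ a⁻¹ * B := by nlinarith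
    have q0 : 0 ≤ a⁻¹ * B := by positivity
    nlinarith
  have hPP : C * b * ((2 * k^2 * b^2) * P + 2 * B) ≤ C * b * ((2 * k^2 * b^2) * (a⁻¹^2 * B) + 2 * B) := by gcongr
  have hfin : c * a * ∫ x, ‖Hm F x‖^2 ∂(mu n) ≤ (C * b * (2 * k^2 * b^2 * a⁻¹^2 + 2) + k * a⁻¹) * B := by linarith
  have hg := mul_le_mul_of_nonneg_left hfin (show 0 ≤ (c * a)⁻¹ by positivity)
  rw [← mul_assoc, inv_mul_cancel₀ (by positivity), one_mul] at hg
  linarith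
theorem hg0 (n : ℕ) : Hg (fun _ : Eu n => (0:ℝ)) := ⟨Sm.const 0, fun r _ y _ => by simp⟩
theorem BB_zero (k : ℕ) (U : Eu n → ℝ) {y : Eu n} (hy : y ≠ 0) : BB k U (fun _ => 0) y = 0 := by
  have := BB_add k (U := U) (hg0 n).sm (hg0 n).sm (-1) hy
  simp at this; exact this
theorem sq3 (a b c : ℝ) : (a + b + c)^2 ≤ 3 * (a^2 + b^2 + c^2) := by
  nlinarith [sq_nonneg (a - b), sq_nonneg (b - c), sq_nonneg (a - c)]
set_option maxHeartbeats 1000000 in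
theorem step {k : ℕ} (hk : k ≤ n) {U V : Eu n → ℝ} (hU : Gd U) (hV : Gd V) (hD : DD k U) {a d C : ℝ} (ha : 0 < a) (hd0 : 0 < d) (hd1 : d ≤ 1) (hC : 0 ≤ C)
    (hd : d^2 * (3 * (6 * C * (2 + a⁻¹^2) + 1 + a⁻¹^2)) ≤ 1 / 4)
    (hA : ∀ x ∈ sph n, a ≤ U x ∧ |U x - V x| ≤ d)
    (hE : ∀ F, Hg F → ∫ x, F x * sg k U x ∂(mu n) = 0 → ∫ x, (F x ^ 2 + ‖Hm F x‖^2) ∂(mu n) ≤ C * ∫ x, (BB k U F x)^2 ∂(mu n))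
    (hB : ∀ F, Hg F → ∀ x ∈ sph n, (BB k V F x - BB k U F x)^2 ≤ 2 * d^2 * (F x ^ 2 + ‖Hm F x‖^2)) : DD k V := by
  have cU := hU.sm.cont
  have cV := hV.sm.cont
  have csg := (sg_sm k hU.sm).cont
  have hS := sphVol_pos n
  rw [sphVol_eq] at hS
  set S := ∫ _, (1:ℝ) ∂(mu n) with hSd
  have half : ∀ z : Eu n → ℝ, ContinuousOn z (sph n) → ∫ x, V x * z x ∂(mu n) = 0 →
      ∃ F, Hg F ∧ ∫ x, (BB k V F x - z x)^2 ∂(mu n) ≤ 1 / 4 * ∫ x, z x ^ 2 ∂(mu n) := by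
    intro z hz hz0
    set Z := ∫ x, z x ^ 2 ∂(mu n) with hZ
    have hZ0 : 0 ≤ Z := int_nonneg fun x _ => sq_nonneg _
    rcases hZ0.eq_or_lt with h | hZp
    · refine ⟨_, hg0 n, ?_⟩
      rw [int_congr (h := fun x => z x ^ 2) fun x hx => by rw [BB_zero k V (sph_ne hx)]; ring, ← hZ, ← h]; simp
    set s := ∫ x, U x * z x ∂(mu n) with hs
    set S0 := ∫ x, U x ∂(mu n) with hS0
    have hS0a : a * S ≤ S0 := by
      rw [hSd, ← integral_const_mul]
      exact int_mono (by fun_prop) (by fun_prop) fun x hx => by linarith [(hA x hx).1]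
    have hS0p : 0 < S0 := lt_of_lt_of_le (by positivity) hS0a
    set e := s / S0 with he
    have hs2 : s^2 ≤ d^2 * S * Z := by
      have h1 : s = ∫ x, (U x - V x) * z x ∂(mu n) := by
        rw [← sub_zero s, ← hz0, hs, ← isub (by fun_prop) (by fun_prop)]
        exact int_congr fun x _ => by ring
      have h2 := cs (f := fun x => U x - V x) (g := z) (by fun_prop) hz
      rw [h1]
      refine h2.trans (mul_le_mul_of_nonneg_right ?_ hZ0)
      rw [hSd, ← integral_const_mul]
      refine int_mono (by fun_prop) (by fun_prop) fun x hx => ?_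
      have := (hA x hx).2
      rw [mul_one, ← sq_abs]
      gcongr
    have he2 : e^2 * S ≤ d^2 * a⁻¹^2 * Z := by
      have h1 : (a * S)^2 ≤ S0^2 := by gcongr
      have h2 : e^2 * S0^2 = s^2 := by rw [he]; field_simp
      have h3 : e^2 * (a * S)^2 ≤ d^2 * S * Z := (mul_le_mul_of_nonneg_left h1 (sq_nonneg _)).trans (h2.le.trans hs2)
      have h4 := mul_le_mul_of_nonneg_left h3 (show 0 ≤ a⁻¹^2 * S⁻¹ by positivity)
      have e1 : a⁻¹^2 * S⁻¹ * (e^2 * (a * S)^2) = e^2 * S := by field_simp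
      have e2 : a⁻¹^2 * S⁻¹ * (d^2 * S * Z) = d^2 * a⁻¹^2 * Z := by field_simp
      linarith
    obtain ⟨F0, hF0, hF0e⟩ := hD (fun x => z x - e * 1) (by fun_prop) (by
      have : ∫ x, U x * (z x - e * 1) ∂(mu n) = s - e * S0 := by
        rw [hs, hS0, ← integral_const_mul, ← isub (by fun_prop) (by fun_prop)]
        exact int_congr fun x _ => by ring
      rw [this, he, div_mul_cancel₀ _ hS0p.ne', sub_self]) (d^2 * Z) (by positivity)
    set q := ∫ x, U x * sg k U x ∂(mu n) with hq
    have hqp : 0 < q := by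
      obtain ⟨c, hc, hc1⟩ := pos_min (sph_compact n) (show ContinuousOn (fun x => U x * sg k U x) (sph n) by fun_prop) fun x hx =>
        mul_pos (hU.pos x (sph_ne hx)) (hU.sgpos hk hx)
      have : c * S ≤ q := by
        rw [hSd, ← integral_const_mul]
        exact int_mono (by fun_prop) (by fun_prop) fun x hx => by linarith [hc1 x hx]
      exact lt_of_lt_of_le (by positivity) this
    set t := - (∫ x, F0 x * sg k U x ∂(mu n)) / q with ht
    have hF : Hg (fun y => F0 y + t * U y) := hF0.add (hU.toHg.cmul t)
    have cF0 := hF0.sm.cont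
    have hF1 : ∫ x, (F0 x + t * U x) * sg k U x ∂(mu n) = 0 := by
      have : ∫ x, (F0 x + t * U x) * sg k U x ∂(mu n) = ∫ x, F0 x * sg k U x ∂(mu n) + t * q := by
        rw [hq, ← integral_const_mul, ← iadd (by fun_prop) (by fun_prop)]
        exact int_congr fun x _ => by ring
      rw [this, ht, div_mul_cancel₀ _ hqp.ne']; ring
    have hBU : ∀ x ∈ sph n, BB k U (fun y => F0 y + t * U y) x = BB k U F0 x := fun x hx => by
      rw [BB_add k hF0.sm hU.sm t (sph_ne hx), BB_self k hU (sph_ne hx)]; ring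
    generalize hFe : (fun y => F0 y + t * U y) = F at hF hBU
    have hF1' : ∫ x, F x * sg k U x ∂(mu n) = 0 := by rw [← hFe]; exact hF1
    refine ⟨F, hF, ?_⟩
    have cBU := (BB_sm k hU hF.sm).cont
    have cBV := (BB_sm k hV hF.sm).cont
    have cF := hF.sm.cont
    have cH := (Hm_cont hF.sm).norm
    have i1 : ∫ x, (BB k U F x - (z x - e * 1))^2 ∂(mu n) ≤ d^2 * Z := by
      rw [int_congr (h := fun x => (BB k U F0 x - (z x - e * 1))^2) fun x hx => by rw [hBU x hx]]; exact hF0e.le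
    have i0 : ∫ x, e^2 * 1 ∂(mu n) ≤ d^2 * a⁻¹^2 * Z := by rw [integral_const_mul]; exact he2
    have i2 : ∫ x, (BB k U F x)^2 ∂(mu n) ≤ 3 * (2 + a⁻¹^2) * Z := by
      have : ∫ x, (BB k U F x)^2 ∂(mu n) ≤ ∫ x, 3 * ((BB k U F x - (z x - e * 1))^2 + e^2 * 1 + z x ^ 2) ∂(mu n) := by
        refine int_mono (by fun_prop) (by fun_prop) fun x _ => ?_
        have := sq3 (BB k U F x - (z x - e * 1)) (-e) (z x)
        rw [show BB k U F x - (z x - e * 1) + -e + z x = BB k U F x by ring, neg_sq] at this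
        linarith
      rw [integral_const_mul, iadd (by fun_prop) (by fun_prop), iadd (by fun_prop) (by fun_prop)] at this
      have hdd : d^2 * (1 + a⁻¹^2) * Z ≤ 1 * (1 + a⁻¹^2) * Z := by gcongr; nlinarith
      linarith
    have i3 : ∫ x, (BB k V F x - BB k U F x)^2 ∂(mu n) ≤ 2 * d^2 * (C * (3 * (2 + a⁻¹^2) * Z)) := by
      calc ∫ x, (BB k V F x - BB k U F x)^2 ∂(mu n) ≤ ∫ x, 2 * d^2 * (F x ^ 2 + ‖Hm F x‖^2) ∂(mu n) :=
            int_mono (by fun_prop) (by fun_prop) fun x hx => hB F hF x hx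
        _ = 2 * d^2 * ∫ x, (F x ^ 2 + ‖Hm F x‖^2) ∂(mu n) := integral_const_mul _ _
        _ ≤ _ := by gcongr; exact (hE F hF hF1').trans (by gcongr)
    have i4 : ∫ x, (BB k V F x - z x)^2 ∂(mu n) ≤ ∫ x, 3 * ((BB k V F x - BB k U F x)^2 + (BB k U F x - (z x - e * 1))^2 + e^2 * 1) ∂(mu n) := by
      refine int_mono (by fun_prop) (by fun_prop) fun x _ => ?_
      have := sq3 (BB k V F x - BB k U F x) (BB k U F x - (z x - e * 1)) (-e)
      rw [show BB k V F x - BB k U F x + (BB k U F x - (z x - e * 1)) + -e = BB k V F x - z x by ring, neg_sq] at this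
      linarith
    rw [integral_const_mul, iadd (by fun_prop) (by fun_prop), iadd (by fun_prop) (by fun_prop)] at i4
    have hf := mul_le_mul_of_nonneg_right hd hZ0
    linarith
  intro z hz hz0 ε hε
  have iter : ∀ N : ℕ, ∃ F, Hg F ∧ ∫ x, (BB k V F x - z x)^2 ∂(mu n) ≤ (1/4)^N * ∫ x, z x ^ 2 ∂(mu n) := by
    intro N
    induction N with
    | zero => exact ⟨_, hg0 n, le_of_eq (by rw [int_congr (h := fun x => z x ^ 2) fun x hx => by rw [BB_zero k V (sph_ne hx)]; ring]; simp)⟩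
    | succ N ih =>
      obtain ⟨F, hF, h⟩ := ih
      have cBV := (BB_sm k hV hF.sm).cont
      obtain ⟨G, hG, h'⟩ := half (fun x => z x - BB k V F x) (by fun_prop) (by
        rw [int_congr (h := fun x => V x * z x - V x * BB k V F x) fun x _ => by ring, isub (by fun_prop) (by fun_prop), hz0, BB_int hV hF, sub_zero])
      refine ⟨_, hF.add (hG.cmul 1), ?_⟩
      rw [int_congr (h := fun x => (BB k V G x - (z x - BB k V F x))^2) fun x hx => by rw [BB_add k hF.sm hG.sm 1 (sph_ne hx)]; ring]
      refine h'.trans ?_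
      rw [int_congr (g := fun x => (z x - BB k V F x)^2) (h := fun x => (BB k V F x - z x)^2) fun x hx => by ring]
      rw [pow_succ]; linarith
  have ht : Tendsto (fun N : ℕ => (1/4:ℝ)^N * ∫ x, z x ^ 2 ∂(mu n)) atTop (𝓝 (0 * _)) :=
    (tendsto_pow_atTop_nhds_zero_of_lt_one (by norm_num) (by norm_num)).mul_const _
  rw [zero_mul] at ht
  obtain ⟨N, hN⟩ := (ht.eventually (gt_mem_nhds hε)).exists
  obtain ⟨F, hF, h⟩ := iter N
  exact ⟨F, hF, h.trans_lt hN⟩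
theorem af2 {k : ℕ} (hk2 : 2 ≤ k) (hk : k ≤ n) {U : Eu n → ℝ} (hU : Gd U) : AF k U := by
  have hKc : IsCompact (Set.Icc (0:ℝ) 1 ×ˢ sph n) := isCompact_Icc.prod (sph_compact n)
  have hsub : Set.Icc (0:ℝ) 1 ×ˢ sph n ⊆ Set.univ ×ˢ sph n := Set.prod_mono (Set.subset_univ _) subset_rfl
  have cu := (Ut_cont hU).mono hsub
  have ch := (Ut_hm hU).mono hsub
  have csg : ContinuousOn (fun p : ℝ × Eu n => sg k (Ut U p.1) p.2) (Set.Icc (0:ℝ) 1 ×ˢ sph n) :=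
    (es_contDiff k).continuous.comp_continuousOn ch
  have up : ∀ p ∈ Set.Icc (0:ℝ) 1 ×ˢ sph n, 0 < Ut U p.1 p.2 := fun p hp => (Ut_gd hU hp.1).pos _ (sph_ne hp.2)
  have cw : ContinuousOn (fun p : ℝ × Eu n => sg k (Ut U p.1) p.2 * (Ut U p.1 p.2)⁻¹) (Set.Icc (0:ℝ) 1 ×ˢ sph n) :=
    csg.mul (cu.inv₀ fun p hp => (up p hp).ne')
  have cD : ContinuousOn (fun p : ℝ × Eu n => fderiv ℝ (es k) (Hm (Ut U p.1) p.2)) (Set.Icc (0:ℝ) 1 ×ˢ sph n) :=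
    (esD_contDiff k).continuous.comp_continuousOn ch
  obtain ⟨a1, ha1, h1⟩ := pos_min hKc cu up
  obtain ⟨a2, ha2, h2⟩ := pos_min hKc cw fun p hp => mul_pos ((Ut_gd hU hp.1).sgpos hk hp.2) (inv_pos.2 (up p hp))
  obtain ⟨b1, h3⟩ := hKc.exists_bound_of_continuousOn cu
  obtain ⟨b2, h4⟩ := hKc.exists_bound_of_continuousOn cw
  obtain ⟨C, hC, c, hc, h5⟩ := ell hk2 hk hU
  set a := min a1 a2 with ha
  set b := max (max b1 b2) 1 with hb
  have ha0 : 0 < a := lt_min ha1 ha2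
  have hb0 : 0 < b := lt_of_lt_of_le one_pos (le_max_right _ _)
  set C1 := (a⁻¹^2 + (c * a)⁻¹ * (C * b * (2 * k^2 * b^2 * a⁻¹^2 + 2) + k * a⁻¹)) with hC1
  have hC10 : 0 ≤ C1 := by positivity
  set Q := 3 * (6 * C1 * (2 + a⁻¹^2) + 1 + a⁻¹^2) with hQ
  have hQ1 : 1 ≤ Q := by
    have : 0 ≤ C1 * (2 + a⁻¹^2) := by positivity
    have : 0 ≤ a⁻¹^2 := by positivity
    linarith
  set d := (2 * Q)⁻¹ with hdd
  have hd0 : 0 < d := by positivity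
  have hd1 : d ≤ 1 := inv_le_one_of_one_le₀ (by linarith)
  have hdQ : d^2 * Q ≤ 1/4 := by
    have : d^2 * Q = 1/4 * Q⁻¹ := by rw [hdd]; field_simp; ring
    rw [this]
    have := inv_le_one_of_one_le₀ hQ1
    linarith
  have cG : ContinuousOn (fun p : ℝ × Eu n => (Ut U p.1 p.2, (k:ℝ) * (sg k (Ut U p.1) p.2 * (Ut U p.1 p.2)⁻¹), fderiv ℝ (es k) (Hm (Ut U p.1) p.2))) (Set.Icc (0:ℝ) 1 ×ˢ sph n) :=
    cu.prodMk ((cw.const_smul (k:ℝ)).prodMk cD)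
  obtain ⟨δ, hδ, huc⟩ := Metric.uniformContinuousOn_iff.1 (hKc.uniformContinuousOn_of_continuous cG) d hd0
  have main : ∀ s ∈ Set.Icc (0:ℝ) 1, ∀ t ∈ Set.Icc (0:ℝ) 1, |s - t| < δ → DD k (Ut U s) → DD k (Ut U t) := by
    intro s hs t ht hst hD
    have hclose : ∀ x ∈ sph n, |Ut U s x - Ut U t x| ≤ d ∧ |(k:ℝ) * (sg k (Ut U s) x * (Ut U s x)⁻¹) - k * (sg k (Ut U t) x * (Ut U t x)⁻¹)| ≤ d ∧
        ‖fderiv ℝ (es k) (Hm (Ut U s) x) - fderiv ℝ (es k) (Hm (Ut U t) x)‖ ≤ d := by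
      intro x hx
      have := huc (s, x) ⟨hs, hx⟩ (t, x) ⟨ht, hx⟩ (by rw [Prod.dist_eq]; simpa [Real.dist_eq] using hst)
      rw [Prod.dist_eq, Prod.dist_eq, max_lt_iff, max_lt_iff] at this
      exact ⟨this.1.le, this.2.1.le, by rw [← dist_eq_norm]; exact this.2.2.le⟩
    refine step hk (Ut_gd hU hs) (Ut_gd hU ht) hD ha0 hd0 hd1 hC10 hdQ (fun x hx => ⟨(min_le_left _ _).trans (h1 (s, x) ⟨hs, hx⟩), (hclose x hx).1⟩)
      (fun F hF h0 => ?_) (fun F hF x hx => ?_)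
    · refine apriori hk2 hk (Ut_gd hU hs) (hD.af hk2 hk (Ut_gd hU hs)) ha0 hb0 hc hC (fun x hx => ⟨?_, ?_, ?_, ?_⟩) (fun x hx M hM => h5 s hs x hx M hM) hF h0
      · exact (min_le_left _ _).trans (h1 (s, x) ⟨hs, hx⟩)
      · exact (le_abs_self _).trans ((h3 (s, x) ⟨hs, hx⟩).trans ((le_max_left _ _).trans (le_max_left _ _)))
      · exact (min_le_right _ _).trans (h2 (s, x) ⟨hs, hx⟩)
      · exact (le_abs_self _).trans ((h4 (s, x) ⟨hs, hx⟩).trans ((le_max_right _ _).trans (le_max_left _ _)))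
    · obtain ⟨_, q2, q3⟩ := hclose x hx
      have l1 : |eD k (Hm (Ut U s) x) (Hm F x) - eD k (Hm (Ut U t) x) (Hm F x)| ≤ d * ‖Hm F x‖ := by
        have := ContinuousLinearMap.le_opNorm (fderiv ℝ (es k) (Hm (Ut U s) x) - fderiv ℝ (es k) (Hm (Ut U t) x)) (Hm F x)
        exact this.trans (by gcongr)
      set w := (k:ℝ) * (sg k (Ut U s) x * (Ut U s x)⁻¹) - k * (sg k (Ut U t) x * (Ut U t x)⁻¹) with hw
      set l := eD k (Hm (Ut U s) x) (Hm F x) - eD k (Hm (Ut U t) x) (Hm F x) with hl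
      have e : BB k (Ut U t) F x - BB k (Ut U s) F x = - (w * F x) + l := by rw [BB, BB, LL, LL, hw, hl]; ring
      have t1 : (w * F x)^2 ≤ d^2 * F x ^ 2 := by rw [mul_pow]; gcongr ?_ * _; rw [← sq_abs]; gcongr
      have t2 : l^2 ≤ d^2 * ‖Hm F x‖^2 := by rw [← mul_pow, ← sq_abs l]; gcongr
      rw [e]
      nlinarith [sq_nonneg (w * F x + l)]
  obtain ⟨N, hN⟩ := exists_nat_one_div_lt hδ
  have hN0 : (0:ℝ) < (N:ℝ) + 1 := by positivity
  have ind : ∀ j : ℕ, j ≤ N + 1 → DD k (Ut U ((j:ℝ) / (N + 1))) := by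
    intro j
    induction j with
    | zero =>
      intro _
      have : Ut U (((0:ℕ):ℝ) / (N + 1)) = fun y => ‖y‖ := by ext y; simp [Ut]
      rw [this]; exact DD0 (by omega) hk
    | succ j ih =>
      intro hj
      have hmem : ∀ i : ℕ, i ≤ N + 1 → (i:ℝ) / (N + 1) ∈ Set.Icc (0:ℝ) 1 := fun i hi =>
        ⟨by positivity, by rw [div_le_one hN0]; exact_mod_cast hi⟩
      refine main _ (hmem j (by omega)) _ (hmem (j+1) hj) ?_ (ih (by omega))
      have : (j:ℝ) / (N + 1) - ((j+1:ℕ):ℝ) / (N + 1) = - (1 / (N + 1)) := by push_cast; field_simp; ring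
      rw [this, abs_neg, abs_of_pos (by positivity)]; exact hN
  have h := ind (N+1) le_rfl
  have e : Ut U (((N+1:ℕ):ℝ) / (N + 1)) = U := by
    ext y; rw [Ut]; push_cast; rw [div_self hN0.ne']; ring
  rw [e] at h
  exact h.af hk2 hk hU
theorem int_pos {q : Eu n → ℝ} (hq : ContinuousOn q (sph n)) (h : ∀ x ∈ sph n, 0 < q x) : 0 < ∫ x, q x ∂(mu n) := by
  obtain ⟨c, hc, hc1⟩ := pos_min (sph_compact n) hq h
  have hS := sphVol_pos n
  rw [sphVol_eq] at hS
  have : c * ∫ _, (1:ℝ) ∂(mu n) ≤ ∫ x, q x ∂(mu n) := by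
    rw [← integral_const_mul]
    exact int_mono (by fun_prop) hq fun x hx => by linarith [hc1 x hx]
  exact lt_of_lt_of_le (by positivity) this
theorem VV_pos {k : ℕ} (hk : k ≤ n) {U : Eu n → ℝ} (hU : Gd U) : 0 < VV k U :=
  int_pos (hU.sm.cont.mul (sg_sm k hU.sm).cont) fun _ hx => mul_pos (hU.pos _ (sph_ne hx)) (hU.sgpos hk hx)
theorem quad {k : ℕ} {U F : Eu n → ℝ} (hU : Hg U) (hF : Hg F) (t : ℝ) :
    ∫ x, (F x + t * U x) * LL k U (fun y => F y + t * U y) x ∂(mu n) =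
      ∫ x, F x * LL k U F x ∂(mu n) + 2 * t * k * ∫ x, F x * sg k U x ∂(mu n) + t^2 * k * VV k U := by
  have cU := hU.sm.cont
  have cF := hF.sm.cont
  have cL := (LL_sm k hU.sm hF.sm).cont
  have csg := (sg_sm k hU.sm).cont
  have h1 : ∫ x, U x * LL k U F x ∂(mu n) = k * ∫ x, F x * sg k U x ∂(mu n) := by
    rw [F1 k hU hF hU, ← integral_const_mul]
    exact int_congr fun x _ => by rw [LL_self]; ring
  rw [int_congr (h := fun x => F x * LL k U F x + t * k * (F x * sg k U x) + t * (U x * LL k U F x) + t^2 * k * (U x * sg k U x))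
    fun x hx => by rw [LL_add k hF.sm hU.sm t (sph_ne hx), LL_self]; ring]
  rw [iadd (by fun_prop) (by fun_prop), iadd (by fun_prop) (by fun_prop), iadd (by fun_prop) (by fun_prop), integral_const_mul, integral_const_mul,
    integral_const_mul, h1, VV]
  ring
theorem af1 (hn : 2 ≤ n) {U : Eu n → ℝ} (hU : Gd U) : AF 1 U := by
  have h2 := af2 le_rfl hn (Gd.nrm n)
  obtain ⟨c, hc⟩ := eD_nrm (n := n) (k := 2) (by norm_num) (by omega)
  have hsg : ∀ x ∈ sph n, sg 2 (fun y : Eu n => ‖y‖) x = c * n / 2 := by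
    intro x hx
    have h := LL_self 2 (fun y : Eu n => ‖y‖) x
    rw [LL, hc x hx _ ((Hg.nrm n).kx hx)] at h
    have : tr (Hm (fun y : Eu n => ‖y‖) x) = n := by simp [tr, Hm_nrm hx, sum_sq_sph hx]
    rw [this] at h; push_cast at h; linarith
  have hcp : 0 < c := by
    have hx : (EuclideanSpace.single 0 1 : Eu n) ∈ sph n := by simp [mem_sph]
    have := (Gd.nrm n).sgpos hn hx
    rw [hsg _ hx] at this
    by_contra h
    have : c * n ≤ 0 := mul_nonpos_of_nonpos_of_nonneg (not_lt.1 h) (by positivity)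
    linarith
  have key : ∀ F, Hg F → ∫ x, F x ∂(mu n) = 0 → ∫ x, F x * LL 1 U F x ∂(mu n) ≤ 0 := by
    intro F hF h0
    have := h2 F hF (by
      rw [int_congr (h := fun x => c * n / 2 * F x) fun x hx => by rw [hsg x hx]; ring, integral_const_mul, h0, mul_zero])
    rw [int_congr (h := fun x => c * (F x * LL 1 U F x)) fun x hx => by
      rw [LL, hc x hx _ (hF.kx hx), LL, eD_one]; ring, integral_const_mul] at this
    by_contra h
    have := mul_pos hcp (not_le.1 h)
    linarith
  intro F hF h0
  have hUp : 0 < ∫ x, U x ∂(mu n) := int_pos hU.sm.cont fun x hx => hU.pos x (sph_ne hx)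
  set t := - (∫ x, F x ∂(mu n)) / ∫ x, U x ∂(mu n) with ht
  have cU := hU.sm.cont
  have cF := hF.sm.cont
  have := key _ (hF.add (hU.toHg.cmul t)) (by
    rw [iadd (by fun_prop) (by fun_prop), integral_const_mul, ht, div_mul_cancel₀ _ hUp.ne']; ring)
  rw [quad hU.toHg hF, h0] at this
  have := mul_nonneg (sq_nonneg t) (VV_pos (by omega : 1 ≤ n) hU).le
  push_cast at *
  linarith
theorem aff {k : ℕ} (hn : 2 ≤ n) (hk1 : 1 ≤ k) (hk : k ≤ n) {U F : Eu n → ℝ} (hU : Gd U) (hF : Hg F) :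
    (∫ x, F x * LL k U F x ∂(mu n)) * VV k U ≤ k * (∫ x, F x * sg k U x ∂(mu n))^2 := by
  have hA : AF k U := by
    rcases hk1.eq_or_lt with rfl | h
    · exact af1 hn hU
    · exact af2 h hk hU
  have hV := VV_pos hk hU
  set t := - (∫ x, F x * sg k U x ∂(mu n)) / VV k U with ht
  have htV : t * VV k U = - ∫ x, F x * sg k U x ∂(mu n) := by rw [ht, div_mul_cancel₀ _ hV.ne']
  have cU := hU.sm.cont
  have cF := hF.sm.cont
  have csg := (sg_sm k hU.sm).cont
  have := hA _ (hF.add (hU.toHg.cmul t)) (by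
    rw [int_congr (h := fun x => F x * sg k U x + t * (U x * sg k U x)) fun x _ => by ring, iadd (by fun_prop) (by fun_prop),
      integral_const_mul]
    change _ + t * VV k U = 0
    rw [htV]; ring)
  rw [quad hU.toHg hF] at this
  have h3 := mul_le_mul_of_nonneg_right this hV.le
  have e : (∫ x, F x * LL k U F x ∂(mu n) + 2 * t * k * ∫ x, F x * sg k U x ∂(mu n) + t^2 * k * VV k U) * VV k U
    = (∫ x, F x * LL k U F x ∂(mu n)) * VV k U + 2 * k * (t * VV k U) * (∫ x, F x * sg k U x ∂(mu n)) + k * (t * VV k U)^2 := by ring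
  rw [e, htV] at h3
  linarith
def ww {n : ℕ} (k : ℕ) (U : Eu n → ℝ) : ℝ := Real.exp (Real.log (VV k U) / (k + 1))
theorem mink {k : ℕ} (hn : 2 ≤ n) (hk1 : 1 ≤ k) (hk : k ≤ n) {U V : Eu n → ℝ} (hU : Gd U) (hV : Gd V) :
    ww k V * VV k U ≤ ww k U * ∫ x, V x * sg k U x ∂(mu n) := by
  have hF : Hg (fun y => V y + (-1) * U y) := hV.toHg.add (hU.toHg.cmul (-1))
  set F : Eu n → ℝ := fun y => V y + (-1) * U y with hFd
  have hG : ∀ s ∈ Set.Icc (0:ℝ) 1, Gd (fun y => U y + s * F y) := fun s hs => by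
    have := hU.comb hV (a := 1 - s) (b := s) (by linarith [hs.2]) hs.1 (by linarith)
    convert this using 2 with y
    rw [hFd]; ring
  set P : ℝ → ℝ := fun s => VV k (fun y => U y + s * F y) with hP
  set J : ℝ → ℝ := fun s => ∫ x, F x * sg k (fun y => U y + s * F y) x ∂(mu n) with hJ
  set Q : ℝ → ℝ := fun s => ∫ x, F x * LL k (fun y => U y + s * F y) F x ∂(mu n) with hQ
  have hPp : ∀ s ∈ Set.Icc (0:ℝ) 1, 0 < P s := fun s hs => VV_pos hk (hG s hs)
  have dP : ∀ s, HasDerivAt P ((k + 1) * J s) s := fun s => V_deriv k hU.toHg hF s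
  have dJ : ∀ s, HasDerivAt J (Q s) s := fun s => V_deriv2 k hU.toHg hF hF.sm.cont s
  have hk0 : (0:ℝ) < k + 1 := by positivity
  set h : ℝ → ℝ := fun s => Real.exp (Real.log (P s) / (k + 1)) with hh
  have dh : ∀ s ∈ Set.Icc (0:ℝ) 1, HasDerivAt h (h s * (J s / P s)) s := fun s hs => by
    have := (((dP s).log (hPp s hs).ne').div_const ((k:ℝ) + 1)).exp
    have e : Real.exp (Real.log (P s) / (k + 1)) * ((k + 1) * J s / P s / (k + 1)) = h s * (J s / P s) := by
      rw [hh]; field_simp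
    rwa [e] at this
  have dq : ∀ s ∈ Set.Icc (0:ℝ) 1, HasDerivAt (fun s => h s * (J s / P s)) (h s * (Q s * P s - k * J s ^ 2) / P s ^ 2) s := fun s hs => by
    have := (dh s hs).mul ((dJ s).div (dP s) (hPp s hs).ne')
    have e : h s * (J s / P s) * (J s / P s) + h s * ((Q s * P s - J s * ((k + 1) * J s)) / P s ^ 2) = h s * (Q s * P s - k * J s ^ 2) / P s ^ 2 := by
      have := (hPp s hs).ne'
      field_simp; ring
    rw [← e]; exact this
  have anti : AntitoneOn (fun s => h s * (J s / P s)) (Set.Icc (0:ℝ) 1) := by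
    refine antitoneOn_of_deriv_nonpos (convex_Icc 0 1) (fun s hs => (dq s hs).continuousAt.continuousWithinAt)
      (fun s hs => (dq s (interior_subset hs)).differentiableAt.differentiableWithinAt) fun s hs => ?_
    rw [(dq s (interior_subset hs)).deriv]
    have := aff hn hk1 hk (hG s (interior_subset hs)) hF
    refine div_nonpos_of_nonpos_of_nonneg (mul_nonpos_of_nonneg_of_nonpos (Real.exp_pos _).le ?_) (sq_nonneg _)
    exact sub_nonpos.2 this
  obtain ⟨ξ, hξ, he⟩ := exists_hasDerivAt_eq_slope h (fun s => h s * (J s / P s)) zero_lt_one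
    (fun s hs => (dh s hs).continuousAt.continuousWithinAt) (fun s hs => dh s (Set.Ioo_subset_Icc_self hs))
  have := anti ⟨le_rfl, zero_le_one⟩ (Set.Ioo_subset_Icc_self hξ) hξ.1.le
  simp only [sub_zero, div_one] at he this
  rw [he] at this
  have e0 : (fun y => U y + 0 * F y) = U := by ext y; ring
  have e1 : (fun y => U y + 1 * F y) = V := by ext y; rw [hFd]; ring
  have p0 : P 0 = VV k U := by rw [hP]; simp only [e0]
  have h0 : h 0 = ww k U := by rw [hh]; simp only [p0]; rfl
  have h1 : h 1 = ww k V := by rw [hh, hP]; simp only [e1]; rfl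
  have j0 : J 0 = ∫ x, V x * sg k U x ∂(mu n) - VV k U := by
    have cU := hU.sm.cont
    have cV := hV.sm.cont
    have csg := (sg_sm k hU.sm).cont
    rw [hJ]; simp only [e0]
    rw [VV, ← isub (by fun_prop) (by fun_prop)]
    exact int_congr fun x _ => by rw [hFd]; ring
  rw [h0, h1, p0, j0] at this
  have hVp := VV_pos hk hU
  have := mul_le_mul_of_nonneg_right this hVp.le
  have e : ww k U * ((∫ x, V x * sg k U x ∂(mu n) - VV k U) / VV k U) * VV k U = ww k U * (∫ x, V x * sg k U x ∂(mu n)) - ww k U * VV k U := by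
    field_simp
  rw [e] at this
  linarith
theorem pd_scale {F : Eu n → ℝ} (h : Sm F) (i : Fin (n+1)) {r : ℝ} (hr : r ≠ 0) {y : Eu n} (hy : y ≠ 0) :
    pd i (fun y => F (r • y)) y = r * pd i F (r • y) := by
  have h1 : HasFDerivAt (fun y : Eu n => r • y) (r • ContinuousLinearMap.id ℝ (Eu n)) y := (hasFDerivAt_id y).const_smul r
  have := (h.diff (smul_ne_zero hr hy)).hasFDerivAt.comp y h1
  rw [pd, HasFDerivAt.fderiv (f := fun y => F (r • y)) this]
  simp [pd]
theorem Hg.hm_scale {F : Eu n → ℝ} (h : Hg F) {r : ℝ} (hr : 0 < r) {y : Eu n} (hy : y ≠ 0) (i j : Fin (n+1)) :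
    Hm F y i j = r * Hm F (r • y) i j := by
  have h1 : ∀ y ≠ 0, pd j F (r • y) = pd j F y := fun y hy => by
    have := pd_congr (fun y hy => h.hom r hr y hy) j hy
    rw [pd_scale h.sm j hr.ne' hy, pd_cmul j r h.sm hy] at this
    exact mul_left_cancel₀ hr.ne' this
  have h2 := pd_congr h1 i hy
  rw [pd_scale (h.sm.pd j) i hr.ne' hy] at h2
  exact h2.symm
theorem PT.nn {x : Eu n} (hx : x ∈ sph n) {A : Mt (n+1)} (hA : PT x A) (v : Fin (n+1) → ℝ) : 0 ≤ qf A v := by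
  set c := ∑ i, v i * x i with hc
  have hxx := sum_sq_sph hx
  have hperp : ∑ i, (v i - c * x i) * x i = 0 := by
    simp only [sub_mul, Finset.sum_sub_distrib, mul_assoc, ← Finset.mul_sum, hxx]; rw [← hc]; ring
  have e : qf A (fun i => v i - c * x i) = qf A v := by
    have k1 : ∀ i, ∑ j, v i * A i j * x j = 0 := fun i => by simp only [mul_assoc, ← Finset.mul_sum, hA.ker, mul_zero]
    have k2 : ∀ j, ∑ i, x i * A i j = 0 := fun j => by rw [← hA.ker j]; exact Finset.sum_congr rfl fun i _ => by rw [hA.symm i j]; ring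
    have : ∀ i j, (v i - c * x i) * A i j * (v j - c * x j) = v i * A i j * v j - c * (v i * A i j * x j) - c * (v j - c * x j) * (x i * A i j) := by
      intro i j; ring
    simp only [qf, this, Finset.sum_sub_distrib]
    rw [Finset.sum_comm (f := fun i j => c * (v j - c * x j) * (x i * A i j))]
    simp only [← Finset.mul_sum, k1, k2]; simp
  rw [← e]
  by_cases h0 : (fun i => v i - c * x i) = 0
  · rw [h0]; simp [qf]
  · exact (hA.pos _ hperp h0).le
theorem Gd.hn {U : Eu n → ℝ} (hU : Gd U) {z : Eu n} (hz : z ≠ 0) (v : Fin (n+1) → ℝ) : 0 ≤ qf (Hm U z) v := by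
  have hp := norm_pos_iff.2 hz
  have hx : ‖z‖⁻¹ • z ∈ sph n := by rw [mem_sph, norm_smul, norm_inv, norm_norm, inv_mul_cancel₀ hp.ne']
  have : Hm U z = ‖z‖⁻¹ • Hm U (‖z‖⁻¹ • z) := by
    ext i j; exact hU.toHg.hm_scale (inv_pos.2 hp) hz i j
  rw [this, qf_smul]
  exact mul_nonneg (inv_pos.2 hp).le ((hU.cvx _ hx).nn hx v)
theorem Gd.supp {U : Eu n → ℝ} (hU : Gd U) {x y : Eu n} (hx : x ≠ 0) (hy : y ≠ 0) : fderiv ℝ U x y ≤ U y := by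
  have heu : fderiv ℝ U x x = U x := by rw [fderiv_pd]; exact hU.toHg.euler hx
  by_cases hz : ∀ s ∈ Set.Icc (0:ℝ) 1, x + s • (y - x) ≠ 0
  · have d1 : ∀ s ∈ Set.Icc (0:ℝ) 1, _ := fun s hs => line_d hU.sm x (y - x) (hz s hs)
    have d2 : ∀ s ∈ Set.Icc (0:ℝ) 1, _ := fun s hs => line_d2 hU.sm x (y - x) (hz s hs)
    have mono : MonotoneOn (fun s : ℝ => ∑ i, (y - x) i * pd i U (x + s • (y - x))) (Set.Icc 0 1) := by
      refine monotoneOn_of_deriv_nonneg (convex_Icc 0 1) (fun s hs => (d2 s hs).continuousAt.continuousWithinAt)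
        (fun s hs => (d2 s (interior_subset hs)).differentiableAt.differentiableWithinAt) fun s hs => ?_
      rw [(d2 s (interior_subset hs)).deriv]
      exact hU.hn (hz s (interior_subset hs)) _
    obtain ⟨ξ, hξ, he⟩ := exists_hasDerivAt_eq_slope _ _ zero_lt_one
      (fun s hs => (d1 s hs).continuousAt.continuousWithinAt) (fun s hs => d1 s (Set.Ioo_subset_Icc_self hs))
    have h1 := mono ⟨le_rfl, zero_le_one⟩ (Set.Ioo_subset_Icc_self hξ) hξ.1.le
    simp only at h1
    rw [he, zero_smul, add_zero, ← fderiv_pd, map_sub, heu] at h1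
    simp at h1
    linarith
  · push Not at hz
    obtain ⟨s, hs, h0⟩ := hz
    have h1 := congrArg (fderiv ℝ U x) h0
    rw [map_add, map_smul, map_sub, heu, map_zero, smul_eq_mul] at h1
    have hUx := hU.pos x hx
    have hUy := hU.pos y hy
    rcases hs.1.eq_or_lt with h | h
    · rw [← h] at h1; linarith
    · by_contra hc
      nlinarith [hs.2]
theorem Gd.subadd {U : Eu n → ℝ} (hU : Gd U) (h0 : U 0 = 0) (x y : Eu n) : U (x + y) ≤ U x + U y := by
  by_cases hx : x = 0
  · rw [hx, zero_add, h0, zero_add]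
  by_cases hy : y = 0
  · rw [hy, add_zero, h0, add_zero]
  by_cases hs : x + y = 0
  · rw [hs, h0]; linarith [hU.pos x hx, hU.pos y hy]
  have := hU.toHg.euler hs
  rw [← this, ← fderiv_pd, map_add]
  linarith [hU.supp hs hx, hU.supp hs hy]
def bd {n : ℕ} (U : Eu n → ℝ) : ℝ := ∑ i, (U (bv i) + U (-bv i))
theorem Gd.bound {U : Eu n → ℝ} (hU : Gd U) (h0 : U 0 = 0) (x : Eu n) : U x ≤ bd U * ‖x‖ := by
  have hbn : ∀ i : Fin (n+1), (bv i : Eu n) ≠ 0 := fun i h => by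
    have := congrFun (congrArg WithLp.ofLp h) i; simp [bv] at this
  have e : x = ∑ i, x i • bv i := by
    ext j; simp [bv, Finset.sum_apply, Pi.single_apply]
  have h1 : U x ≤ ∑ i, U (x i • bv i) := by
    conv_lhs => rw [e]
    exact Finset.le_sum_of_subadditive U h0.le (hU.subadd h0) _ _
  refine h1.trans ?_
  rw [bd, Finset.sum_mul]
  refine Finset.sum_le_sum fun i _ => ?_
  have p1 := hU.pos _ (hbn i)
  have p2 := hU.pos _ (neg_ne_zero.2 (hbn i))
  have hle : |x i| ≤ ‖x‖ := by simpa using PiLp.norm_apply_le x i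
  rcases lt_trichotomy (x i) 0 with h | h | h
  · have : x i • (bv i : Eu n) = (-(x i)) • (-bv i) := by simp
    rw [this, hU.hom _ (neg_pos.2 h) _ (neg_ne_zero.2 (hbn i))]
    rw [abs_of_neg h] at hle; nlinarith
  · rw [h, zero_smul, h0]; positivity
  · rw [hU.hom _ h _ (hbn i)]
    rw [abs_of_pos h] at hle; nlinarith
theorem Gd.lip {U : Eu n → ℝ} (hU : Gd U) (h0 : U 0 = 0) (x y : Eu n) : |U x - U y| ≤ bd U * ‖x - y‖ := by
  have key : ∀ x y : Eu n, U x - U y ≤ bd U * ‖x - y‖ := fun x y => by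
    have h1 := hU.subadd h0 (x - y) y
    rw [sub_add_cancel] at h1
    linarith [hU.bound h0 (x - y)]
  rw [abs_le]; constructor
  · have := key y x; rw [norm_sub_rev] at this; linarith
  · exact key x y
theorem es_mono {k : ℕ} (hk : k ≤ n) {x : Eu n} (hx : x ∈ sph n) {A N : Mt (n+1)} (hA : PT x A) (hN : Kx x N) (h : ∀ v, 0 ≤ qf N v) :
    es k A ≤ es k (A + N) := by
  have hP : ∀ s : ℝ, 0 ≤ s → PT x (A + s • N) := fun s hs =>
    ⟨hA.toKx.add (hN.smul s), fun v hv hv0 => by rw [qf_add, qf_smul]; have := hA.pos v hv hv0; have := mul_nonneg hs (h v); linarith⟩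
  have mono : MonotoneOn (fun s : ℝ => es k (A + s • N)) (Set.Ici 0) := by
    refine monotoneOn_of_deriv_nonneg (convex_Ici 0) (fun s hs => (es_line k A N s).continuousAt.continuousWithinAt)
      (fun s hs => (es_line k A N s).differentiableAt.differentiableWithinAt) fun s hs => ?_
    rw [(es_line k A N s).deriv]
    exact E2 hk hx (hP s (interior_subset hs)) hN h
  have := mono (Set.self_mem_Ici) (Set.mem_Ici.2 zero_le_one) zero_le_one
  simpa using this
theorem sg_comp {k : ℕ} (hk : k ≤ n) {U V : Eu n → ℝ} (hU : Gd U) (hV : Gd V) {c : ℝ} (h : ∀ y ∈ sph n, U y ≤ c * V y)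
    {x : Eu n} (hx : x ∈ sph n) (he : U x = c * V x) : sg k U x ≤ c^k * sg k V x := by
  have hF : Hg (fun y => c * V y + (-1) * U y) := (hV.toHg.cmul c).add (hU.toHg.cmul (-1))
  have h1 := es_mono hk hx (hU.cvx x hx) (hF.kx hx) (hF.touch (fun y hy => by linarith [h y hy]) hx (by rw [he]; ring))
  have e : Hm U x + Hm (fun y => c * V y + (-1) * U y) x = c • Hm V x := by
    rw [Hm_line (hV.sm.cmul c) hU.sm (sph_ne hx), Hm_cmul c hV.sm (sph_ne hx)]; module
  rw [e, es_smul] at h1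
  exact h1
theorem max0 {φ : ℝ → ℝ} {d h0 : ℝ} (hh : 0 < h0) (hd : HasDerivWithinAt φ d (Set.Icc 0 h0) 0) (hm : ∀ h ∈ Set.Icc 0 h0, φ h ≤ φ 0) : d ≤ 0 := by
  have ht := hasDerivWithinAt_iff_tendsto_slope.1 (hd.mono Set.Ioc_subset_Icc_self)
  rw [Set.sdiff_singleton_eq_self (by simp)] at ht
  haveI : (𝓝[Set.Ioc 0 h0] (0:ℝ)).NeBot := by
    rw [nhdsWithin_Ioc_eq_nhdsGT hh]; infer_instance
  refine le_of_tendsto ht ?_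
  filter_upwards [self_mem_nhdsWithin] with h hm'
  rw [slope_def_field, sub_zero]
  exact div_nonpos_of_nonpos_of_nonneg (sub_nonpos.2 (hm h (Set.Ioc_subset_Icc_self hm'))) hm'.1.le
theorem prim {a : ℝ → ℝ} {b : ℝ} (hb : 0 ≤ b) (ha : ContinuousOn a (Set.Icc 0 b)) :
    ∃ τ : ℝ → ℝ, ∀ t ∈ Set.Icc 0 b, HasDerivWithinAt τ (a t) (Set.Icc 0 b) t := by
  have hc : Continuous (Set.IccExtend hb ((Set.Icc 0 b).restrict a)) := (continuousOn_iff_continuous_restrict.1 ha).Icc_extend'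
  refine ⟨fun u => ∫ x in (0:ℝ)..u, Set.IccExtend hb ((Set.Icc 0 b).restrict a) x, fun t ht => ?_⟩
  have := (hc.integral_hasStrictDerivAt 0 t).hasDerivAt.hasDerivWithinAt (s := Set.Icc 0 b)
  rwa [Set.IccExtend_of_mem _ _ ht] at this
theorem compare {b K : ℝ} (hb : 0 < b) {L g : ℝ → Eu n → ℝ} {e a : ℝ → ℝ}
    (cL : ContinuousOn (fun p : ℝ × Eu n => L p.1 p.2) (Set.Icc 0 b ×ˢ sph n))
    (dL : ∀ x ∈ sph n, ∀ t ∈ Set.Icc 0 b, HasDerivWithinAt (fun r => L r x) (g t x - e t) (Set.Icc 0 b) t)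
    (ca : ContinuousOn a (Set.Icc 0 b)) (pa : ∀ t ∈ Set.Icc 0 b, 0 < a t) (pg : ∀ t ∈ Set.Icc 0 b, ∀ x ∈ sph n, 0 < g t x)
    (hK : ∀ x ∈ sph n, a 0 * g 0 x < K)
    (hmax : ∀ s ∈ Set.Icc 0 b, ∀ r ∈ Set.Icc 0 b, ∀ x ∈ sph n, (∀ z ∈ sph n, L r z - L s z ≤ L r x - L s x) → a r * g r x ≤ a s * g s x)
    (hmin : ∀ s ∈ Set.Icc 0 b, ∀ r ∈ Set.Icc 0 b, ∀ x ∈ sph n, (∀ z ∈ sph n, L r x - L s x ≤ L r z - L s z) → a s * g s x ≤ a r * g r x) :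
    ∀ s ∈ Set.Ico 0 b, ∀ x ∈ sph n, ∀ y ∈ sph n, g s x - g s y ≤ K * (a s)⁻¹ := by
  obtain ⟨τ, hτ⟩ : ∃ τ : ℝ → ℝ, ∀ t ∈ Set.Icc 0 b, HasDerivWithinAt τ ((a t)⁻¹) (Set.Icc 0 b) t := prim hb.le (ca.inv₀ fun t ht => (pa t ht).ne')
  have cτ : ContinuousOn τ (Set.Icc 0 b) := fun t ht => (hτ t ht).continuousWithinAt
  have sh : ∀ (P : ℝ → ℝ) (d t v h0 : ℝ), 0 ≤ h0 → (∀ h ∈ Set.Icc 0 h0, t + h * v ∈ Set.Icc 0 b) → HasDerivWithinAt P d (Set.Icc 0 b) t →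
      HasDerivWithinAt (fun h => P (t + h * v)) (d * v) (Set.Icc 0 h0) 0 := by
    intro P d t v h0 hh0 hmap hd
    have h1 : HasDerivWithinAt (fun h : ℝ => t + h * v) v (Set.Icc 0 h0) 0 := by
      simpa using (((hasDerivAt_id (0:ℝ)).mul_const v).const_add t).hasDerivWithinAt
    have hd' : HasDerivWithinAt P d (Set.Icc 0 b) (t + 0 * v) := by simpa using hd
    exact hd'.comp (0:ℝ) h1 hmap
  have main : ∀ ε > 0, ∀ s r, 0 ≤ s → s ≤ r → r ≤ b → ∀ x ∈ sph n, ∀ y ∈ sph n,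
      (L r x - L s x) - (L r y - L s y) - K * (τ r - τ s) - ε * s ≤ 0 := by
    intro ε hε
    let D : Set (ℝ × ℝ) := (Set.Icc 0 b ×ˢ Set.Icc 0 b) ∩ {p | p.1 ≤ p.2}
    have hD : IsCompact D := (isCompact_Icc.prod isCompact_Icc).inter_right (isClosed_le continuous_fst continuous_snd)
    let G : (ℝ × ℝ) × (Eu n × Eu n) → ℝ := fun q => (L q.1.2 q.2.1 - L q.1.1 q.2.1) - (L q.1.2 q.2.2 - L q.1.1 q.2.2) - K * (τ q.1.2 - τ q.1.1) - ε * q.1.1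
    let Z : Set ((ℝ × ℝ) × (Eu n × Eu n)) := D ×ˢ (sph n ×ˢ sph n)
    have hZ : IsCompact Z := hD.prod ((sph_compact n).prod (sph_compact n))
    have cLL : ∀ (i : (ℝ × ℝ) × (Eu n × Eu n) → ℝ) (j : (ℝ × ℝ) × (Eu n × Eu n) → Eu n), Continuous i → Continuous j →
        (∀ q ∈ Z, i q ∈ Set.Icc 0 b ∧ j q ∈ sph n) → ContinuousOn (fun q => L (i q) (j q)) Z := fun i j hi hj hm =>
      cL.comp (hi.prodMk hj).continuousOn hm
    have cG : ContinuousOn G Z := by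
      refine ContinuousOn.sub (ContinuousOn.sub (ContinuousOn.sub (ContinuousOn.sub ?_ ?_) (ContinuousOn.sub ?_ ?_)) (ContinuousOn.mul continuousOn_const (ContinuousOn.sub ?_ ?_))) (by fun_prop)
      · exact cLL _ _ (by fun_prop) (by fun_prop) fun q hq => ⟨hq.1.1.2, hq.2.1⟩
      · exact cLL _ _ (by fun_prop) (by fun_prop) fun q hq => ⟨hq.1.1.1, hq.2.1⟩
      · exact cLL _ _ (by fun_prop) (by fun_prop) fun q hq => ⟨hq.1.1.2, hq.2.2⟩
      · exact cLL _ _ (by fun_prop) (by fun_prop) fun q hq => ⟨hq.1.1.1, hq.2.2⟩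
      · exact cτ.comp (by fun_prop) fun q hq => hq.1.1.2
      · exact cτ.comp (by fun_prop) fun q hq => hq.1.1.1
    intro s1 r1 hs1 hsr1 hr1 x1 hx1 y1 hy1
    have hm1 : ((s1, r1), (x1, y1)) ∈ Z := ⟨⟨⟨⟨hs1, hsr1.trans hr1⟩, ⟨hs1.trans hsr1, hr1⟩⟩, hsr1⟩, hx1, hy1⟩
    obtain ⟨⟨⟨s, r⟩, ⟨x, y⟩⟩, ⟨⟨⟨hs, hr⟩, hsr⟩, hx, hy⟩, hq⟩ := hZ.exists_isMaxOn ⟨_, hm1⟩ cG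
    change s ∈ Set.Icc 0 b at hs
    change r ∈ Set.Icc 0 b at hr
    change s ≤ r at hsr
    change x ∈ sph n at hx
    change y ∈ sph n at hy
    have hq' : ∀ s' r', 0 ≤ s' → s' ≤ r' → r' ≤ b → ∀ x' ∈ sph n, ∀ y' ∈ sph n,
      (L r' x' - L s' x') - (L r' y' - L s' y') - K * (τ r' - τ s') - ε * s' ≤ (L r x - L s x) - (L r y - L s y) - K * (τ r - τ s) - ε * s :=
      fun s' r' h1 h2 h3 x' hx' y' hy' => hq (show ((s', r'), (x', y')) ∈ Z from ⟨⟨⟨⟨h1, h2.trans h3⟩, ⟨h1.trans h2, h3⟩⟩, h2⟩, hx', hy'⟩)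
    refine (hq' s1 r1 hs1 hsr1 hr1 x1 hx1 y1 hy1).trans ?_
    rcases hsr.eq_or_lt with h | h
    · rw [h]; have := mul_nonneg hε.le hr.1; linarith
    exfalso
    have mx := hmax s hs r hr x hx fun z hz => by have := hq' s r hs.1 hsr hr.2 z hz y hy; linarith
    have mn := hmin s hs r hr y hy fun z hz => by have := hq' s r hs.1 hsr hr.2 x hx z hz; linarith
    have par := pa r hr
    have pas := pa s hs
    rcases hs.1.eq_or_lt with h0 | h0
    · have hrp : 0 < r := by linarith
      have hmap : ∀ h ∈ Set.Icc 0 r, r + h * (-1) ∈ Set.Icc 0 b := fun h hh => ⟨by linarith [hh.2], by linarith [hh.1, hr.2]⟩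
      have d := (((sh _ _ r (-1) r hrp.le hmap (dL x hx r hr)).sub (sh _ _ r (-1) r hrp.le hmap (dL y hy r hr))).sub
        ((sh _ _ r (-1) r hrp.le hmap (hτ r hr)).const_mul K))
      have := max0 hrp d fun h hh => by
        have := hq' s (r + h * (-1)) hs.1 (by rw [← h0]; exact (hmap h hh).1) (hmap h hh).2 x hx y hy
        simp only [Pi.sub_apply, zero_mul, add_zero]
        linarith
      have h2 : a r * (K * ((a r)⁻¹)) = K := by field_simp
      have h3 : K ≤ a r * (g r x - g r y) := by
        rw [← h2]; exact mul_le_mul_of_nonneg_left (by linarith) par.le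
      have h4 := hK x hx
      rw [← h0] at mx
      have := mul_pos par (pg r hr y hy)
      linarith
    · obtain ⟨h0', hh0, hA, hB⟩ : ∃ h0' > 0, h0' * a s ≤ s ∧ h0' * a r ≤ r - s := by
        refine ⟨min (s / a s) ((r - s) / a r), lt_min (div_pos h0 pas) (div_pos (by linarith) par), ?_, ?_⟩
        · rw [← le_div_iff₀ pas]; exact min_le_left _ _
        · rw [← le_div_iff₀ par]; exact min_le_right _ _
      have e1 : ∀ h ∈ Set.Icc 0 h0', 0 ≤ h * a s ∧ h * a s ≤ s ∧ 0 ≤ h * a r ∧ h * a r ≤ r - s := fun h hh =>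
        ⟨mul_nonneg hh.1 pas.le, (mul_le_mul_of_nonneg_right hh.2 pas.le).trans hA, mul_nonneg hh.1 par.le, (mul_le_mul_of_nonneg_right hh.2 par.le).trans hB⟩
      have ms : ∀ h ∈ Set.Icc 0 h0', s + h * (-a s) ∈ Set.Icc 0 b := fun h hh => ⟨by linarith [(e1 h hh).2.1], by linarith [(e1 h hh).1, hs.2]⟩
      have mr : ∀ h ∈ Set.Icc 0 h0', r + h * (-a r) ∈ Set.Icc 0 b := fun h hh => ⟨by linarith [(e1 h hh).2.2.2], by linarith [(e1 h hh).2.2.1, hr.2]⟩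
      have hh := hh0.le
      have d := ((((sh _ _ r (-a r) h0' hh mr (dL x hx r hr)).sub (sh _ _ s (-a s) h0' hh ms (dL x hx s hs))).sub
        ((sh _ _ r (-a r) h0' hh mr (dL y hy r hr)).sub (sh _ _ s (-a s) h0' hh ms (dL y hy s hs)))).sub
        (((sh _ _ r (-a r) h0' hh mr (hτ r hr)).sub (sh _ _ s (-a s) h0' hh ms (hτ s hs))).const_mul K)).sub
        ((sh _ _ s (-a s) h0' hh ms (hasDerivWithinAt_id s _)).const_mul ε)
      have := max0 hh0 d fun h hh => by
        have := hq' (s + h * (-a s)) (r + h * (-a r)) (ms h hh).1 (by obtain ⟨h1, h2, h3, h4⟩ := e1 h hh; linarith) (mr h hh).2 x hx y hy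
        simp only [Pi.sub_apply, zero_mul, add_zero, id]
        linarith
      have h1 : (a r)⁻¹ * (-a r) = -1 := by field_simp
      have h2 : (a s)⁻¹ * (-a s) = -1 := by field_simp
      rw [h1, h2] at this
      have := mul_pos hε pas
      linarith
  intro s hs x hx y hy
  have hs' := Set.Ico_subset_Icc_self hs
  have hpos : 0 < b - s := by linarith [hs.2]
  have hmap : ∀ h ∈ Set.Icc 0 (b - s), s + h * 1 ∈ Set.Icc 0 b := fun h hh => ⟨by linarith [hh.1, hs.1], by linarith [hh.2]⟩
  have d := (((sh _ _ s 1 (b - s) hpos.le hmap (dL x hx s hs')).sub (sh _ _ s 1 (b - s) hpos.le hmap (dL y hy s hs'))).sub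
        ((sh _ _ s 1 (b - s) hpos.le hmap (hτ s hs')).const_mul K))
  have := max0 hpos d fun h hh => by
    simp only [Pi.sub_apply, zero_mul, add_zero]
    have key : L (s + h * 1) x - L s x - (L (s + h * 1) y - L s y) - K * (τ (s + h * 1) - τ s) ≤ 0 := by
      refine le_of_forall_pos_le_add fun δ hδ => ?_
      have h1 := main (δ / (s + 1)) (div_pos hδ (by linarith [hs.1])) s (s + h * 1) hs.1 (by linarith [hh.1]) (hmap h hh).2 x hx y hy
      have h2 : δ / (s + 1) * s ≤ δ := by
        rw [div_mul_eq_mul_div, div_le_iff₀ (by linarith [hs.1])]; nlinarith [hs.1]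
      linarith
    linarith
  linarith
def gg {n : ℕ} (k : ℕ) (α β : ℝ) (f V : Eu n → ℝ) (x : Eu n) : ℝ := f x * V x ^ (α-1) * sg k V x ^ β
structure Fl {n : ℕ} (k : ℕ) (α β T : ℝ) (f : Eu n → ℝ) (U : ℝ → Eu n → ℝ) (η : ℝ → ℝ) : Prop where
  hn : 2 ≤ n
  hk1 : 1 ≤ k
  hk : k ≤ n
  hβ : 0 < β
  hb1 : 1 < k * β
  hp : α + k * β ≤ 1
  fH : Hg f
  fp : ∀ x ∈ sph n, 0 < f x
  gd : ∀ t ∈ Set.Ico 0 T, Gd (U t)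
  z : ∀ t, U t 0 = 0
  ode : ∀ x ∈ sph n, ∀ t ∈ Set.Ico 0 T, HasDerivWithinAt (fun r => U r x) (U t x * (gg k α β f (U t) x - η t)) (Set.Ico 0 T) t
  et : ∀ t ∈ Set.Ico 0 T, η t * sphVol n = ∫ x, gg k α β f (U t) x * (U t x * sg k (U t) x) ∂(mu n)
  v0 : VV k (U 0) = sphVol n
theorem Gd.p {U : Eu n → ℝ} (h : Gd U) {x : Eu n} (hx : x ∈ sph n) : 0 < U x := h.pos x (sph_ne hx)
theorem gg_pos {k : ℕ} (hk : k ≤ n) {α β : ℝ} {f V : Eu n → ℝ} (fp : ∀ x ∈ sph n, 0 < f x) (hV : Gd V) {x : Eu n} (hx : x ∈ sph n) :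
    0 < gg k α β f V x :=
  mul_pos (mul_pos (fp x hx) (Real.rpow_pos_of_pos (hV.p hx) _)) (Real.rpow_pos_of_pos (hV.sgpos hk hx) _)
theorem Gd.rc {V : Eu n → ℝ} (hV : Gd V) (e : ℝ) : ContinuousOn (fun x => V x ^ e) (sph n) :=
  hV.sm.cont.rpow_const fun _ hx => Or.inl (hV.p hx).ne'
theorem Gd.sc {k : ℕ} (hk : k ≤ n) {V : Eu n → ℝ} (hV : Gd V) (e : ℝ) : ContinuousOn (fun x => sg k V x ^ e) (sph n) :=
  (sg_sm k hV.sm).cont.rpow_const fun _ hx => Or.inl (hV.sgpos hk hx).ne'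
theorem gg_cont {k : ℕ} (hk : k ≤ n) {α β : ℝ} {f V : Eu n → ℝ} (hf : ContinuousOn f (sph n)) (hV : Gd V) :
    ContinuousOn (gg k α β f V) (sph n) := (hf.mul (hV.rc _)).mul (hV.sc hk _)
theorem gg_comp {k : ℕ} (hk : k ≤ n) {α β c : ℝ} (hβ : 0 < β) (hc : 0 < c) {f U V : Eu n → ℝ} (fp : ∀ x ∈ sph n, 0 < f x) (hU : Gd U) (hV : Gd V)
    (h : ∀ y ∈ sph n, U y ≤ c * V y) {x : Eu n} (hx : x ∈ sph n) (he : U x = c * V x) :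
    gg k α β f U x ≤ c ^ (α + k * β - 1) * gg k α β f V x := by
  have h1 := sg_comp hk hU hV h hx he
  have h2 := Real.rpow_le_rpow (hU.sgpos hk hx).le h1 hβ.le
  rw [Real.mul_rpow (pow_nonneg hc.le k) (hV.sgpos hk hx).le, ← Real.rpow_natCast, ← Real.rpow_mul hc.le] at h2
  have h3 : U x ^ (α - 1) = c ^ (α - 1) * V x ^ (α - 1) := by rw [he, Real.mul_rpow hc.le (hV.p hx).le]
  have h4 : c ^ (α + k * β - 1) = c ^ (α - 1) * c ^ (k * β) := by rw [← Real.rpow_add hc]; congr 1; ring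
  calc gg k α β f U x ≤ f x * U x ^ (α - 1) * (c ^ (k * β) * sg k V x ^ β) :=
        mul_le_mul_of_nonneg_left h2 (mul_pos (fp x hx) (Real.rpow_pos_of_pos (hU.p hx) _)).le
    _ = _ := by rw [h3, h4, gg]; ring
theorem ww_pos (k : ℕ) (U : Eu n → ℝ) : 0 < ww k U := Real.exp_pos _
theorem ww_pow {k : ℕ} (hk : k ≤ n) {U : Eu n → ℝ} (hU : Gd U) : ww k U ^ (k+1) = VV k U := by
  rw [ww, ← Real.exp_nat_mul]
  have : (k:ℝ) + 1 ≠ 0 := by positivity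
  rw [show ((k+1 : ℕ):ℝ) * (Real.log (VV k U) / (k+1)) = Real.log (VV k U) by push_cast; field_simp]
  exact Real.exp_log (VV_pos hk hU)
theorem ww_le {k : ℕ} (hn : 2 ≤ n) (hk1 : 1 ≤ k) (hk : k ≤ n) {U V : Eu n → ℝ} (hU : Gd U) (hV : Gd V) {c : ℝ} (h : ∀ y ∈ sph n, U y ≤ c * V y) :
    ww k U ≤ c * ww k V := by
  have h1 := mink hn hk1 hk hV hU
  have h2 : ∫ x, U x * sg k V x ∂(mu n) ≤ c * VV k V := by
    rw [VV, ← integral_const_mul]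
    refine int_mono (hU.sm.mul (sg_sm k hV.sm)).cont ((hV.sm.mul (sg_sm k hV.sm)).cmul c).cont fun x hx => ?_
    rw [← mul_assoc]; exact mul_le_mul_of_nonneg_right (h x hx) (hV.sgpos hk hx).le
  have h3 := h1.trans (mul_le_mul_of_nonneg_left h2 (ww_pos k V).le)
  refine le_of_mul_le_mul_right (h3.trans_eq ?_) (VV_pos hk hV); ring
section
variable {n k : ℕ} {α β T : ℝ} {f : Eu n → ℝ} {U : ℝ → Eu n → ℝ} {η : ℝ → ℝ}
theorem Fl.tc (h : Fl k α β T f U η) {x : Eu n} (hx : x ∈ sph n) : ContinuousOn (fun r => U r x) (Set.Ico 0 T) :=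
  fun t ht => (h.ode x hx t ht).continuousWithinAt
theorem bv_sph (i : Fin (n+1)) : (bv i : Eu n) ∈ sph n := by rw [mem_sph]; simp [bv]
theorem neg_sph {x : Eu n} (hx : x ∈ sph n) : -x ∈ sph n := by rw [mem_sph] at *; rwa [norm_neg]
theorem sub_Ico {b : ℝ} (hb : b < T) : Set.Icc 0 b ⊆ Set.Ico 0 T := fun _ ht => ⟨ht.1, ht.2.trans_lt hb⟩
theorem Fl.jc (h : Fl k α β T f U η) {b : ℝ} (hb : b < T) :
    ContinuousOn (fun p : ℝ × Eu n => U p.1 p.2) (Set.Icc 0 b ×ˢ sph n) := by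
  have hs := sub_Ico hb
  have c1 : ContinuousOn (fun t => bd (U t)) (Set.Icc 0 b) := by
    refine continuousOn_finsetSum _ fun i _ => ?_
    exact ((h.tc (bv_sph i)).mono hs).add ((h.tc (neg_sph (bv_sph i))).mono hs)
  obtain ⟨C, hC⟩ := isCompact_Icc.exists_bound_of_continuousOn c1
  refine continuousOn_prod_of_continuousOn_lipschitzOnWith' _ (Real.toNNReal C) (fun t ht => ?_) fun x hx => (h.tc hx).mono hs
  refine LipschitzOnWith.of_dist_le_mul fun x _ y _ => ?_
  rw [Real.dist_eq, dist_eq_norm]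
  refine ((h.gd t (hs ht)).lip (h.z t) x y).trans (mul_le_mul_of_nonneg_right ?_ (norm_nonneg _))
  exact (le_abs_self _).trans ((hC t ht).trans (Real.le_coe_toNNReal C))
theorem Fl.ub (h : Fl k α β T f U η) {b : ℝ} (hb : b < T) :
    ∃ c > 0, ∃ C > 0, ∀ t ∈ Set.Icc 0 b, ∀ x ∈ sph n, c ≤ U t x ∧ U t x ≤ C := by
  have hs := sub_Ico hb
  have hc : IsCompact (Set.Icc 0 b ×ˢ sph n) := isCompact_Icc.prod (sph_compact n)
  obtain ⟨c, hc0, hc1⟩ := pos_min hc (h.jc hb) fun q hq => (h.gd q.1 (hs hq.1)).p hq.2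
  obtain ⟨C, hC⟩ := hc.exists_bound_of_continuousOn (h.jc hb)
  refine ⟨c, hc0, max C 1, by positivity, fun t ht x hx => ⟨hc1 (t, x) ⟨ht, hx⟩, ?_⟩⟩
  exact (le_abs_self _).trans ((hC (t, x) ⟨ht, hx⟩).trans (le_max_left _ _))
theorem Fl.ratio (h : Fl k α β T f U η) {t0 δ : ℝ} (ht0 : t0 ∈ Set.Ico 0 T) (hδ : 0 < δ) :
    ∀ᶠ t in 𝓝[Set.Ico 0 T] t0, ∀ x ∈ sph n, U t x ≤ (1+δ) * U t0 x ∧ U t0 x ≤ (1+δ) * U t x := by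
  have hb : (t0 + T) / 2 < T := by linarith [ht0.2]
  obtain ⟨c, hc0, _, _, hc⟩ := h.ub hb
  have hu := ((isCompact_Icc.prod (sph_compact n)).uniformContinuousOn_of_continuous (h.jc hb))
  rw [Metric.uniformContinuousOn_iff] at hu
  obtain ⟨d, hd, hu⟩ := hu (c * δ) (by positivity)
  have e1 : ∀ᶠ t in 𝓝[Set.Ico 0 T] t0, t < (t0 + T) / 2 := nhdsWithin_le_nhds (Iio_mem_nhds (by linarith [ht0.2]))
  have e2 : ∀ᶠ t in 𝓝[Set.Ico 0 T] t0, dist t t0 < d := nhdsWithin_le_nhds (Metric.ball_mem_nhds t0 hd)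
  filter_upwards [e1, e2, self_mem_nhdsWithin] with t h1 h2 h3 x hx
  have m1 : t ∈ Set.Icc 0 ((t0 + T) / 2) := ⟨h3.1, h1.le⟩
  have m0 : t0 ∈ Set.Icc 0 ((t0 + T) / 2) := ⟨ht0.1, by linarith [ht0.2]⟩
  have := hu (t, x) ⟨m1, hx⟩ (t0, x) ⟨m0, hx⟩ (by rw [Prod.dist_eq, dist_self]; exact max_lt h2 hd)
  rw [Real.dist_eq, abs_lt] at this
  have k1 := mul_le_mul_of_nonneg_right (hc t m1 x hx).1 hδ.le
  have k2 := mul_le_mul_of_nonneg_right (hc t0 m0 x hx).1 hδ.le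
  constructor <;> linarith
theorem Fl.gbd (h : Fl k α β T f U η) {b : ℝ} (hb0 : 0 ≤ b) (hb : b < T) :
    ∃ C > 0, ∀ t ∈ Set.Icc 0 b, ∀ x ∈ sph n, gg k α β f (U t) x ≤ C := by
  have hb' : (b + T) / 2 < T := by linarith
  have hs := sub_Ico hb'
  set b' := (b + T) / 2 with hbe
  have hb0' : 0 < b' := by linarith
  obtain ⟨c, hc0, C, -, hc⟩ := h.ub hb'
  set p := α + k * β with hpe
  have hp := h.hp
  let x0 : Eu n := bv 0
  have hx0 : x0 ∈ sph n := bv_sph 0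
  obtain ⟨K, hK0, hK⟩ := bd_sph (gg_cont (α := α) (β := β) h.hk h.fH.sm.cont (h.gd 0 ⟨le_rfl, by linarith⟩))
  obtain ⟨N, hN0, hN⟩ := bd_sph (gg_cont (α := α) (β := β) h.hk h.fH.sm.cont (Gd.nrm n))
  have up : ∀ t ∈ Set.Icc 0 b', ∀ x ∈ sph n, 0 < U t x := fun t ht x hx => (h.gd t (hs ht)).p hx
  have hm : ∀ s ∈ Set.Icc 0 b', ∀ r ∈ Set.Icc 0 b', ∀ x ∈ sph n, (∀ z ∈ sph n, Real.log (U r z) - Real.log (U s z) ≤ Real.log (U r x) - Real.log (U s x)) →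
      U r x0 ^ (1-p) * gg k α β f (U r) x ≤ U s x0 ^ (1-p) * gg k α β f (U s) x := by
    intro s hs' r hr x hx H
    have q : ∀ z ∈ sph n, U r z / U s z ≤ U r x / U s x := fun z hz => by
      rw [← Real.log_le_log_iff (div_pos (up r hr z hz) (up s hs' z hz)) (div_pos (up r hr x hx) (up s hs' x hx)),
        Real.log_div (up r hr z hz).ne' (up s hs' z hz).ne', Real.log_div (up r hr x hx).ne' (up s hs' x hx).ne']
      exact H z hz
    have h1 := gg_comp (α := α) h.hk h.hβ (div_pos (up r hr x hx) (up s hs' x hx)) h.fp (h.gd r (hs hr)) (h.gd s (hs hs'))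
      (fun y hy => (div_le_iff₀ (up s hs' y hy)).1 (q y hy)) hx (div_mul_cancel₀ _ (up s hs' x hx).ne').symm
    have h2 : (U r x / U s x) ^ (p - 1) ≤ (U r x0 / U s x0) ^ (p - 1) :=
      Real.rpow_le_rpow_of_nonpos (div_pos (up r hr x0 hx0) (up s hs' x0 hx0)) (q x0 hx0) (by linarith)
    have h3 : U r x0 ^ (1-p) * (U r x0 / U s x0) ^ (p - 1) = U s x0 ^ (1-p) := by
      rw [show p - 1 = -(1 - p) by ring, Real.rpow_neg (div_pos (up r hr x0 hx0) (up s hs' x0 hx0)).le, Real.div_rpow (up r hr x0 hx0).le (up s hs' x0 hx0).le]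
      have := (Real.rpow_pos_of_pos (up r hr x0 hx0) (1-p)).ne'
      have := (Real.rpow_pos_of_pos (up s hs' x0 hx0) (1-p)).ne'
      field_simp
    rw [← h3, mul_assoc]
    refine mul_le_mul_of_nonneg_left (h1.trans ?_) (Real.rpow_pos_of_pos (up r hr x0 hx0) _).le
    exact mul_le_mul_of_nonneg_right h2 (gg_pos h.hk h.fp (h.gd s (hs hs')) hx).le
  have pa : ∀ t ∈ Set.Icc 0 b', 0 < U t x0 ^ (1 - p) := fun t ht => Real.rpow_pos_of_pos (up t ht x0 hx0) _
  have m0 : (0:ℝ) ∈ Set.Icc 0 b' := ⟨le_rfl, hb0'.le⟩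
  have key := compare (K := U 0 x0 ^ (1 - p) * (K + 1)) hb0' (L := fun t x => Real.log (U t x)) (g := fun t => gg k α β f (U t)) (e := η) (a := fun t => U t x0 ^ (1-p))
    ((h.jc hb').log fun q hq => (up q.1 hq.1 q.2 hq.2).ne')
    (fun x hx t ht => by
      have := ((h.ode x hx t (hs ht)).mono hs).log (up t ht x hx).ne'
      rwa [mul_div_cancel_left₀ _ (up t ht x hx).ne'] at this)
    (((h.tc hx0).mono hs).rpow_const fun t ht => Or.inl (up t ht x0 hx0).ne') pa
    (fun t ht x hx => gg_pos h.hk h.fp (h.gd t (hs ht)) hx)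
    (fun x hx => mul_lt_mul_of_pos_left (by linarith [le_abs_self (gg k α β f (U 0) x), hK x hx]) (pa 0 m0))
    hm (fun s hs' r hr x hx H => hm r hr s hs' x hx fun z hz => by linarith [H z hz])
  refine ⟨c ^ (p-1) * N + U 0 x0 ^ (1 - p) * (K + 1) * (c ^ (1-p))⁻¹, ?_, fun t ht x hx => ?_⟩
  · have := pa 0 m0; have := Real.rpow_pos_of_pos hc0 (p-1); have := Real.rpow_pos_of_pos hc0 (1-p); positivity
  have ht' : t ∈ Set.Icc 0 b' := ⟨ht.1, by linarith [ht.2]⟩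
  obtain ⟨y, hy, hmy⟩ := (sph_compact n).exists_isMaxOn ⟨x, hx⟩ (h.gd t (hs ht')).sm.cont
  have h1 := gg_comp (α := α) h.hk h.hβ (up t ht' y hy) h.fp (h.gd t (hs ht')) (Gd.nrm n)
    (fun z hz => by rw [mem_sph.1 hz, mul_one]; exact hmy hz) hy (by rw [mem_sph.1 hy, mul_one])
  have h2 : U t y ^ (p-1) ≤ c ^ (p-1) := Real.rpow_le_rpow_of_nonpos hc0 (hc t ht' y hy).1 (by linarith)
  have h3 : U t y ^ (p-1) * gg k α β f (fun y => ‖y‖) y ≤ c ^ (p-1) * N :=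
    mul_le_mul h2 ((le_abs_self _).trans (hN y hy)) (gg_pos h.hk h.fp (Gd.nrm n) hy).le (Real.rpow_pos_of_pos hc0 _).le
  have h4 := key t ⟨ht.1, by linarith [ht.2]⟩ x hx y hy
  have h5 : (U t x0 ^ (1-p))⁻¹ ≤ (c ^ (1-p))⁻¹ :=
    inv_anti₀ (Real.rpow_pos_of_pos hc0 _) (Real.rpow_le_rpow hc0.le (hc t ht' x0 hx0).1 (by linarith))
  have h6 := mul_le_mul_of_nonneg_left h5 (mul_pos (pa 0 m0) (by linarith : 0 < K + 1)).le
  linarith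
theorem Fl.epos (h : Fl k α β T f U η) {t : ℝ} (ht : t ∈ Set.Ico 0 T) : 0 < η t := by
  have h1 := h.et t ht
  have hU := h.gd t ht
  have h2 : 0 < ∫ x, gg k α β f (U t) x * (U t x * sg k (U t) x) ∂(mu n) :=
    int_pos ((gg_cont h.hk h.fH.sm.cont hU).mul (hU.sm.mul (sg_sm k hU.sm)).cont)
      fun x hx => mul_pos (gg_pos h.hk h.fp hU hx) (mul_pos (hU.p hx) (hU.sgpos h.hk hx))
  rw [← h1] at h2
  exact pos_of_mul_pos_left h2 (sphVol_pos n).le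
theorem Fl.ebd (h : Fl k α β T f U η) {b : ℝ} (hb0 : 0 ≤ b) (hb : b < T) : ∃ C > 0, ∀ t ∈ Set.Icc 0 b, η t ≤ C := by
  obtain ⟨C, hC0, hC⟩ := h.gbd hb0 hb
  obtain ⟨_, _, B, hB0, hB⟩ := h.ub hb
  have hw := ww_pos k (fun y : Eu n => ‖y‖)
  have hS := sphVol_pos n
  refine ⟨C * (B * ww k (fun y : Eu n => ‖y‖)) ^ (k+1) / sphVol n, by positivity, fun t ht => ?_⟩
  have hU := h.gd t (sub_Ico hb ht)
  rw [le_div_iff₀ hS, h.et t (sub_Ico hb ht)]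
  have h1 : ∫ x, gg k α β f (U t) x * (U t x * sg k (U t) x) ∂(mu n) ≤ C * VV k (U t) := by
    rw [VV, ← integral_const_mul]
    exact int_mono ((gg_cont h.hk h.fH.sm.cont hU).mul (hU.sm.mul (sg_sm k hU.sm)).cont) ((hU.sm.mul (sg_sm k hU.sm)).cmul C).cont
      fun x hx => mul_le_mul_of_nonneg_right (hC t ht x hx) (mul_pos (hU.p hx) (hU.sgpos h.hk hx)).le
  refine h1.trans (mul_le_mul_of_nonneg_left ?_ hC0.le)
  rw [← ww_pow h.hk hU]
  refine pow_le_pow_left₀ (ww_pos _ _).le (ww_le h.hn h.hk1 h.hk hU (Gd.nrm n) fun y hy => ?_) _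
  rw [mem_sph.1 hy, mul_one]; exact (hB t ht y hy).2
theorem rpow_bd {c C u : ℝ} (hc : 0 < c) (h1 : c ≤ u) (h2 : u ≤ C) (e : ℝ) : u ^ e ≤ c ^ e + C ^ e := by
  have hu : 0 < u := by linarith
  rcases le_total 0 e with he | he
  · linarith [Real.rpow_le_rpow hu.le h2 he, Real.rpow_pos_of_pos hc e]
  · linarith [Real.rpow_le_rpow_of_nonpos hc h1 he, Real.rpow_pos_of_pos (hu.trans_le h2) e]
theorem Fl.fd (h : Fl k α β T f U η) {H : Eu n → ℝ} (hH : ContinuousOn H (sph n)) (e : ℝ) {t : ℝ} (ht : t ∈ Set.Ioo 0 T) :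
    HasDerivAt (fun s => ∫ x, H x * U s x ^ e ∂(mu n)) (∫ x, H x * (e * U t x ^ e * (gg k α β f (U t) x - η t)) ∂(mu n)) t := by
  have hb : (t + T) / 2 < T := by linarith [ht.2]
  have hb0 : 0 ≤ (t + T) / 2 := by linarith [ht.1, ht.2]
  obtain ⟨c, hc0, C, hC0, hc⟩ := h.ub hb
  obtain ⟨G, hG0, hG⟩ := h.gbd hb0 hb
  obtain ⟨E, hE0, hE⟩ := h.ebd hb0 hb
  obtain ⟨M, hM0, hM⟩ := bd_sph hH
  have hsub : ∀ s ∈ Metric.ball t (min t ((T - t) / 2)), 0 < s ∧ s < (t + T) / 2 := fun s hs => by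
    rw [Metric.mem_ball, Real.dist_eq, lt_min_iff, abs_lt, abs_lt] at hs
    constructor <;> linarith [hs.1.1, hs.2.2]
  have ho : ∀ s ∈ Metric.ball t (min t ((T - t) / 2)), s ∈ Set.Ico 0 T := fun s hs => ⟨(hsub s hs).1.le, (hsub s hs).2.trans hb⟩
  refine int_derivB (G := fun s x => H x * U s x ^ e) (G' := fun t x => H x * (e * U t x ^ e * (gg k α β f (U t) x - η t))) (ε := min t ((T - t) / 2)) (C := M * (|e| * (c ^ e + C ^ e) * (G + E)))
    (lt_min ht.1 (by linarith [ht.2])) (fun s hs => hH.mul ((h.gd s (ho s hs)).rc e)) ?_ ?_ ?_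
  · have hU := h.gd t ⟨ht.1.le, ht.2⟩
    exact hH.mul ((continuousOn_const.mul (hU.rc e)).mul ((gg_cont h.hk h.fH.sm.cont hU).sub continuousOn_const))
  · intro s hs x hx
    have hs' : s ∈ Set.Icc 0 ((t + T) / 2) := ⟨(hsub s hs).1.le, (hsub s hs).2.le⟩
    have hU := h.gd s (ho s hs)
    have k1 := Real.rpow_pos_of_pos (hU.p hx) e
    have k2 : |gg k α β f (U s) x - η s| ≤ G + E := by
      have := gg_pos (α := α) (β := β) h.hk h.fp hU hx
      have := h.epos (ho s hs)
      rw [abs_le]; constructor <;> linarith [hG s hs' x hx, hE s hs']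
    rw [abs_mul, abs_mul, abs_mul, abs_of_pos k1]
    have := rpow_bd hc0 (hc s hs' x hx).1 (hc s hs' x hx).2 e
    have := hM x hx
    gcongr
  · intro s hs x hx
    have hU := h.gd s (ho s hs)
    have d := (h.ode x hx s (ho s hs)).hasDerivAt (Ico_mem_nhds (hsub s hs).1 (ho s hs).2)
    have d2 := (d.rpow_const (p := e) (Or.inl (hU.p hx).ne')).const_mul (H x)
    have e1 : H x * (e * U s x ^ e * (gg k α β f (U s) x - η s)) = H x * (U s x * (gg k α β f (U s) x - η s) * e * U s x ^ (e - 1)) := by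
      have : U s x ^ e = U s x * U s x ^ (e-1) := by
        rw [Real.rpow_sub_one (hU.p hx).ne']; field_simp [(hU.p hx).ne']
      rw [this]; ring
    rw [e1]; exact d2
theorem Fl.fc (h : Fl k α β T f U η) {H : Eu n → ℝ} (hH : ContinuousOn H (sph n)) (e : ℝ) {b : ℝ} (hb : b < T) :
    ContinuousOn (fun s => ∫ x, H x * U s x ^ e ∂(mu n)) (Set.Icc 0 b) := by
  obtain ⟨c, hc0, C, hC0, hc⟩ := h.ub hb
  obtain ⟨M, hM0, hM⟩ := bd_sph hH
  have hs := sub_Ico hb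
  intro t ht
  refine continuousWithinAt_of_dominated (bound := fun _ => M * (c ^ e + C ^ e)) ?_ ?_ (intg continuousOn_const) ?_
  · filter_upwards [self_mem_nhdsWithin] with s hs'
    exact (intg (hH.mul ((h.gd s (hs hs')).rc e))).aestronglyMeasurable
  · filter_upwards [self_mem_nhdsWithin] with s hs'
    filter_upwards [ae_sph n] with x hx
    rw [Real.norm_eq_abs, abs_mul, abs_of_pos (Real.rpow_pos_of_pos ((h.gd s (hs hs')).p hx) e)]
    have := rpow_bd hc0 (hc s hs' x hx).1 (hc s hs' x hx).2 e
    have := hM x hx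
    have := Real.rpow_pos_of_pos ((h.gd s (hs hs')).p hx) e
    gcongr
  · filter_upwards [ae_sph n] with x hx
    exact (continuousOn_const.mul (((h.tc hx).mono hs).rpow_const fun s hs' => Or.inl ((h.gd s (hs hs')).p hx).ne')) t ht
end
theorem sl_left {φ : ℝ → ℝ} {d c : ℝ} (h : HasDerivAt φ d c) (hd : 0 < d) : ∀ᶠ s in 𝓝[<] c, φ s < φ c := by
  have := (hasDerivAt_iff_tendsto_slope.1 h).eventually (lt_mem_nhds hd)
  filter_upwards [nhdsWithin_mono c (fun s hs => ne_of_lt hs) this, self_mem_nhdsWithin] with s h1 h2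
  rw [slope_def_field] at h1
  have h2' : s - c < 0 := sub_neg.2 h2
  rcases div_pos_iff.1 h1 with h | h <;> linarith [h.1, h.2]
theorem sl_right {φ : ℝ → ℝ} {d c : ℝ} (h : HasDerivAt φ d c) (hd : d < 0) : ∀ᶠ s in 𝓝[>] c, φ s < φ c := by
  have := (hasDerivAt_iff_tendsto_slope.1 h).eventually (gt_mem_nhds hd)
  filter_upwards [nhdsWithin_mono c (fun s hs => ne_of_gt hs) this, self_mem_nhdsWithin] with s h1 h2
  rw [slope_def_field] at h1
  have h2' : 0 < s - c := sub_pos.2 h2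
  rcases div_neg_iff.1 h1 with h | h <;> linarith [h.1, h.2]
section
variable {n k : ℕ} {α β T : ℝ} {f : Eu n → ℝ} {U : ℝ → Eu n → ℝ} {η : ℝ → ℝ}
theorem Fl.wc (h : Fl k α β T f U η) : ContinuousOn (fun t => ww k (U t)) (Set.Ico 0 T) := by
  intro c hc
  rw [ContinuousWithinAt, Metric.tendsto_nhds]
  intro ε hε
  have hw := ww_pos k (U c)
  have hδ : 0 < min 1 (ε / (4 * ww k (U c))) := lt_min one_pos (by positivity)
  filter_upwards [h.ratio hc hδ, self_mem_nhdsWithin] with t ht hm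
  set δ := min 1 (ε / (4 * ww k (U c)))
  have h1 := ww_le h.hn h.hk1 h.hk (h.gd t hm) (h.gd c hc) fun y hy => (ht y hy).1
  have h2 := ww_le h.hn h.hk1 h.hk (h.gd c hc) (h.gd t hm) fun y hy => (ht y hy).2
  have h3 : δ * ww k (U c) ≤ ε / 4 := by
    have := mul_le_mul_of_nonneg_right (min_le_right 1 (ε / (4 * ww k (U c)))) hw.le
    refine this.trans_eq ?_; field_simp
  have h4 : δ ≤ 1 := min_le_left _ _
  have h5 : δ * ww k (U t) ≤ δ * (2 * ww k (U c)) := mul_le_mul_of_nonneg_left (h1.trans (mul_le_mul_of_nonneg_right (by linarith) hw.le)) hδ.le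
  rw [Real.dist_eq, abs_lt]
  constructor <;> linarith
theorem Fl.wd (h : Fl k α β T f U η) {c : ℝ} (hc : c ∈ Set.Ioo 0 T) :
    ∃ φ : ℝ → ℝ, HasDerivAt φ (η c * (sphVol n - VV k (U c))) c ∧ φ c = VV k (U c) ∧ ∀ s ∈ Set.Ico 0 T, φ s < VV k (U c) → ww k (U s) < ww k (U c) := by
  have hc' := Set.Ioo_subset_Ico_self hc
  have hU := h.gd c hc'
  have cU := hU.sm.cont
  have cs := (sg_sm k hU.sm).cont
  have cg : ContinuousOn (gg k α β f (U c)) (sph n) := gg_cont h.hk h.fH.sm.cont hU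
  refine ⟨fun s => ∫ x, sg k (U c) x * U s x ^ (1:ℝ) ∂(mu n), ?_, ?_, ?_⟩
  · have d := h.fd cs 1 hc
    have e : ∫ x, sg k (U c) x * (1 * U c x ^ (1:ℝ) * (gg k α β f (U c) x - η c)) ∂(mu n) = η c * (sphVol n - VV k (U c)) := by
      rw [mul_sub, h.et c hc', VV, ← integral_const_mul, ← isub (by fun_prop) (by fun_prop)]
      refine int_congr fun x _ => ?_
      rw [Real.rpow_one]; ring
    rwa [e] at d
  · simp only [Real.rpow_one, VV]
    exact int_congr fun x _ => mul_comm _ _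
  · intro s hs hl
    have h1 := mink h.hn h.hk1 h.hk hU (h.gd s hs)
    have e : ∫ x, sg k (U c) x * U s x ^ (1:ℝ) ∂(mu n) = ∫ x, U s x * sg k (U c) x ∂(mu n) :=
      int_congr fun x _ => by rw [Real.rpow_one]; ring
    replace hl := e.symm.trans_lt hl
    exact lt_of_mul_lt_mul_right (h1.trans_lt (mul_lt_mul_of_pos_left hl (ww_pos k (U c)))) (VV_pos h.hk hU).le
theorem Fl.wconst (h : Fl k α β T f U η) {b : ℝ} (hb : b ∈ Set.Ico 0 T) : ww k (U b) = ww k (U 0) := by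
  have h0 : (0:ℝ) ∈ Set.Ico 0 T := ⟨le_rfl, hb.1.trans_lt hb.2⟩
  have hs := sub_Ico hb.2
  have cw := h.wc.mono hs
  have lt_iff : ∀ c ∈ Set.Ico 0 T, ∀ d ∈ Set.Ico 0 T, ww k (U c) < ww k (U d) → VV k (U c) < VV k (U d) := fun c hc d hd hl => by
    rw [← ww_pow h.hk (h.gd c hc), ← ww_pow h.hk (h.gd d hd)]
    exact pow_lt_pow_left₀ hl (ww_pos _ _).le (by omega)
  rcases lt_trichotomy (ww k (U b)) (ww k (U 0)) with hl | hl | hl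
  · exfalso
    obtain ⟨c, hc, hm⟩ := isCompact_Icc.exists_isMinOn ⟨b, ⟨hb.1, le_rfl⟩⟩ cw
    have hl' : ww k (U c) < ww k (U 0) := lt_of_le_of_lt (hm (show b ∈ Set.Icc 0 b from ⟨hb.1, le_rfl⟩)) hl
    have hc0 : 0 < c := lt_of_le_of_ne hc.1 fun e => by rw [← e] at hl'; exact lt_irrefl _ hl'
    obtain ⟨φ, d, e, H⟩ := h.wd ⟨hc0, (hs hc).2⟩
    have hv := lt_iff c (hs hc) 0 h0 hl'
    rw [h.v0] at hv
    have ev := sl_left d (mul_pos (h.epos (hs hc)) (by linarith))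
    have ev2 : ∀ᶠ s in 𝓝[<] c, 0 < s := nhdsWithin_le_nhds (Ioi_mem_nhds hc0)
    obtain ⟨s, ⟨h1, h2⟩, h3⟩ := ((ev.and ev2).and (self_mem_nhdsWithin : Set.Iio c ∈ 𝓝[<] c)).exists
    have hs' : s ∈ Set.Icc 0 b := ⟨h2.le, (le_of_lt h3).trans hc.2⟩
    exact absurd (hm hs') (not_le.2 (H s (hs hs') (by rw [← e]; exact h1)))
  · exact hl
  · exfalso
    obtain ⟨l, hl1, hl2⟩ := exists_between hl
    have hK : IsCompact (Set.Icc 0 b ∩ (fun t => ww k (U t)) ⁻¹' Set.Iic l) :=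
      isCompact_Icc.of_isClosed_subset (cw.preimage_isClosed_of_isClosed isClosed_Icc isClosed_Iic) Set.inter_subset_left
    obtain ⟨a, ⟨ha, hal⟩, hg⟩ := hK.exists_isGreatest ⟨0, ⟨le_rfl, hb.1⟩, hl1.le⟩
    change ww k (U a) ≤ l at hal
    have hab : a < b := lt_of_le_of_ne ha.2 fun e => by rw [e] at hal; linarith
    have hr : ∀ t, a < t → t ≤ b → l < ww k (U t) := fun t h1 h2 => by
      by_contra hc
      exact absurd (hg ⟨⟨ha.1.trans h1.le, h2⟩, not_lt.1 hc⟩) (not_le.2 h1)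
    have evb : ∀ᶠ s in 𝓝[>] a, s < b := nhdsWithin_le_nhds (Iio_mem_nhds hab)
    have hal' : l ≤ ww k (U a) := by
      have ht : Tendsto (fun t => ww k (U t)) (𝓝[>] a) (𝓝 (ww k (U a))) := by
        refine (cw a ha).tendsto.mono_left ?_
        rw [← nhdsWithin_Ioc_eq_nhdsGT hab]
        exact nhdsWithin_mono a fun t ht => ⟨ha.1.trans ht.1.le, ht.2⟩
      refine ge_of_tendsto ht ?_
      filter_upwards [evb, self_mem_nhdsWithin] with s h1 h2 using (hr s h2 h1.le).le
    have hl' : ww k (U 0) < ww k (U a) := by linarith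
    have ha0 : 0 < a := lt_of_le_of_ne ha.1 fun e => by rw [← e] at hl'; exact lt_irrefl _ hl'
    obtain ⟨φ, d, e, H⟩ := h.wd ⟨ha0, (hs ha).2⟩
    have hv := lt_iff 0 h0 a (hs ha) hl'
    rw [h.v0] at hv
    have ev := sl_right d (mul_neg_of_pos_of_neg (h.epos (hs ha)) (by linarith))
    obtain ⟨s, ⟨h1, h2⟩, h3⟩ := ((ev.and evb).and (self_mem_nhdsWithin : Set.Ioi a ∈ 𝓝[>] a)).exists
    have := H s (hs ⟨ha.1.trans (le_of_lt h3), h2.le⟩) (by rw [← e]; exact h1)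
    linarith [hr s h3 h2.le]
theorem Fl.vol (h : Fl k α β T f U η) {b : ℝ} (hb : b ∈ Set.Ico 0 T) : VV k (U b) = sphVol n := by
  rw [← h.v0, ← ww_pow h.hk (h.gd b hb), h.wconst hb, ww_pow h.hk (h.gd 0 ⟨le_rfl, hb.1.trans_lt hb.2⟩)]
theorem Fl.mkw (h : Fl k α β T f U η) {s c : ℝ} (hs : s ∈ Set.Ico 0 T) (hc : c ∈ Set.Ico 0 T) :
    sphVol n ≤ ∫ x, U s x * sg k (U c) x ∂(mu n) := by
  have := mink h.hn h.hk1 h.hk (h.gd c hc) (h.gd s hs)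
  rw [h.wconst hs, h.wconst hc, h.vol hc] at this
  exact le_of_mul_le_mul_left this (ww_pos k (U 0))
end
theorem Gd.opn {U F : Eu n → ℝ} (hU : Gd U) (hF : Hg F) : ∃ ε0 > 0, ∀ ε ∈ Set.Icc 0 ε0, Gd (fun y => U y + ε * F y) := by
  obtain ⟨c1, hc1, h1⟩ := pos_min (sph_compact n) hU.sm.cont fun x hx => hU.p hx
  obtain ⟨C1, hC1, H1⟩ := bd_sph hF.sm.cont
  let Z : Set (Eu n × (Fin (n+1) → ℝ)) := (sph n ×ˢ Metric.sphere 0 1) ∩ {p | ∑ i, p.2 i * p.1 i = 0}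
  have hZ : IsCompact Z := ((sph_compact n).prod (isCompact_sphere _ _)).inter_right (isClosed_eq (by fun_prop) (by fun_prop))
  have cq : ∀ {G : Eu n → ℝ}, Sm G → ContinuousOn (fun p : Eu n × (Fin (n+1) → ℝ) => qf (Hm G p.1) p.2) Z := fun {G} hG => by
    have cH : ContinuousOn (fun p : Eu n × (Fin (n+1) → ℝ) => Hm G p.1) Z := (Hm_cont hG).comp continuousOn_fst fun p hp => hp.1.1
    have cij : ∀ i j, ContinuousOn (fun p : Eu n × (Fin (n+1) → ℝ) => Hm G p.1 i j) Z := fun i j => continuousOn_pi.1 (continuousOn_pi.1 cH i) j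
    refine continuousOn_finsetSum _ fun i _ => continuousOn_finsetSum _ fun j _ => ?_
    exact (ContinuousOn.mul (by fun_prop) (cij i j)).mul (by fun_prop)
  obtain ⟨c2, hc2, h2⟩ := pos_min hZ (cq hU.sm) fun p hp => (hU.cvx p.1 hp.1.1).pos p.2 hp.2 fun e => by
    have := hp.1.2; rw [e] at this; simp at this
  obtain ⟨C2, H2⟩ := hZ.exists_bound_of_continuousOn (cq hF.sm)
  refine ⟨min (c1 / (2 * C1)) (c2 / (2 * (|C2| + 1))), lt_min (by positivity) (by positivity), fun ε hε => ?_⟩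
  have hg : Hg (fun y => U y + ε * F y) := hU.toHg.add (hF.cmul ε)
  have e1 : ε * C1 < c1 := by
    have := mul_le_mul_of_nonneg_right (hε.2.trans (min_le_left _ _)) hC1.le
    have e : c1 / (2 * C1) * C1 = c1 / 2 := by field_simp
    linarith
  have e2 : ε * |C2| < c2 := by
    have := mul_le_mul_of_nonneg_right (hε.2.trans (min_le_right _ _)) (by positivity : 0 ≤ |C2| + 1)
    have e : c2 / (2 * (|C2| + 1)) * (|C2| + 1) = c2 / 2 := by field_simp
    linarith [hε.1]
  refine ⟨hg, pos_of_sph hg fun y hy => ?_, fun x hx => ⟨hg.kx hx, fun v hv hv0 => ?_⟩⟩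
  · have := mul_le_mul_of_nonneg_left (neg_le_of_abs_le (H1 y hy)) hε.1
    linarith [h1 y hy]
  · have hp := norm_pos_iff.2 hv0
    have hz : (x, ‖v‖⁻¹ • v) ∈ Z := by
      refine ⟨⟨hx, ?_⟩, ?_⟩
      · simp [norm_smul, hp.ne']
      · simp only [Set.mem_ofPred_eq, Pi.smul_apply, smul_eq_mul, mul_assoc, ← Finset.mul_sum, hv, mul_zero]
    have k1 := h2 _ hz
    have k2 := neg_le_of_abs_le ((H2 _ hz).trans (le_abs_self _))
    simp only [qf_vsmul] at k1 k2
    have : 0 < (‖v‖⁻¹)^2 * qf (Hm (fun y => U y + ε * F y) x) v := by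
      rw [Hm_add hU.sm (hF.cmul ε).sm (sph_ne hx), Hm_cmul ε hF.sm (sph_ne hx), qf_add, qf_smul]
      have := mul_le_mul_of_nonneg_left k2 hε.1
      linarith
    exact pos_of_mul_pos_right this (by positivity)
theorem Sm.proj {F : Eu n → ℝ} (h : Sm F) : Sm (fun y => F (‖y‖⁻¹ • y)) := by
  have h1 : ContDiffOn ℝ (⊤:ℕ∞) (fun y : Eu n => ‖y‖⁻¹ • y) {0}ᶜ :=
    ContDiffOn.smul ((Sm.nrm n).inv fun y hy => norm_ne_zero_iff.2 hy) contDiffOn_id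
  exact ContDiffOn.comp h h1 fun y hy => smul_ne_zero (inv_ne_zero (norm_ne_zero_iff.2 hy)) hy
theorem Sm.rpw {F : Eu n → ℝ} (h : Sm F) (h0 : ∀ y ≠ 0, F y ≠ 0) (e : ℝ) : Sm (fun y => F y ^ e) :=
  ContDiffOn.rpow_const_of_ne h h0
theorem proj_sph {y : Eu n} (hy : y ≠ 0) : ‖y‖⁻¹ • y ∈ sph n := by
  rw [mem_sph, norm_smul, norm_inv, norm_norm, inv_mul_cancel₀ (norm_ne_zero_iff.2 hy)]
theorem xi_hg {k : ℕ} (hk : k ≤ n) {α β : ℝ} {f V : Eu n → ℝ} (hf : Sm f) (hV : Gd V) :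
    Hg (homExt fun x => gg k α β f V x * V x) := by
  refine homExt_hg ?_
  have h1 := ((hf.proj.mul (hV.sm.proj.rpw (fun y hy => (hV.p (proj_sph hy)).ne') (α-1))).mul
    ((sg_sm k hV.sm).proj.rpw (fun y hy => (hV.sgpos hk (proj_sph hy)).ne') β)).mul hV.sm.proj
  exact (Sm.nrm n).mul h1
theorem young {k : ℕ} (hk : k ≤ n) {α β : ℝ} (hβ : 0 < β) {f V Z : Eu n → ℝ} (fp : ∀ x ∈ sph n, 0 < f x) (hV : Gd V) (hZ : Gd Z) {x : Eu n} (hx : x ∈ sph n) :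
    gg k α β f Z x * Z x * sg k V x * (V x / Z x) ^ (α / (1 + β)) ≤
      (1 + β)⁻¹ * (gg k α β f V x * (V x * sg k V x) + β * (gg k α β f Z x * (Z x * sg k Z x))) := by
  have hb : 0 < 1 + β := by linarith
  have a1 := gg_pos (α := α) (β := β) hk fp hV hx
  have a2 := gg_pos (α := α) (β := β) hk fp hZ hx
  have v := hV.p hx
  have z := hZ.p hx
  have s := hV.sgpos hk hx
  have r := hZ.sgpos hk hx
  have ff := fp x hx
  have := Real.geom_mean_le_arith_mean2_weighted (by positivity : 0 ≤ 1 / (1+β)) (by positivity : 0 ≤ β / (1 + β))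
    (mul_pos a1 (mul_pos v s)).le (mul_pos a2 (mul_pos z r)).le (by field_simp)
  refine le_trans (le_of_eq ?_) (this.trans_eq (by ring))
  simp only [gg]
  generalize V x = v' at *
  generalize Z x = z' at *
  generalize sg k V x = s' at *
  generalize sg k Z x = r' at *
  generalize f x = f' at *
  rw [← Real.exp_log v, ← Real.exp_log z, ← Real.exp_log s, ← Real.exp_log r, ← Real.exp_log ff]
  simp only [← Real.exp_mul, ← Real.exp_add, ← Real.exp_sub]
  congr 1
  field_simp
  ring
section
variable {n k : ℕ} {α β T : ℝ} {f : Eu n → ℝ} {U : ℝ → Eu n → ℝ} {η : ℝ → ℝ}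
theorem Fl.αn (h : Fl k α β T f U η) : α < 0 := by linarith [h.hp, h.hb1]
theorem Fl.lsc (h : Fl k α β T f U η) {c m : ℝ} (hc : c ∈ Set.Ico 0 T) (hm : m < η c) : ∀ᶠ t in 𝓝[Set.Ico 0 T] c, m < η t := by
  have hβ := h.hβ
  have hb : 0 < 1 + β := by linarith
  have hS := sphVol_pos n
  have hU := h.gd c hc
  have hX : Hg (homExt fun x => gg k α β f (U c) x * U c x) := xi_hg h.hk h.fH.sm hU
  have hXs : ∀ x ∈ sph n, homExt (fun x => gg k α β f (U c) x * U c x) x = gg k α β f (U c) x * U c x := fun x hx => homExt_sph _ hx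
  generalize homExt (fun x => gg k α β f (U c) x * U c x) = X at hX hXs
  obtain ⟨ε0, hε0, hG⟩ := hU.opn hX
  have hm3 : (m + β * η c) / (1 + β) < η c := by rw [div_lt_iff₀ hb]; linarith
  obtain ⟨m2, h32, h2c⟩ := exists_between hm3
  obtain ⟨m1, h21, h1c⟩ := exists_between h2c
  have d0 := V_deriv k hU.toHg hX 0
  have e00 : (fun y => U c y + 0 * X y) = U c := by ext y; ring
  rw [e00] at d0
  have e1 : ∫ x, X x * sg k (U c) x ∂(mu n) = η c * sphVol n := by
    rw [h.et c hc]; exact int_congr fun x hx => by rw [hXs x hx]; ring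
  rw [e1] at d0
  have hv0 : VV k (fun y => U c y + 0 * X y) = sphVol n := by rw [e00, h.vol hc]
  have d1 : HasDerivAt (fun ε => ww k (fun y => U c y + ε * X y)) (ww k (U 0) * η c) 0 := by
    have := ((d0.log (by rw [hv0]; exact hS.ne')).div_const ((k:ℝ)+1)).exp
    rw [hv0] at this
    refine this.congr_deriv ?_
    rw [← h.v0, ww, h.v0]
    have : (k:ℝ) + 1 ≠ 0 := by positivity
    field_simp
  have hw := ww_pos k (U 0)
  have d2 := (hasDerivAt_iff_tendsto_slope.1 d1).eventually (lt_mem_nhds (mul_lt_mul_of_pos_left h1c hw))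
  have d3 : ∀ᶠ ε in 𝓝[>] (0:ℝ), ε < ε0 := nhdsWithin_le_nhds (Iio_mem_nhds hε0)
  have d4 : ∀ᶠ ε in 𝓝[>] (0:ℝ), ww k (U 0) * m1 < slope (fun ε => ww k fun y => U c y + ε * X y) 0 ε := nhdsWithin_mono (0:ℝ) (fun s hs => ne_of_gt hs) d2
  obtain ⟨ε, ⟨hsl, hεlt⟩, hεp⟩ := ((d4.and d3).and (self_mem_nhdsWithin : Set.Ioi (0:ℝ) ∈ 𝓝[>] 0)).exists
  change 0 < ε at hεp
  rw [slope_def_field, e00, h.wconst hc, sub_zero, lt_div_iff₀ hεp] at hsl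
  have hW := hG ε ⟨hεp.le, hεlt.le⟩
  set W := fun y => U c y + ε * X y with hWe
  have ev1 : ∀ᶠ δ in 𝓝[>] (0:ℝ), (m + β * η c) / (1 + β) < (1 + δ) ^ (α / (1 + β)) * m2 := by
    have hct : Tendsto (fun δ : ℝ => (1 + δ) ^ (α / (1 + β)) * m2) (𝓝 0) (𝓝 ((1 + 0) ^ (α / (1 + β)) * m2)) := by
      have : ContinuousAt (fun δ : ℝ => (1 + δ) ^ (α / (1 + β)) * m2) 0 :=
        ((continuousAt_const.add continuousAt_id).rpow_const (Or.inl (by norm_num))).mul continuousAt_const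
      exact this
    rw [add_zero, Real.one_rpow, one_mul] at hct
    exact nhdsWithin_le_nhds (hct.eventually (lt_mem_nhds h32))
  have ev2 : ∀ᶠ δ in 𝓝[>] (0:ℝ), δ < ε * (m1 - m2) := nhdsWithin_le_nhds (Iio_mem_nhds (mul_pos hεp (by linarith)))
  obtain ⟨δ, ⟨hδ1, hδ2⟩, hδ⟩ := ((ev1.and ev2).and (self_mem_nhdsWithin : Set.Ioi (0:ℝ) ∈ 𝓝[>] 0)).exists
  change 0 < δ at hδ
  filter_upwards [h.ratio hc hδ, self_mem_nhdsWithin] with t hr ht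
  have hV := h.gd t ht
  have cU := hU.sm.cont
  have cV := hV.sm.cont
  have cX := hX.sm.cont
  have cs := (sg_sm k hV.sm).cont
  have cs' := (sg_sm k hU.sm).cont
  have cg : ContinuousOn (gg k α β f (U c)) (sph n) := gg_cont h.hk h.fH.sm.cont hU
  have cg' : ContinuousOn (gg k α β f (U t)) (sph n) := gg_cont h.hk h.fH.sm.cont hV
  have k1 := mink h.hn h.hk1 h.hk hV hW
  rw [h.vol ht, h.wconst ht] at k1
  have k2 : ∫ x, W x * sg k (U t) x ∂(mu n) = ∫ x, U c x * sg k (U t) x ∂(mu n) + ε * ∫ x, X x * sg k (U t) x ∂(mu n) := by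
    rw [← integral_const_mul, ← iadd (by fun_prop) (by fun_prop)]
    exact int_congr fun x _ => by rw [hWe]; ring
  have k3 : ∫ x, U c x * sg k (U t) x ∂(mu n) ≤ (1 + δ) * sphVol n := by
    rw [← h.vol ht, VV, ← integral_const_mul]
    refine int_mono (by fun_prop) (by fun_prop) fun x hx => ?_
    rw [← mul_assoc]; exact mul_le_mul_of_nonneg_right (hr x hx).2 (hV.sgpos h.hk hx).le
  set Xt := ∫ x, X x * sg k (U t) x ∂(mu n) with hXt
  have k4 : m2 * sphVol n ≤ Xt := by
    have a1 : ww k (U 0) * ((1 + ε * m1) * sphVol n) ≤ ww k (U 0) * ((1 + δ) * sphVol n + ε * Xt) := by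
      refine le_trans ?_ (k1.trans (mul_le_mul_of_nonneg_left (by rw [k2]; linarith) hw.le))
      rw [← mul_assoc]; refine mul_le_mul_of_nonneg_right ?_ hS.le; linarith
    have a2 := le_of_mul_le_mul_left a1 hw
    have a3 := mul_le_mul_of_nonneg_right hδ2.le hS.le
    refine le_of_mul_le_mul_left ?_ hεp
    linarith
  have hθ := Real.rpow_pos_of_pos (by linarith : 0 < 1 + δ) (α / (1 + β))
  set q := (1 + δ) ^ (α / (1 + β)) with hq
  have k5 : q * Xt ≤ (η t * sphVol n + β * (η c * sphVol n)) / (1 + β) := by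
    rw [h.et t ht, h.et c hc, hXt, ← integral_const_mul, ← integral_const_mul, ← iadd (by fun_prop) (by fun_prop), div_eq_mul_inv, mul_comm _ (1 + β)⁻¹, ← integral_const_mul]
    refine int_mono (by fun_prop) (by fun_prop) fun x hx => ?_
    have yy := young (α := α) h.hk hβ h.fp hV hU hx
    refine le_trans ?_ yy
    have : q ≤ (U t x / U c x) ^ (α / (1 + β)) :=
      Real.rpow_le_rpow_of_nonpos (div_pos (hV.p hx) (hU.p hx)) ((div_le_iff₀ (hU.p hx)).2 (hr x hx).1) (div_nonpos_of_nonpos_of_nonneg h.αn.le hb.le)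
    rw [hXs x hx, mul_comm]
    exact mul_le_mul_of_nonneg_left this (mul_pos (mul_pos (gg_pos h.hk h.fp hU hx) (hU.p hx)) (hV.sgpos h.hk hx)).le
  have k6 := mul_le_mul_of_nonneg_left k4 hθ.le
  rw [le_div_iff₀ hb] at k5
  rw [div_lt_iff₀ hb] at hδ1
  have k7 := mul_lt_mul_of_pos_right hδ1 hS
  have k8 := mul_le_mul_of_nonneg_right k6 hb.le
  refine lt_of_mul_lt_mul_right (a := sphVol n) ?_ hS.le
  linarith
theorem Fl.mono (h : Fl k α β T f U η) {a b : ℝ} (ha : a ∈ Set.Ico 0 T) (hb : b ∈ Set.Ico 0 T) (hab : a ≤ b) : η b ≤ η a := by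
  by_contra! hlt
  have hβ := h.hβ
  have hb1 : 0 < 1 + β := by linarith
  have hS := sphVol_pos n
  have hsub : Set.Icc a b ⊆ Set.Ico 0 T := fun t ht => ⟨ha.1.trans ht.1, ht.2.trans_lt hb.2⟩
  let A : Set ℝ := {t | t ∈ Set.Icc a b ∧ η t ≤ η a}
  have hAs : A ⊆ Set.Icc a b := fun t ht => ht.1
  have hbd : BddAbove A := ⟨b, fun t ht => ht.1.2⟩
  have hcl := csSup_mem_closure (show A.Nonempty from ⟨a, ⟨le_rfl, hab⟩, le_rfl⟩) hbd
  set c := sSup A with hce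
  have hc : c ∈ Set.Icc a b := closure_minimal hAs isClosed_Icc hcl
  have hc' := hsub hc
  have hηc : η c ≤ η a := by
    by_contra! hh
    have h1 := eventually_nhdsWithin_iff.1 (h.lsc hc' hh)
    obtain ⟨t, ht1, ht2⟩ := ((mem_closure_iff_frequently.1 hcl).and_eventually h1).exists
    exact absurd (ht2 (hsub ht1.1)) (not_lt.2 ht1.2)
  have hcb : c < b := lt_of_le_of_ne hc.2 fun e => by rw [e] at hηc; linarith
  have hr : ∀ t ∈ Set.Ioc c b, η c < η t := fun t ht => by
    by_contra! hh
    exact absurd (le_csSup hbd (show t ∈ A from ⟨⟨hc.1.trans ht.1.le, ht.2⟩, hh.trans hηc⟩)) (not_le.2 ht.1)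
  have hU := h.gd c hc'
  set θ := 1 - α / (1 + β) with hθ
  have hθ1 : 1 ≤ θ := by have := div_nonpos_of_nonpos_of_nonneg h.αn.le hb1.le; linarith
  have cs := (sg_sm k hU.sm).cont
  have cU := hU.sm.cont
  have crc := hU.rc (1 - θ)
  have cH : ContinuousOn (fun x => U c x ^ (1 - θ) * sg k (U c) x) (sph n) := by fun_prop
  have Φge : ∀ r ∈ Set.Ico 0 T, sphVol n ≤ ∫ x, U c x ^ (1 - θ) * sg k (U c) x * U r x ^ θ ∂(mu n) := fun r hr => by
    have hV := h.gd r hr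
    have cV := hV.sm.cont
    have crV := hV.rc θ
    have h1 : (1 - θ) * VV k (U c) + θ * ∫ x, U r x * sg k (U c) x ∂(mu n) ≤ ∫ x, U c x ^ (1 - θ) * sg k (U c) x * U r x ^ θ ∂(mu n) := by
      rw [VV, ← integral_const_mul, ← integral_const_mul, ← iadd (by fun_prop) (by fun_prop)]
      refine int_mono (by fun_prop) (by fun_prop) fun x hx => ?_
      have pc := hU.p hx
      have pr := hV.p hx
      have b1 := one_add_mul_self_le_rpow_one_add (s := U r x / U c x - 1) (by linarith [div_pos pr pc]) hθ1
      rw [add_sub_cancel, Real.div_rpow pr.le pc.le] at b1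
      have b2 : U c x * (U r x ^ θ / U c x ^ θ) = U c x ^ (1 - θ) * U r x ^ θ := by
        rw [Real.rpow_sub pc 1 θ, Real.rpow_one]; ring
      have b3 := mul_le_mul_of_nonneg_left b1 pc.le
      rw [b2] at b3
      have b4 : U c x * (1 + θ * (U r x / U c x - 1)) = (1 - θ) * U c x + θ * U r x := by field_simp; ring
      rw [b4] at b3
      have := mul_le_mul_of_nonneg_right b3 (hU.sgpos h.hk hx).le
      linarith
    rw [h.vol hc'] at h1
    have := mul_le_mul_of_nonneg_left (h.mkw hr hc') (by linarith : 0 ≤ θ)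
    linarith
  have Φc : ∫ x, U c x ^ (1 - θ) * sg k (U c) x * U c x ^ θ ∂(mu n) = sphVol n := by
    rw [← h.vol hc', VV]
    refine int_congr fun x hx => ?_
    have : U c x ^ (1 - θ) * U c x ^ θ = U c x := by rw [← Real.rpow_add (hU.p hx), sub_add_cancel, Real.rpow_one]
    rw [mul_right_comm, this]
  have anti := strictAntiOn_of_deriv_neg (convex_Icc c b) (f := fun s => ∫ x, U c x ^ (1 - θ) * sg k (U c) x * U s x ^ θ ∂(mu n))
    ((h.fc cH θ hb.2).mono fun t ht => ⟨hc'.1.trans ht.1, ht.2⟩) fun r hrm => by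
      rw [interior_Icc] at hrm
      have hr0 : r ∈ Set.Ioo 0 T := ⟨hc'.1.trans_lt hrm.1, hrm.2.trans hb.2⟩
      have hr' := Set.Ioo_subset_Ico_self hr0
      rw [(h.fd cH θ hr0).deriv]
      have hV := h.gd r hr'
      have cV := hV.sm.cont
      have crV := hV.rc θ
      have cg : ContinuousOn (gg k α β f (U c)) (sph n) := gg_cont h.hk h.fH.sm.cont hU
      have cg' : ContinuousOn (gg k α β f (U r)) (sph n) := gg_cont h.hk h.fH.sm.cont hV
      have cs' := (sg_sm k hV.sm).cont
      have e1 : ∫ x, U c x ^ (1 - θ) * sg k (U c) x * (θ * U r x ^ θ * (gg k α β f (U r) x - η r)) ∂(mu n)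
          = θ * (∫ x, gg k α β f (U r) x * (U c x ^ (1 - θ) * sg k (U c) x * U r x ^ θ) ∂(mu n) - η r * ∫ x, U c x ^ (1 - θ) * sg k (U c) x * U r x ^ θ ∂(mu n)) := by
        rw [← integral_const_mul, ← isub (by fun_prop) (by fun_prop), ← integral_const_mul]
        exact int_congr fun x _ => by ring
      rw [e1]
      have k5 : ∫ x, gg k α β f (U r) x * (U c x ^ (1 - θ) * sg k (U c) x * U r x ^ θ) ∂(mu n) ≤ (η c * sphVol n + β * (η r * sphVol n)) / (1 + β) := by
        rw [h.et c hc', h.et r hr', ← integral_const_mul, ← iadd (by fun_prop) (by fun_prop), div_eq_mul_inv, mul_comm _ (1 + β)⁻¹, ← integral_const_mul]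
        refine int_mono (by fun_prop) (by fun_prop) fun x hx => ?_
        have yy := young (α := α) h.hk hβ h.fp hU hV hx
        refine le_trans (le_of_eq ?_) yy
        have pc := hU.p hx
        have pr := hV.p hx
        have : U c x ^ (1 - θ) * U r x ^ θ = U r x * (U c x / U r x) ^ (α / (1 + β)) := by
          rw [hθ, sub_sub_cancel, Real.div_rpow pc.le pr.le, Real.rpow_sub pr, Real.rpow_one]; ring
        calc _ = gg k α β f (U r) x * sg k (U c) x * (U c x ^ (1 - θ) * U r x ^ θ) := by ring
          _ = _ := by rw [this]; ring
      have k6 := hr r ⟨hrm.1, hrm.2.le⟩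
      have k7 : (η c * sphVol n + β * (η r * sphVol n)) / (1 + β) < η r * sphVol n := by
        rw [div_lt_iff₀ hb1]
        have := mul_lt_mul_of_pos_right k6 hS
        linarith
      have k8 := mul_le_mul_of_nonneg_left (Φge r hr') (h.epos hr').le
      exact mul_neg_of_pos_of_neg (by linarith) (by linarith)
  have := anti ⟨le_rfl, hcb.le⟩ ⟨hcb.le, le_rfl⟩ hcb
  have h2 := Φge b hb
  simp only [Φc] at this
  linarith
end
section
variable {n k : ℕ} {α β T : ℝ} {f : Eu n → ℝ} {U : ℝ → Eu n → ℝ} {η : ℝ → ℝ}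
theorem hid (hk : k ≤ n) (hβ : 0 < β) (fp : ∀ x ∈ sph n, 0 < f x) {V : Eu n → ℝ} (hV : Gd V) {x : Eu n} (hx : x ∈ sph n) :
    f x ^ (-(1/β)) * V x ^ ((1 + β - α) / β) = gg k α β f V x ^ (-(1/β)) * (V x * sg k V x) := by
  have v := hV.p hx
  have s := hV.sgpos hk hx
  have ff := fp x hx
  rw [gg]
  generalize V x = v' at *
  generalize sg k V x = s' at *
  generalize f x = f' at *
  rw [← Real.exp_log v, ← Real.exp_log s, ← Real.exp_log ff]
  simp only [← Real.exp_mul, ← Real.exp_add]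
  congr 1
  field_simp
  ring
theorem Fl.zmono (h : Fl k α β T f U η) {t : ℝ} (ht : t ∈ Set.Ico 0 T) :
    ∫ x, f x ^ (-(1/β)) * U t x ^ ((1 + β - α) / β) ∂(mu n) ≤ ∫ x, f x ^ (-(1/β)) * U 0 x ^ ((1 + β - α) / β) ∂(mu n) := by
  have hβ := h.hβ
  set q := (1 + β - α) / β with hq
  have hq0 : 0 < q := div_pos (by linarith [h.αn]) hβ
  have cH : ContinuousOn (fun x => f x ^ (-(1/β))) (sph n) := h.fH.sm.cont.rpow_const fun x hx => Or.inl (h.fp x hx).ne'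
  refine antitoneOn_of_deriv_nonpos (f := fun s => ∫ x, f x ^ (-(1/β)) * U s x ^ q ∂(mu n)) (convex_Icc 0 t) (h.fc cH q ht.2)
    (fun r hr => ?_) (fun r hr => ?_) ⟨le_rfl, ht.1⟩ ⟨ht.1, le_rfl⟩ ht.1
  · rw [interior_Icc] at hr
    exact (h.fd cH q ⟨hr.1, hr.2.trans ht.2⟩).differentiableAt.differentiableWithinAt
  rw [interior_Icc] at hr
  have hr0 : r ∈ Set.Ioo 0 T := ⟨hr.1, hr.2.trans ht.2⟩
  have hr' := Set.Ioo_subset_Ico_self hr0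
  have he := h.epos hr'
  rw [(h.fd cH q hr0).deriv]
  have hV := h.gd r hr'
  have cV := hV.sm.cont
  have crV := hV.rc q
  have cg : ContinuousOn (gg k α β f (U r)) (sph n) := gg_cont h.hk h.fH.sm.cont hV
  have cs := (sg_sm k hV.sm).cont
  have e0 : ∫ x, (gg k α β f (U r) x - η r) * (U r x * sg k (U r) x) ∂(mu n) = 0 := by
    have : ∫ x, (gg k α β f (U r) x - η r) * (U r x * sg k (U r) x) ∂(mu n) = ∫ x, gg k α β f (U r) x * (U r x * sg k (U r) x) ∂(mu n) - η r * VV k (U r) := by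
      rw [VV, ← integral_const_mul, ← isub (by fun_prop) (by fun_prop)]
      exact int_congr fun x _ => by ring
    rw [this, ← h.et r hr', h.vol hr', sub_self]
  have le : ∫ x, f x ^ (-(1/β)) * (q * U r x ^ q * (gg k α β f (U r) x - η r)) ∂(mu n)
      ≤ ∫ x, q * (η r ^ (-(1/β)) * ((gg k α β f (U r) x - η r) * (U r x * sg k (U r) x))) ∂(mu n) := by
    refine int_mono (by fun_prop) (by fun_prop) fun x hx => ?_
    have id1 := hid (α := α) h.hk hβ h.fp hV hx
    have gp := gg_pos (α := α) (β := β) h.hk h.fp hV hx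
    have us := mul_pos (hV.p hx) (hV.sgpos h.hk hx)
    have eq1 : f x ^ (-(1/β)) * (q * U r x ^ q * (gg k α β f (U r) x - η r)) = q * ((f x ^ (-(1/β)) * U r x ^ q) * (gg k α β f (U r) x - η r)) := by ring
    rw [eq1, id1]
    refine mul_le_mul_of_nonneg_left ?_ hq0.le
    have neg : -(1/β) ≤ 0 := by have := one_div_pos.2 hβ; linarith
    have key : gg k α β f (U r) x ^ (-(1/β)) * (gg k α β f (U r) x - η r) ≤ η r ^ (-(1/β)) * (gg k α β f (U r) x - η r) := by
      rcases le_total (η r) (gg k α β f (U r) x) with hc | hc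
      · exact mul_le_mul_of_nonneg_right (Real.rpow_le_rpow_of_nonpos he hc neg) (by linarith)
      · exact mul_le_mul_of_nonpos_right (Real.rpow_le_rpow_of_nonpos gp hc neg) (by linarith)
    have := mul_le_mul_of_nonneg_right key us.le
    linarith
  refine le.trans_eq ?_
  rw [integral_const_mul, integral_const_mul, e0, mul_zero, mul_zero]
theorem Fl.low (h : Fl k α β T f U η) (hT : 0 < T) : ∃ c > 0, ∀ t ∈ Set.Ico 0 T, c ≤ η t := by
  have hβ := h.hβ
  have hS := sphVol_pos n
  have h0 : (0:ℝ) ∈ Set.Ico 0 T := ⟨le_rfl, hT⟩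
  have cH : ContinuousOn (fun x => f x ^ (-(1/β))) (sph n) := h.fH.sm.cont.rpow_const fun x hx => Or.inl (h.fp x hx).ne'
  set Z := ∫ x, f x ^ (-(1/β)) * U 0 x ^ ((1 + β - α) / β) ∂(mu n) with hZ
  have hZ0 : 0 < Z := int_pos (cH.mul ((h.gd 0 h0).rc _)) fun x hx => mul_pos (Real.rpow_pos_of_pos (h.fp x hx) _) (Real.rpow_pos_of_pos ((h.gd 0 h0).p hx) _)
  obtain ⟨m, hm0, hm⟩ : ∃ m > 0, m ^ (1/β) * Z = sphVol n / 2 := by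
    refine ⟨(sphVol n / (2 * Z)) ^ β, Real.rpow_pos_of_pos (by positivity) _, ?_⟩
    rw [← Real.rpow_mul (by positivity), mul_one_div_cancel hβ.ne', Real.rpow_one]; field_simp
  refine ⟨m / 2, by positivity, fun t ht => ?_⟩
  have hV := h.gd t ht
  have cV := hV.sm.cont
  have crV := hV.rc ((1 + β - α) / β)
  have cg : ContinuousOn (gg k α β f (U t)) (sph n) := gg_cont h.hk h.fH.sm.cont hV
  have cs := (sg_sm k hV.sm).cont
  have k1 : VV k (U t) ≤ m⁻¹ * (η t * sphVol n) + m ^ (1/β) * ∫ x, f x ^ (-(1/β)) * U t x ^ ((1 + β - α) / β) ∂(mu n) := by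
    rw [h.et t ht, VV, ← integral_const_mul, ← integral_const_mul, ← iadd (by fun_prop) (by fun_prop)]
    refine int_mono (by fun_prop) (by fun_prop) fun x hx => ?_
    rw [hid h.hk hβ h.fp hV hx]
    have gp := gg_pos (α := α) (β := β) h.hk h.fp hV hx
    have us := mul_pos (hV.p hx) (hV.sgpos h.hk hx)
    have key : 1 ≤ m⁻¹ * gg k α β f (U t) x + m ^ (1/β) * gg k α β f (U t) x ^ (-(1/β)) := by
      rcases le_total m (gg k α β f (U t) x) with hc | hc
      · have h1 : 1 ≤ m⁻¹ * gg k α β f (U t) x := by rw [inv_mul_eq_div, one_le_div hm0]; exact hc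
        have := mul_pos (Real.rpow_pos_of_pos hm0 (1/β)) (Real.rpow_pos_of_pos gp (-(1/β)))
        linarith
      · have h1 : 1 ≤ m ^ (1/β) * gg k α β f (U t) x ^ (-(1/β)) := by
          rw [Real.rpow_neg gp.le, ← div_eq_mul_inv, one_le_div (Real.rpow_pos_of_pos gp _)]
          exact Real.rpow_le_rpow gp.le hc (by positivity)
        have := mul_pos (inv_pos.2 hm0) gp
        linarith
    have := mul_le_mul_of_nonneg_right key us.le
    linarith
  have k2 := mul_le_mul_of_nonneg_left (h.zmono ht) (Real.rpow_pos_of_pos hm0 (1/β)).le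
  rw [← hZ, hm] at k2
  rw [h.vol ht] at k1
  have k3 : sphVol n / 2 ≤ m⁻¹ * (η t * sphVol n) := by linarith
  rw [inv_mul_eq_div, le_div_iff₀ hm0] at k3
  refine le_of_mul_le_mul_right ?_ hS
  linarith
end
theorem mkFl {k : ℕ} (hn : 2 ≤ n) (hk1 : 1 ≤ k) (hkn : k ≤ n)
    {α β T : ℝ} (hβ : 1 / (k : ℝ) < β) (hα : α ≤ 1 - k * β)
    {f : Eu n → ℝ} (hfs : SmoothOnSphere f) (hfp : PosOnSphere f)
    {u : ℝ → Eu n → ℝ} (hu : NormFlow n k α β f (Set.Ico 0 T) u) (hT : 0 < T) :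
    Fl k α β T (homExt f) (fun t => homExt (u t)) (fun t => eta n k α β f (u t)) := by
  obtain ⟨h1, h2, h3⟩ := hu
  have h0 : (0:ℝ) ∈ Set.Ico 0 T := ⟨le_rfl, hT⟩
  have hk0 : (0:ℝ) < k := by exact_mod_cast hk1
  have G : ∀ t ∈ Set.Ico 0 T, Gd (homExt (u t)) := fun t ht => Gd.of_good (h1 t ht)
  have up : ∀ t ∈ Set.Ico 0 T, ∀ x ∈ sph n, 0 < u t x := fun t ht => (h1 t ht).2.1
  have sp : ∀ t ∈ Set.Ico 0 T, ∀ x ∈ sph n, 0 < sigmaK n k (u t) x := fun t ht x hx => by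
    rw [sigmaK_eq hkn (h1 t ht).1 hx]; exact (G t ht).sgpos hkn hx
  have gE : ∀ t ∈ Set.Ico 0 T, ∀ x ∈ sph n, gg k α β (homExt f) (homExt (u t)) x = f x * u t x ^ (α - 1) * sigmaK n k (u t) x ^ β := fun t ht x hx => by
    rw [gg, homExt_sph _ hx, homExt_sph _ hx, sigmaK_eq hkn (h1 t ht).1 hx]
  have uα : ∀ t ∈ Set.Ico 0 T, ∀ x ∈ sph n, u t x ^ α = u t x ^ (α - 1) * u t x := fun t ht x hx => by
    rw [Real.rpow_sub_one (up t ht x hx).ne', div_mul_cancel₀ _ (up t ht x hx).ne']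
  refine ⟨hn, hk1, hkn, (by positivity : (0:ℝ) < 1 / k).trans hβ, ?_, by linarith, homExt_hg hfs, fun x hx => ?_, G, fun t => by simp [homExt], fun x hx t ht => ?_, fun t ht => ?_, ?_⟩
  · rw [div_lt_iff₀ hk0] at hβ; linarith
  · rw [homExt_sph _ hx]; exact hfp x hx
  · have e : (fun r => homExt (u r) x) = fun r => u r x := by ext r; exact homExt_sph _ hx
    rw [e]
    refine (h3 x hx t ht).congr_deriv ?_
    rw [gE t ht x hx, homExt_sph _ hx, uα t ht x hx]; ring
  · simp only [eta]
    rw [mul_comm, mul_inv_cancel_left₀ (sphVol_pos n).ne', sphInt_eq]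
    refine int_congr fun x hx => ?_
    rw [gE t ht x hx, homExt_sph _ hx, ← sigmaK_eq hkn (h1 t ht).1 hx, uα t ht x hx, Real.rpow_add (sp t ht x hx), Real.rpow_one]; ring
  · rw [← h2, sphInt_eq, VV]
    exact int_congr fun x hx => by rw [homExt_sph _ hx, sigmaK_eq hkn (h1 0 h0).1 hx]
theorem stmt5 (n k : ℕ) (hn : 2 ≤ n) (hk1 : 1 ≤ k) (hkn : k ≤ n)
    (α β T : ℝ) (hβ : 1 / (k : ℝ) < β) (hα : α ≤ 1 - k * β)
    (f : Eu n → ℝ) (hfs : SmoothOnSphere f) (hfp : PosOnSphere f)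
    (u : ℝ → Eu n → ℝ) (hu : NormFlow n k α β f (Set.Ico 0 T) u) :
    (∀ t₁ ∈ Set.Ico (0 : ℝ) T, ∀ t₂ ∈ Set.Ico (0 : ℝ) T, t₁ ≤ t₂ →
      eta n k α β f (u t₂) ≤ eta n k α β f (u t₁)) ∧
    ∃ c C : ℝ, 0 < c ∧ c ≤ C ∧
      ∀ t ∈ Set.Ico (0 : ℝ) T, c ≤ eta n k α β f (u t) ∧ eta n k α β f (u t) ≤ C := by
  rcases le_or_gt T 0 with hT | hT
  · have he : ∀ t ∈ Set.Ico (0:ℝ) T, False := fun t ht => by linarith [ht.1, ht.2]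
    exact ⟨fun t ht => (he t ht).elim, 1, 1, one_pos, le_rfl, fun t ht => (he t ht).elim⟩
  have h := mkFl hn hk1 hkn hβ hα hfs hfp hu hT
  have h0 : (0:ℝ) ∈ Set.Ico 0 T := ⟨le_rfl, hT⟩
  obtain ⟨c, hc, H⟩ := h.low hT
  exact ⟨fun t₁ h1 t₂ h2 hl => h.mono h1 h2 hl, c, eta n k α β f (u 0), hc, H 0 h0, fun t ht => ⟨H t ht, h.mono h0 ht ht.1⟩⟩
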